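/- Let k be a field of characteristic not 2 or 3, and let (A,−) and (A′,−) be central simple k-algebras with involution such that A is alternative and (dim A, dim Skew(A,−)) ≠ (8,3). Then (A,−) and (A′,−) are isotopic if and only if they are isomorphic as algebras with involution. -/

import Mathlib

open scoped TensorProduct

noncomputable section

universe u

/-- A unital, not necessarily associative, algebra with involution over a commutative ring. -/
structure AlgebraWithInvolution (R : Type u) [CommRing R] : Type (u + 1) where
  carrier : Type u
  [isNonAssocRing : NonAssocRing carrier]
  [isModule : Module R carrier]
  [isSMulCommClass : SMulCommClass R carrier carrier]
  [isScalarTower : IsScalarTower R carrier carrier]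
  invol : carrier →ₗ[R] carrier
  invol_one : invol 1 = 1
  invol_mul : ∀ x y : carrier, invol (x * y) = invol y * invol x
  invol_invol : ∀ x : carrier, invol (invol x) = x

namespace AlgebraWithInvolution

attribute [instance] isNonAssocRing isModule isSMulCommClass isScalarTower

instance {R : Type u} [CommRing R] : CoeSort (AlgebraWithInvolution R) (Type u) :=
  ⟨carrier⟩

variable {R : Type u} [CommRing R]

/-- The operator `V_{x,y} z = (x ȳ) z + (z ȳ) x − (z x̄) y` of a (candidate) structurable
algebra. -/
def Vop (A : AlgebraWithInvolution R) (x y z : A) : A :=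
  (x * A.invol y) * z + (z * A.invol y) * x - (z * A.invol x) * y

/-- `(A,−)` is a structurable algebra:
`[V_{x,y}, V_{z,w}] = V_{V_{x,y} z, w} − V_{z, V_{y,x} w}`. -/
def IsStructurable (A : AlgebraWithInvolution R) : Prop :=
  ∀ x y z w v : A,
    A.Vop x y (A.Vop z w v) - A.Vop z w (A.Vop x y v) =
      A.Vop (A.Vop x y z) w v - A.Vop z (A.Vop y x w) v

/-- An element `x` is conjugate-invertible if `V_{x,y} = id` for some `y`. -/
def ConjInvertible (A : AlgebraWithInvolution R) (x : A) : Prop :=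
  ∃ y : A, ∀ z : A, A.Vop x y z = z

/-- A structurable division algebra: every nonzero element is conjugate-invertible. -/
def IsStructurableDivisionAlgebra (A : AlgebraWithInvolution R) : Prop :=
  ∀ x : A, x ≠ 0 → A.ConjInvertible x

/-- The submodule of skew elements of an algebra with involution. -/
def skew (A : AlgebraWithInvolution R) : Submodule R A.carrier where
  carrier := {a | A.invol a = -a}
  add_mem' := by
    intro a b ha hb
    simp only [Set.mem_setOf_eq, map_add] at *
    rw [ha, hb, neg_add]
  zero_mem' := by simp
  smul_mem' := by
    intro c a ha
    simp only [Set.mem_setOf_eq, map_smul] at *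
    rw [ha, smul_neg]

/-- `ψ(x,y) = x ȳ − y x̄`. -/
def psi (A : AlgebraWithInvolution R) (x y : A) : A :=
  x * A.invol y - y * A.invol x

/-- Isomorphisms of algebras with involution. -/
structure Iso (A B : AlgebraWithInvolution R) where
  toLinearEquiv : A.carrier ≃ₗ[R] B.carrier
  map_mul : ∀ x y : A, toLinearEquiv (x * y) = toLinearEquiv x * toLinearEquiv y
  map_one : toLinearEquiv 1 = 1
  map_invol : ∀ x : A, toLinearEquiv (A.invol x) = B.invol (toLinearEquiv x)

/-- Isotopies of (structurable) algebras with involution: pairs `(α, α̂)` of linear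
bijections with `α ∘ V_{x,y} ∘ α⁻¹ = V_{α x, α̂ y}`. -/
structure Isotopy (A B : AlgebraWithInvolution R) where
  toLinearEquiv : A.carrier ≃ₗ[R] B.carrier
  hat : A.carrier ≃ₗ[R] B.carrier
  map_Vop : ∀ x y z : A,
    toLinearEquiv (A.Vop x y z) = B.Vop (toLinearEquiv x) (hat y) (toLinearEquiv z)

/-- Two algebras with involution are isotopic if there is an isotopy between them. -/
def IsIsotopic (A B : AlgebraWithInvolution R) : Prop :=
  Nonempty (A.Isotopy B)

/-- The tensor product of two algebras with involution. -/
def tensor (A B : AlgebraWithInvolution R) : AlgebraWithInvolution R where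
  carrier := A.carrier ⊗[R] B.carrier
  invol := TensorProduct.map A.invol B.invol
  invol_one := by
    simp [Algebra.TensorProduct.one_def, A.invol_one, B.invol_one]
  invol_mul := by
    intro x y
    induction x with
    | zero => simp
    | tmul a b =>
      induction y with
      | zero => simp
      | tmul c d =>
        simp [Algebra.TensorProduct.tmul_mul_tmul, A.invol_mul, B.invol_mul]
      | add u v hu hv =>
        simp only [mul_add, map_add, hu, hv, add_mul]
    | add u v hu hv =>
      simp only [add_mul, map_add, hu, hv, mul_add]
  invol_invol := by
    intro x
    induction x with
    | zero => simp
    | tmul a b => simp [A.invol_invol, B.invol_invol]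
    | add u v hu hv => simp [hu, hv]

/-- Base change of an algebra with involution along `R → S`. -/
def baseChange (A : AlgebraWithInvolution R) (S : Type u) [CommRing S] [Algebra R S] :
    AlgebraWithInvolution S where
  carrier := S ⊗[R] A.carrier
  invol := LinearMap.baseChange S A.invol
  invol_one := by
    simp [Algebra.TensorProduct.one_def, A.invol_one]
  invol_mul := by
    intro x y
    induction x with
    | zero => simp
    | tmul s a =>
      induction y with
      | zero => simp
      | tmul t b =>
        simp only [Algebra.TensorProduct.tmul_mul_tmul, LinearMap.baseChange_tmul,
          A.invol_mul, mul_comm s t]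
      | add u v hu hv =>
        simp only [mul_add, map_add, hu, hv, add_mul]
    | add u v hu hv =>
      simp only [add_mul, map_add, hu, hv, mul_add]
  invol_invol := by
    intro x
    induction x with
    | zero => simp
    | tmul s a => simp [A.invol_invol]
    | add u v hu hv => simp [hu, hv]

end AlgebraWithInvolution

/-- A composition algebra over a field `F`: a unital (possibly non-associative) algebra with a
nondegenerate multiplicative quadratic form, together with its standard involution
`x̄ = b(x,1)·1 − x` (where `b` is the polar form of the norm). -/
structure CompositionAlgebra (F : Type u) [Field F] : Type (u + 1) where
  carrier : Type u
  [isNonAssocRing : NonAssocRing carrier]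
  [isModule : Module F carrier]
  [isSMulCommClass : SMulCommClass F carrier carrier]
  [isScalarTower : IsScalarTower F carrier carrier]
  [isFinite : FiniteDimensional F carrier]
  norm : QuadraticForm F carrier
  norm_one : norm 1 = 1
  norm_mul : ∀ x y : carrier, norm (x * y) = norm x * norm y
  nondegenerate : ∀ x : carrier, (∀ y : carrier, norm (x + y) - norm x - norm y = 0) → x = 0
  conj : carrier →ₗ[F] carrier
  conj_def : ∀ x : carrier, conj x = (norm (x + 1) - norm x - norm 1) • (1 : carrier) - x
  conj_one : conj 1 = 1
  conj_mul : ∀ x y : carrier, conj (x * y) = conj y * conj x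
  conj_conj : ∀ x : carrier, conj (conj x) = x

namespace CompositionAlgebra

attribute [instance] isNonAssocRing isModule isSMulCommClass isScalarTower isFinite

variable {F : Type u} [Field F]

/-- A composition algebra, viewed as an algebra with its standard involution. -/
def toAWI (C : CompositionAlgebra F) : AlgebraWithInvolution F where
  carrier := C.carrier
  invol := C.conj
  invol_one := C.conj_one
  invol_mul := C.conj_mul
  invol_invol := C.conj_conj

end CompositionAlgebra

/-- A splitting datum witnessing that `(A,−)` is an `(m₁, m₂)`-product algebra: a field
extension `K/k` over which `(A,−)` becomes isomorphic, as an algebra with involution, to the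
tensor product of two composition algebras (with their standard involutions) of dimensions
`m₁` and `m₂`. -/
structure ProductAlgebraSplitting {k : Type u} [Field k]
    (A : AlgebraWithInvolution k) (m₁ m₂ : ℕ) : Type (u + 1) where
  K : Type u
  [fieldK : Field K]
  [algK : Algebra k K]
  C₁ : CompositionAlgebra K
  C₂ : CompositionAlgebra K
  finrank₁ : Module.finrank K C₁.carrier = m₁
  finrank₂ : Module.finrank K C₂.carrier = m₂
  iso : (A.baseChange K).Iso (C₁.toAWI.tensor C₂.toAWI)

attribute [instance] ProductAlgebraSplitting.fieldK ProductAlgebraSplitting.algK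

/-- `(A,−)` is an `(m₁, m₂)`-product algebra. -/
def IsProductAlgebra {k : Type u} [Field k] (A : AlgebraWithInvolution k) (m₁ m₂ : ℕ) : Prop :=
  Nonempty (ProductAlgebraSplitting A m₁ m₂)

/-- An Albert form of an `(m₁,m₂)`-product algebra `(A,−)`: a quadratic form `Q` on the space
of skew elements, together with the `♮`-map, satisfying `L_s ∘ L_{s♮} = −Q(s)·id` and such that
`Q(s) ≠ 0` iff left multiplication by `s` is invertible. -/
structure AlbertForm {k : Type u} [Field k] (A : AlgebraWithInvolution k) where
  Q : QuadraticForm k A.skew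
  natMap : A.skew →ₗ[k] A.skew
  mul_natMap : ∀ (s : A.skew) (a : A.carrier),
    (s : A.carrier) * ((natMap s : A.carrier) * a) = -(Q s) • a
  nonzero_iff : ∀ s : A.skew,
    Q s ≠ 0 ↔ Function.Bijective fun a : A.carrier => (s : A.carrier) * a

end

/-- A unital nonassociative ring is alternative if it satisfies the left and right alternative
laws. -/
class IsAlternativeRing (A : Type*) [NonAssocRing A] : Prop where
  left_alt : ∀ x y : A, x * (x * y) = (x * x) * y
  right_alt : ∀ x y : A, (y * x) * x = y * (x * x)

namespace IsAlternativeRing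

section Basic

variable {A : Type*} [NonAssocRing A]

theorem assoc_add_left (x x' y z : A) :
    associator (x + x') y z = associator x y z + associator x' y z := by
  simp only [associator, add_mul]; abel

theorem assoc_add_mid (x y y' z : A) :
    associator x (y + y') z = associator x y z + associator x y' z := by
  simp only [associator, mul_add, add_mul]; abel

theorem assoc_add_right (x y z z' : A) :
    associator x y (z + z') = associator x y z + associator x y z' := by
  simp only [associator, mul_add]; abel

/-- The Teichmüller identity. -/
theorem teichmuller (w x y z : A) :
    associator (w * x) y z - associator w (x * y) z + associator w x (y * z) =
      w * associator x y z + associator w x y * z := by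
  simp only [associator, mul_sub, sub_mul]; abel

variable [IsAlternativeRing A]

theorem assoc_self_left (x y : A) : associator x x y = 0 := by
  rw [associator, left_alt, sub_self]

theorem assoc_self_right (x y : A) : associator y x x = 0 := by
  rw [associator, right_alt, sub_self]

theorem assoc_swap_left (x y z : A) : associator y x z = -associator x y z := by
  have h := assoc_self_left (x + y) z
  rw [assoc_add_left, assoc_add_mid, assoc_add_mid, assoc_self_left, assoc_self_left] at h
  rw [eq_neg_iff_add_eq_zero, ← h]; abel

theorem assoc_swap_right (x y z : A) : associator x z y = -associator x y z := by
  have h := assoc_self_right (y + z) x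
  rw [assoc_add_right, assoc_add_mid, assoc_add_mid, assoc_self_right, assoc_self_right] at h
  rw [eq_neg_iff_add_eq_zero, ← h]; abel

theorem assoc_cyclic (x y z : A) : associator y z x = associator x y z := by
  rw [assoc_swap_right, assoc_swap_left, neg_neg]

theorem assoc_reverse (x y z : A) : associator z y x = -associator x y z := by
  rw [assoc_swap_left, assoc_cyclic]

theorem assoc_flex (x y : A) : associator x y x = 0 := by
  rw [assoc_swap_right, assoc_self_left, neg_zero]

theorem flexible (x y : A) : (x * y) * x = x * (y * x) :=
  sub_eq_zero.1 (assoc_flex x y)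

theorem assoc_mul_left_mid (x y z : A) :
    associator x (x * y) z = associator x y z * x ∧
      associator x (y * x) z = x * associator x y z := by
  have h2 : ∀ z y : A, associator (x * x) y z =
      associator x (y * x) z + associator x y z * x := by
    intro z y
    have h := teichmuller z y x x
    rw [assoc_self_right, assoc_self_right, mul_zero, assoc_reverse (x * x),
      assoc_reverse x, assoc_reverse x y z, neg_mul] at h
    grind
  have h3 := teichmuller y x x z
  rw [assoc_self_left, assoc_self_right, mul_zero, zero_mul, assoc_swap_left x,
    assoc_swap_left (x * x), assoc_swap_left x y] at h3
  have h4 := teichmuller z x x y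
  rw [assoc_self_left, assoc_self_right, mul_zero, zero_mul, assoc_swap_left x,
    assoc_swap_left (x * x), assoc_swap_left x z, assoc_swap_right (x * x)] at h4
  have h1 := teichmuller x x y z
  rw [assoc_self_left x y, assoc_self_left, zero_mul] at h1
  have h1' := teichmuller x x z y
  rw [assoc_self_left x z, assoc_self_left, zero_mul, assoc_swap_right (x * x),
    assoc_swap_right x y z,
    mul_neg] at h1'
  have e1 := h2 z y
  have e2 := h2 y z
  rw [assoc_swap_right (x * x), assoc_swap_right x y z, neg_mul] at e2
  rw [assoc_swap_right x (x * y) z] at h4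
  rw [assoc_swap_right x (x * z) y] at h3
  constructor <;> grind

theorem assoc_mul_left (x y z : A) : associator x (x * y) z = associator x y z * x :=
  (assoc_mul_left_mid x y z).1

theorem assoc_mul_right (x y z : A) : associator x (y * x) z = x * associator x y z :=
  (assoc_mul_left_mid x y z).2

theorem moufang_left (a b c : A) : ((a * b) * a) * c = a * (b * (a * c)) := by
  have h : ((a * b) * a) * c - a * (b * (a * c)) =
      associator (a * b) a c + associator a b (a * c) := by
    simp only [associator]; abel
  rw [assoc_swap_left, assoc_swap_right _ (a * c), assoc_mul_left, assoc_mul_left,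
    assoc_swap_right a b c, neg_mul] at h
  grind

theorem moufang_right (a b c : A) : ((c * a) * b) * a = c * (a * (b * a)) := by
  have h : ((c * a) * b) * a - c * (a * (b * a)) =
      associator (c * a) b a + associator c a (b * a) := by
    simp only [associator]; abel
  have h1 : associator (c * a) b a = a * associator a c b := by
    rw [← assoc_mul_right, assoc_cyclic a]
  have h2 : associator c a (b * a) = a * associator a b c := by
    rw [← assoc_mul_right, ← assoc_cyclic c]
  rw [h1, h2, assoc_swap_right a b c,
    mul_neg] at h
  grind

theorem moufang_mid (a b c : A) : (a * b) * (c * a) = (a * (b * c)) * a := by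
  have h : (a * b) * (c * a) - (a * ((b * c) * a)) =
      associator a b (c * a) - a * associator b c a := by
    simp only [associator, mul_sub]; abel
  rw [assoc_swap_right _ (c * a), assoc_mul_right, assoc_cyclic a b c, assoc_swap_right a b c,
    mul_neg] at h
  rw [flexible]
  grind

/-- A two-sided inverse whose multiplications are inverse to those of `s`. -/
structure IsInv (s t : A) : Prop where
  mul_left : ∀ x, s * (t * x) = x
  left_mul : ∀ x, t * (s * x) = x
  mul_right : ∀ x, (x * t) * s = x
  right_mul : ∀ x, (x * s) * t = x

omit [IsAlternativeRing A] in
theorem IsInv.symm {s t : A} (h : IsInv s t) : IsInv t s :=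
  ⟨h.2, h.1, h.4, h.3⟩

omit [IsAlternativeRing A] in
theorem IsInv.mul_eq {s t : A} (h : IsInv s t) : s * t = 1 := by
  simpa using h.1 1

/-- `U_{sx} = L_s U_x R_s`. -/
theorem U_mul_left {s t : A} (h : IsInv s t) (x c : A) :
    ((s * x) * c) * (s * x) = s * ((x * (c * s)) * x) := by
  obtain ⟨r, rfl⟩ : ∃ r, c = r * s := ⟨c * t, (h.mul_right c).symm⟩
  rw [moufang_mid, moufang_left, right_alt, ← moufang_mid, left_alt]

/-- `U_{xs} = R_s U_x L_s`. -/
theorem U_mul_right {s t : A} (h : IsInv s t) (x c : A) :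
    (x * s) * (c * (x * s)) = (x * ((s * c) * x)) * s := by
  obtain ⟨r, rfl⟩ : ∃ r, c = s * r := ⟨t * c, (h.mul_left c).symm⟩
  rw [moufang_mid, flexible s, ← moufang_right, right_alt, moufang_mid, left_alt, flexible]

end Basic

end IsAlternativeRing

namespace IsAlternativeRing

section Operators

variable {k A : Type*} [CommRing k] [NonAssocRing A] [Module k A] [SMulCommClass k A A]
  [IsScalarTower k A A]

/-- Left multiplication by an invertible element. -/
def IsInv.leftEquiv (k : Type*) [CommRing k] [Module k A] [SMulCommClass k A A]
    {s t : A} (h : IsInv s t) : A ≃ₗ[k] A :=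
  { LinearMap.mulLeft k s with
    invFun := fun x => t * x
    left_inv := h.left_mul
    right_inv := h.mul_left }

/-- Right multiplication by an invertible element. -/
def IsInv.rightEquiv (k : Type*) [CommRing k] [Module k A] [IsScalarTower k A A]
    {s t : A} (h : IsInv s t) : A ≃ₗ[k] A :=
  { LinearMap.mulRight k s with
    invFun := fun x => x * t
    left_inv := h.right_mul
    right_inv := h.mul_right }

omit [IsScalarTower k A A] in
@[simp] theorem IsInv.leftEquiv_apply {s t : A} (h : IsInv s t) (x : A) :
    h.leftEquiv k x = s * x := rfl

omit [SMulCommClass k A A] in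
@[simp] theorem IsInv.rightEquiv_apply {s t : A} (h : IsInv s t) (x : A) :
    h.rightEquiv k x = x * s := rfl

variable [IsAlternativeRing A]

theorem U_mul_left_polar {s t : A} (h : IsInv s t) (x c z : A) :
    ((s * x) * c) * (s * z) + ((s * z) * c) * (s * x) =
      s * ((x * (c * s)) * z + (z * (c * s)) * x) := by
  have h1 := U_mul_left h (x + z) c
  have h2 := U_mul_left h x c
  have h3 := U_mul_left h z c
  simp only [mul_add, add_mul] at h1 h2 h3 ⊢
  grind

theorem U_mul_right_polar {s t : A} (h : IsInv s t) (x c z : A) :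
    ((x * s) * c) * (z * s) + ((z * s) * c) * (x * s) =
      ((x * (s * c)) * z + (z * (s * c)) * x) * s := by
  have h1 := U_mul_right h (x + z) c
  have h2 := U_mul_right h x c
  have h3 := U_mul_right h z c
  simp only [← flexible] at h1 h2 h3
  simp only [mul_add, add_mul] at h1 h2 h3 ⊢
  grind

omit [Module k A] [SMulCommClass k A A] [IsScalarTower k A A] [IsAlternativeRing A] in
theorem assoc_of_mem_center {c : A} (hc : c ∈ Set.center A) (x y : A) :
    associator c x y = 0 ∧ associator x c y = 0 ∧ associator x y c = 0 := by
  have hc := (Set.mem_center_iff.1 hc)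
  have h1 : associator c x y = 0 := by rw [associator, hc.left_assoc, sub_self]
  refine ⟨h1, ?_, ?_⟩
  · rw [associator, hc.mid_assoc, sub_self]
  · rw [associator, hc.right_assoc, sub_self]

/-- If `a + b` is central then `b` associates and commutes with the inverse of `a`. -/
theorem assoc_inv_of_add_mem_center {a a' b : A} (h : IsInv a a')
    (hc : a + b ∈ Set.center A) :
    (∀ x, associator b x a' = 0) ∧ b * a' = a' * b := by
  have h0 : ∀ x, associator b x a = 0 := by
    intro x
    have h1 := (assoc_of_mem_center hc x a).1
    rwa [assoc_add_left, assoc_flex, zero_add] at h1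
  have hab : a * b = b * a := by
    have h1 := (Set.mem_center_iff.1 hc).comm a
    rw [Commute, SemiconjBy, add_mul, mul_add] at h1
    grind
  refine ⟨fun x => ?_, ?_⟩
  · have h1 := h0 (x * a')
    rw [associator, h.mul_right] at h1
    have h2 := congrArg (· * a') (sub_eq_zero.1 h1)
    simp only [h.right_mul] at h2
    rw [associator, h2, sub_self]
  · have h1 : a * (b * a') = (a * b) * a' := by
      have h2 := h0 a'
      rw [← assoc_cyclic, ← assoc_cyclic] at h2
      exact (sub_eq_zero.1 h2).symm
    rw [hab, h.right_mul] at h1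
    rw [← h1, h.left_mul, h1]

end Operators

end IsAlternativeRing

namespace AlgebraWithInvolution

open IsAlternativeRing

variable {k : Type*} [Field k] {A B C : AlgebraWithInvolution k}

/-- Isomorphic algebras with involution are isotopic. -/
def Iso.toIsotopy (f : A.Iso B) : A.Isotopy B where
  toLinearEquiv := f.toLinearEquiv
  hat := f.toLinearEquiv
  map_Vop x y z := by simp [Vop, f.map_mul, f.map_invol]

/-- Composition of isotopies. -/
def Isotopy.trans (f : A.Isotopy B) (g : B.Isotopy C) : A.Isotopy C where
  toLinearEquiv := f.toLinearEquiv.trans g.toLinearEquiv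
  hat := f.hat.trans g.hat
  map_Vop x y z := by simp [f.map_Vop, g.map_Vop]

theorem _root_.IsAlternativeRing.IsInv.invol {s t : A} (h : IsInv s t) :
    IsInv (A.invol s) (A.invol t) := by
  constructor <;> intro x <;> rw [← A.invol_invol x, ← A.invol_mul, ← A.invol_mul]
  · rw [h.mul_right]
  · rw [h.right_mul]
  · rw [h.mul_left]
  · rw [h.left_mul]

/-- Left multiplication by an invertible element of an associative algebra is an isotopy. -/
def isotopyOfAssoc (hassoc : ∀ x y z : A, associator x y z = 0) {s t : A} (h : IsInv s t) :
    A.Isotopy A where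
  toLinearEquiv := h.leftEquiv k
  hat := h.symm.invol.leftEquiv k
  map_Vop x y z := by
    have ha : ∀ x y z : A, (x * y) * z = x * (y * z) := fun x y z => sub_eq_zero.1 (hassoc x y z)
    simp only [Vop, IsInv.leftEquiv_apply, A.invol_mul, A.invol_invol, mul_add, mul_sub, ha,
      h.left_mul, h.invol.mul_left]

/-- Left multiplication by an invertible central element is an isotopy. -/
def isotopyOfCenter {s t : A} (h : IsInv s t) (hs : s ∈ Set.center A.carrier)
    (ht : t ∈ Set.center A.carrier) (hs' : A.invol s ∈ Set.center A.carrier)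
    (ht' : A.invol t ∈ Set.center A.carrier) :
    A.Isotopy A where
  toLinearEquiv := h.leftEquiv k
  hat := h.symm.invol.leftEquiv k
  map_Vop x y z := by
    have h1 : ∀ c : A, c ∈ Set.center A.carrier → ∀ x y : A, (c * x) * y = c * (x * y) :=
      fun c hc x y => ((Set.mem_center_iff.1 hc).left_assoc x y).symm
    have h2 : ∀ c : A, c ∈ Set.center A.carrier → ∀ x y : A, x * (c * y) = c * (x * y) := by
      intro c hc x y
      have h := Set.mem_center_iff.1 hc
      rw [(h.comm y).eq, ← h.right_assoc, (h.comm (x * y)).eq]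
    have e1 : ∀ x y z : A, ((s * x) * (y * t)) * (s * z) = s * ((x * y) * z) := by
      intro x y z
      rw [← ((Set.mem_center_iff.1 ht).comm y).eq, h1 _ hs, h2 _ ht, h.mul_left, h2 _ hs]
    have e2 : ∀ x y z : A, ((s * x) * (y * A.invol s)) * (A.invol t * z) = s * ((x * y) * z) := by
      intro x y z
      rw [← ((Set.mem_center_iff.1 hs').comm y).eq, h2 _ hs', h1 _ hs', h2 _ ht',
        h.invol.mul_left, h1 _ hs, h1 _ hs]
    simp only [Vop, IsInv.leftEquiv_apply, A.invol_mul, A.invol_invol, mul_add, mul_sub, e1, e2]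

variable [IsAlternativeRing A.carrier]

/-- Left multiplication by an invertible skew element is an isotopy. -/
def isotopyOfSkew {s t : A} (h : IsInv s t) (hs : A.invol s = -s) : A.Isotopy A where
  toLinearEquiv := h.leftEquiv k
  hat := (h.symm.leftEquiv k).trans (LinearEquiv.neg k)
  map_Vop x y z := by
    have ht : A.invol t = -t := by
      have h1 : t * s = 1 := h.symm.mul_eq
      have h2 := congrArg A.invol h1
      rw [A.invol_mul, hs, A.invol_one, neg_mul] at h2
      have h3 := h.left_mul (A.invol t)
      rw [neg_eq_iff_eq_neg.1 h2, mul_neg, mul_one] at h3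
      exact h3.symm
    have h1 := U_mul_left_polar h x (A.invol y * t) z
    rw [h.mul_right] at h1
    have h2 : s * ((z * A.invol x) * y) = ((s * z) * (A.invol x * s)) * (t * y) := by
      rw [moufang_mid, moufang_left, h.mul_left]
    simp only [Vop, IsInv.leftEquiv_apply, LinearEquiv.trans_apply, LinearEquiv.neg_apply, map_neg,
      A.invol_mul, hs, ht, mul_neg, neg_neg, neg_mul, mul_sub, h2, ← h1]

/-- For `a + ā` central and `a` invertible, `x ↦ a (x ā⁻¹) a` is an isotopy. -/
def isotopyOfTrace {a a' : A} (h : IsInv a a') (hc : a + A.invol a ∈ Set.center A.carrier) :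
    A.Isotopy A where
  toLinearEquiv := (h.symm.invol.rightEquiv k).trans ((h.leftEquiv k).trans (h.rightEquiv k))
  hat := (h.symm.invol.rightEquiv k).trans ((h.symm.invol.leftEquiv k).trans (h.rightEquiv k))
  map_Vop x y z := by
    have hb := h.invol
    obtain ⟨h1, h2⟩ := assoc_inv_of_add_mem_center h hc
    set b := A.invol a' with hb_def
    set b' := A.invol a with hb'_def
    have h3 : ∀ x, b' * (x * a') = (b' * x) * a' := fun x => (sub_eq_zero.1 (h1 x)).symm
    have h4 : ∀ x, (a' * x) * b' = a' * (x * b') := fun x => by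
      have := h1 x
      rw [assoc_reverse, neg_eq_zero] at this
      exact sub_eq_zero.1 this
    have h5 : ∀ x, b' * (a' * x) = a' * (b' * x) := fun x => by
      have e1 := h1 x
      rw [assoc_swap_right, neg_eq_zero] at e1
      have e2 := e1
      rw [assoc_swap_left, neg_eq_zero] at e2
      rw [← sub_eq_zero.1 e1, ← sub_eq_zero.1 e2, h2]
    have e1 : ∀ y : A, A.invol ((b * (y * b)) * a) = a' * ((b' * A.invol y) * a') := fun y => by
      rw [A.invol_mul, A.invol_mul, A.invol_mul, hb_def, A.invol_invol, ← hb'_def, flexible, h5, h3]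
    have e2 : ∀ x : A, A.invol ((a * (x * b)) * a) = a' * ((b' * A.invol x) * b') := fun x => by
      rw [A.invol_mul, A.invol_mul, A.invol_mul, hb_def, A.invol_invol, ← hb'_def, ← flexible, h5,
        h4]
    have e3 : ((a * (x * b)) * a) * (a' * ((b' * A.invol y) * a')) * ((a * (z * b)) * a) +
        ((a * (z * b)) * a) * (a' * ((b' * A.invol y) * a')) * ((a * (x * b)) * a) =
        (a * (((x * A.invol y) * z + (z * A.invol y) * x) * b)) * a := by
      rw [U_mul_right_polar h, U_mul_left_polar h, h.mul_left, h.mul_right,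
        U_mul_right_polar hb.symm, hb.symm.mul_left]
    have e4 : (((a * (z * b)) * a) * (a' * ((b' * A.invol x) * b'))) * ((b * (y * b)) * a) =
        (a * (((z * A.invol x) * y) * b)) * a := by
      rw [moufang_left, h.mul_left, flexible b', ← moufang_right, hb.mul_right, moufang_mid,
        ← moufang_right, hb.right_mul]
    simp only [Vop, LinearEquiv.trans_apply, IsInv.leftEquiv_apply, IsInv.rightEquiv_apply]
    simp only [← hb_def, e1, e2, sub_mul, mul_sub, e4, ← e3]

end AlgebraWithInvolution

namespace AlgebraWithInvolution

open IsAlternativeRing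

section Isotopies

variable {k : Type*} [Field k] {A B : AlgebraWithInvolution k}

/-- An isotopy preserving the unit element is an isomorphism. -/
def Isotopy.toIso (hk3 : (3 : k) ≠ 0) (f : A.Isotopy B) (h1 : f.toLinearEquiv 1 = 1) :
    A.Iso B := by
  have h3 : ∀ x : B, x + x + x = 0 → x = 0 := by
    intro x hx
    have : (3 : k) • x = 0 := by
      rw [← hx]; module
    exact (smul_eq_zero.1 this).resolve_left hk3
  have hV := f.map_Vop 1
  simp only [Vop, h1, A.invol_one, B.invol_one, one_mul, mul_one] at hV
  have hhat : f.hat 1 = 1 := by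
    have e1 := hV 1 1
    simp only [h1, A.invol_one, one_mul, mul_one] at e1
    have e2 := congrArg B.invol e1
    simp only [map_add, map_sub, B.invol_invol, h1, B.invol_one] at e2
    rw [add_sub_cancel_right, h1] at e1
    have e3 := h3 (B.invol (f.hat 1) - f.hat 1)
      (by linear_combination (norm := abel) e2 - e1)
    linear_combination (norm := abel) - e1 - e3 - e3
  have hT : ∀ x z : A, f.toLinearEquiv (x * z) + f.toLinearEquiv (z * x) -
      f.toLinearEquiv (z * A.invol x) = f.toLinearEquiv x * f.toLinearEquiv z +
      f.toLinearEquiv z * f.toLinearEquiv x -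
      f.toLinearEquiv z * B.invol (f.toLinearEquiv x) := by
    intro x z
    have h := f.map_Vop x 1 z
    simpa only [Vop, hhat, A.invol_one, B.invol_one, mul_one, map_add, map_sub] using h
  have hinv : ∀ x : A, f.toLinearEquiv (A.invol x) = B.invol (f.toLinearEquiv x) := by
    intro x
    have h := hT x 1
    simp only [h1, one_mul, mul_one] at h
    grind
  let D : A → A → B := fun x z =>
    f.toLinearEquiv (x * z) - f.toLinearEquiv x * f.toLinearEquiv z
  have hD1 : ∀ x z, D x z + D z x - D z (A.invol x) = 0 := by
    intro x z
    have h := hT x z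
    simp only [D, hinv]
    grind
  have hDinv : ∀ x z, B.invol (D x z) = D (A.invol z) (A.invol x) := by
    intro x z
    simp only [D, map_sub, B.invol_mul, ← hinv, A.invol_mul]
  have hD2 : ∀ x z, D z (A.invol x) + D (A.invol x) z - D x z = 0 := by
    intro x z
    have h := congrArg B.invol (hD1 x (A.invol z))
    simpa only [map_add, map_sub, map_zero, hDinv, A.invol_invol] using h
  have hD3 : ∀ x z, D z x + D (A.invol x) z = 0 := by
    intro x z
    have e1 := hD1 x z
    have e2 := hD2 x z
    grind
  have hD4 : ∀ x z, D x z + D x z + D z x = 0 := by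
    intro x z
    have e1 := hD1 x z
    have e2 := hD3 (A.invol x) z
    rw [A.invol_invol] at e2
    grind
  refine ⟨f.toLinearEquiv, fun x y => ?_, h1, hinv⟩
  have e1 := hD4 x y
  have e2 := hD4 y x
  exact sub_eq_zero.1 (h3 (D x y) (by grind))

theorem Isotopy.nonempty_iso (hk3 : (3 : k) ≠ 0) (f : A.Isotopy B) (g : A.Isotopy A)
    (h : g.toLinearEquiv 1 = f.toLinearEquiv.symm 1) : Nonempty (A.Iso B) :=
  ⟨(g.trans f).toIso hk3 (by simp [Isotopy.trans, h])⟩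

/-- The operator `y ↦ V_{u,y} u` is surjective if `u` is sent to `1` by an isotopy. -/
theorem Isotopy.exists_Vop_eq (hk3 : (3 : k) ≠ 0) (f : A.Isotopy B) (w : A) :
    ∃ y, A.Vop (f.toLinearEquiv.symm 1) y (f.toLinearEquiv.symm 1) = w := by
  obtain ⟨y, hy⟩ := f.hat.surjective
    ((3 : k)⁻¹ • ((2 : k) • B.invol (f.toLinearEquiv w) + f.toLinearEquiv w))
  refine ⟨y, f.toLinearEquiv.injective ?_⟩
  rw [f.map_Vop, hy]
  simp only [LinearEquiv.apply_symm_apply, Vop, one_mul, mul_one, map_smul, map_add,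
    B.invol_invol, B.invol_one]
  match_scalars <;> field_simp <;> ring

/-- An associative algebra with involution is isomorphic to its isotopes. -/
theorem Isotopy.nonempty_iso_of_assoc [Module.Finite k A.carrier] (hk3 : (3 : k) ≠ 0)
    (f : A.Isotopy B) (hassoc : ∀ x y z : A, associator x y z = 0) : Nonempty (A.Iso B) := by
  have ha : ∀ x y z : A, (x * y) * z = x * (y * z) := fun x y z => sub_eq_zero.1 (hassoc x y z)
  set u := f.toLinearEquiv.symm 1 with hu
  have hsurj : Function.Surjective (LinearMap.mulLeft k u) := by
    intro w
    obtain ⟨y, hy⟩ := f.exists_Vop_eq hk3 w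
    refine ⟨A.invol y * u + A.invol y * u - A.invol u * y, ?_⟩
    rw [← hy]
    simp only [LinearMap.mulLeft_apply, Vop, mul_add, mul_sub, ha, ← hu]
  have hinj := LinearMap.injective_iff_surjective.2 hsurj
  obtain ⟨v, hv⟩ := hsurj 1
  rw [LinearMap.mulLeft_apply] at hv
  have hv' : v * u = 1 := hinj (by simp [← ha, hv])
  have h : IsInv u v :=
    ⟨fun x => by rw [← ha, hv, one_mul], fun x => by rw [← ha, hv', one_mul],
      fun x => by rw [ha, hv', mul_one], fun x => by rw [ha, hv, mul_one]⟩
  exact f.nonempty_iso hk3 (isotopyOfAssoc hassoc h) (by simp [isotopyOfAssoc, hu])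

end Isotopies

end AlgebraWithInvolution

namespace IsAlternativeRing

section Scalar

variable {R B : Type*} [NonAssocRing B]

theorem assoc_one_left (x y : B) : associator 1 x y = 0 := by simp [associator]

theorem assoc_one_mid (x y : B) : associator x 1 y = 0 := by simp [associator]

theorem assoc_one_right (x y : B) : associator x y 1 = 0 := by simp [associator]

variable [CommRing R] [Module R B]

theorem assoc_smul_left [IsScalarTower R B B] (c : R) (x y z : B) :
    associator (c • x) y z = c • associator x y z := by
  simp only [associator, smul_mul_assoc, smul_sub]

theorem assoc_smul_mid [SMulCommClass R B B] [IsScalarTower R B B] (c : R) (x y z : B) :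
    associator x (c • y) z = c • associator x y z := by
  simp only [associator, smul_mul_assoc, mul_smul_comm, smul_sub]

theorem assoc_smul_right [SMulCommClass R B B] (c : R) (x y z : B) :
    associator x y (c • z) = c • associator x y z := by
  simp only [associator, mul_smul_comm, smul_sub]

end Scalar

section Idempotent

variable {F B : Type*} [Field F] [NonAssocRing B] [Module F B] [SMulCommClass F B B]
  [IsScalarTower F B B] [IsAlternativeRing B]

open Polynomial

/-- A polynomial in `x` associates and commutes with `x`. -/
theorem assoc_aeval (x : B) (p : F[X]) :
    (∀ z, associator x (aeval (LinearMap.mulLeft F x) p 1) z = 0) ∧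
      aeval (LinearMap.mulLeft F x) p 1 * x = x * aeval (LinearMap.mulLeft F x) p 1 := by
  induction p using Polynomial.induction_on with
  | C a => simp [assoc_smul_mid, assoc_one_mid, Algebra.algebraMap_eq_smul_one]
  | add p q hp hq =>
    simp only [map_add, LinearMap.add_apply, assoc_add_mid, hp.1, hq.1, add_mul, mul_add, hp.2,
      hq.2, add_zero, implies_true, and_self]
  | monomial n a h =>
    have e : (C a * X ^ (n + 1) : F[X]) = X * (C a * X ^ n) := by ring
    rw [e, map_mul, aeval_X, Module.End.mul_apply, LinearMap.mulLeft_apply]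
    refine ⟨fun z => ?_, ?_⟩
    · rw [assoc_mul_left, h.1, zero_mul]
    · rw [flexible, h.2]

theorem aeval_mulLeft_one_mul (x : B) (p : F[X]) (z : B) :
    aeval (LinearMap.mulLeft F x) p 1 * z = aeval (LinearMap.mulLeft F x) p z := by
  induction p using Polynomial.induction_on with
  | C a => simp [Algebra.algebraMap_eq_smul_one]
  | add p q hp hq => rw [map_add, LinearMap.add_apply, add_mul, hp, hq, LinearMap.add_apply]
  | monomial n a h =>
    have e : (C a * X ^ (n + 1) : F[X]) = X * (C a * X ^ n) := by ring
    rw [e, map_mul, aeval_X, Module.End.mul_apply, Module.End.mul_apply, LinearMap.mulLeft_apply,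
      LinearMap.mulLeft_apply, ← h]
    exact sub_eq_zero.1 ((assoc_aeval x (C a * X ^ n)).1 z)

theorem isInv_of_assoc {x y : B} (hxy : x * y = 1) (hyx : y * x = 1)
    (h : ∀ z, associator x y z = 0) : IsInv x y := by
  refine ⟨fun z => ?_, fun z => ?_, fun z => ?_, fun z => ?_⟩
  · rw [← sub_eq_zero.1 (h z), hxy, one_mul]
  · have := h z
    rw [assoc_swap_left, neg_eq_zero] at this
    rw [← sub_eq_zero.1 this, hyx, one_mul]
  · have := h z
    rw [assoc_reverse, neg_eq_zero] at this
    rw [sub_eq_zero.1 this, hyx, mul_one]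
  · have := h z
    rw [assoc_cyclic z x y] at this
    rw [sub_eq_zero.1 this, hxy, mul_one]

/-- Fitting's trichotomy for an element of a finite-dimensional alternative algebra. -/
theorem nilpotent_or_inv_or_idempotent [Module.Finite F B] (x : B) :
    IsNilpotent (LinearMap.mulLeft F x) ∨ (∃ y, IsInv x y) ∨
      ∃ e : B, e * e = e ∧ e ≠ 0 ∧ e ≠ 1 := by
  set L := LinearMap.mulLeft F x with hL
  have hLint : IsIntegral F L := Algebra.IsIntegral.isIntegral L
  have hne : minpoly F L ≠ 0 := minpoly.ne_zero hLint
  obtain ⟨q, hq, hdvd⟩ := exists_eq_pow_rootMultiplicity_mul_and_not_dvd _ hne 0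
  set m := rootMultiplicity 0 (minpoly F L)
  rw [C_0, sub_zero] at hq hdvd
  have hcop : IsCoprime X q := (Polynomial.prime_X.coprime_iff_not_dvd).2 hdvd
  have hzero : aeval L (X ^ m * q) = 0 := by rw [← hq]; exact minpoly.aeval F L
  by_cases hm : m = 0
  · right; left
    obtain ⟨a, b, hab⟩ := hcop
    rw [hm, pow_zero, one_mul] at hzero
    refine ⟨aeval L a 1, ?_⟩
    have h1 : x * aeval L a 1 = 1 := by
      have h := congrArg (fun p => aeval L p (1 : B)) hab
      rw [mul_comm a] at h
      simp only [map_add, map_mul, hzero, mul_zero, add_zero, aeval_X, map_one] at h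
      exact h
    exact isInv_of_assoc h1 (by rw [(assoc_aeval x a).2, h1]) (assoc_aeval x a).1
  by_cases hu : IsUnit q
  · left
    refine ⟨m, ?_⟩
    obtain ⟨r, hr⟩ := hu.exists_right_inv
    have : X ^ m = (X ^ m * q) * r := by rw [mul_assoc, hr, mul_one]
    have h := congrArg (aeval L) this
    rwa [map_mul, hzero, zero_mul, map_pow, aeval_X] at h
  · right; right
    obtain ⟨a, b, hab⟩ := (IsCoprime.pow_left hcop : IsCoprime (X ^ m) q)
    refine ⟨aeval L (a * X ^ m) 1, ?_, fun h => ?_, fun h => ?_⟩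
    · have h : a * X ^ m * (a * X ^ m) = a * X ^ m - a * b * (X ^ m * q) := by
        linear_combination (a * X ^ m) * hab
      have h' := congrArg (fun p => aeval L p (1 : B)) h
      simp only [map_sub, map_mul _ _ (X ^ m * q), hzero, mul_zero, sub_zero] at h'
      rwa [map_mul, Module.End.mul_apply, hL, ← aeval_mulLeft_one_mul] at h'
    · have h1 : aeval L (a * X ^ m) = 0 := by
        ext z
        rw [hL, ← aeval_mulLeft_one_mul, ← hL, h, zero_mul, LinearMap.zero_apply]
      have h2 := minpoly.dvd F L h1
      rw [hq] at h2
      have h3 : q ∣ 1 := by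
        rw [← hab]
        exact dvd_add ((dvd_mul_left _ _).trans h2) (dvd_mul_left _ _)
      exact hu (isUnit_of_dvd_one h3)
    · have h1 : aeval L (b * q) = 0 := by
        have e : b * q = 1 - a * X ^ m := by rw [← hab]; ring
        ext z
        rw [hL, ← aeval_mulLeft_one_mul, ← hL, e, map_sub, LinearMap.sub_apply, h,
          map_one (aeval L), Module.End.one_apply, sub_self, zero_mul, LinearMap.zero_apply]
      have h2 := minpoly.dvd F L h1
      rw [hq] at h2
      have h3 : (X : F[X]) ∣ 1 := by
        rw [← hab]
        exact dvd_add ((dvd_pow_self X hm).mul_left a)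
          ((dvd_pow_self X hm).trans ((dvd_mul_right _ _).trans h2))
      exact Polynomial.not_isUnit_X (isUnit_of_dvd_one h3)


theorem isNilpotent_mulLeft_of_mul_eq_zero [Module.Finite F B]
    (hidem : ∀ e : B, e * e = e → e = 0 ∨ e = 1) {x : B}
    (h : (∃ z ≠ 0, z * x = 0) ∨ ∃ z ≠ 0, x * z = 0) : IsNilpotent (LinearMap.mulLeft F x) := by
  rcases nilpotent_or_inv_or_idempotent (F := F) x with h1 | ⟨y, hy⟩ | ⟨e, he, h0, h1⟩
  · exact h1
  · rcases h with ⟨z, hz, hzx⟩ | ⟨z, hz, hzx⟩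
    · exact absurd (by rw [← hy.right_mul z, hzx, zero_mul]) hz
    · exact absurd (by rw [← hy.left_mul z, hzx, mul_zero]) hz
  · rcases hidem e he with h | h
    · exact absurd h h0
    · exact absurd h h1

theorem exists_mul_eq_zero_of_isNilpotent [Nontrivial B] {x : B}
    (h : IsNilpotent (LinearMap.mulLeft F x)) :
    ∃ z ≠ 0, x * z = 0 ∧ z * x = 0 ∧ ∀ y, associator x z y = 0 := by
  obtain ⟨n, hn⟩ := h
  classical
  have hex : ∃ n, (LinearMap.mulLeft F x ^ n) (1 : B) = 0 := ⟨n, by rw [hn]; rfl⟩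
  have h0 := Nat.find_spec hex
  obtain ⟨m, hm⟩ : ∃ m, Nat.find hex = m + 1 := by
    refine Nat.exists_eq_succ_of_ne_zero fun h => ?_
    rw [h, pow_zero] at h0
    exact one_ne_zero h0
  rw [hm, pow_succ', Module.End.mul_apply, LinearMap.mulLeft_apply] at h0
  have h1 := Nat.find_min hex (m := m) (by omega)
  have h2 := assoc_aeval (F := F) x (X ^ m)
  rw [map_pow, aeval_X] at h2
  exact ⟨_, h1, h0, h2.2.trans h0, h2.1⟩

theorem isNilpotent_mulLeft_mul [Module.Finite F B] [Nontrivial B]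
    (hidem : ∀ e : B, e * e = e → e = 0 ∨ e = 1) {x : B}
    (h : IsNilpotent (LinearMap.mulLeft F x)) (y : B) :
    IsNilpotent (LinearMap.mulLeft F (x * y)) ∧ IsNilpotent (LinearMap.mulLeft F (y * x)) := by
  obtain ⟨z, hz, hxz, hzx, hass⟩ := exists_mul_eq_zero_of_isNilpotent h
  refine ⟨isNilpotent_mulLeft_of_mul_eq_zero hidem (Or.inl ⟨z, hz, ?_⟩),
    isNilpotent_mulLeft_of_mul_eq_zero hidem (Or.inr ⟨z, hz, ?_⟩)⟩
  · have := hass y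
    rw [assoc_swap_left, neg_eq_zero, associator, hzx, zero_mul, zero_sub, neg_eq_zero] at this
    exact this
  · have := hass y
    rw [← assoc_cyclic, ← assoc_cyclic, associator, hxz, mul_zero, sub_zero] at this
    exact this

theorem isNilpotent_mulLeft_add [Module.Finite F B] [Nontrivial B]
    (hidem : ∀ e : B, e * e = e → e = 0 ∨ e = 1) {x y : B}
    (hx : IsNilpotent (LinearMap.mulLeft F x)) (hy : IsNilpotent (LinearMap.mulLeft F y)) :
    IsNilpotent (LinearMap.mulLeft F (x + y)) := by
  rcases nilpotent_or_inv_or_idempotent (F := F) (x + y) with h1 | ⟨d, hd⟩ | ⟨e, he, h0, h1⟩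
  · exact h1
  · exfalso
    have h1 := (isNilpotent_mulLeft_mul hidem hx d).1
    have h2 := (isNilpotent_mulLeft_mul hidem hy d).1
    have h3 : LinearMap.mulLeft F (x * d) = 1 - LinearMap.mulLeft F (y * d) := by
      ext z
      have : x * d = 1 - y * d := by rw [eq_sub_iff_add_eq, ← add_mul, hd.mul_eq]
      simp [this, sub_mul]
    rw [h3] at h1
    have h4 : IsUnit (1 - LinearMap.mulLeft F (y * d)) := h2.isUnit_one_sub
    exact (h4.not_isNilpotent h1)
  · rcases hidem e he with h | h
    · exact absurd h h0
    · exact absurd h h1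

/-- A simple nonassociative finite-dimensional alternative algebra over an algebraically closed
field contains a proper idempotent. -/
theorem exists_idempotent [IsAlgClosed F] [Module.Finite F B]
    (hsimple : ∀ I : Submodule F B, (∀ x ∈ I, ∀ y, x * y ∈ I ∧ y * x ∈ I) → I = ⊥ ∨ I = ⊤)
    (hassoc : ¬ ∀ x y z : B, (x * y) * z = x * (y * z)) :
    ∃ e : B, e * e = e ∧ e ≠ 0 ∧ e ≠ 1 := by
  by_contra! hcon
  have hidem : ∀ e : B, e * e = e → e = 0 ∨ e = 1 := fun e he => by
    by_contra! h
    exact h.2 (hcon e he h.1)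
  cases subsingleton_or_nontrivial B
  · exact hassoc fun x y z => Subsingleton.elim _ _
  let N : Submodule F B :=
    { carrier := {x | IsNilpotent (LinearMap.mulLeft F x)}
      add_mem' := isNilpotent_mulLeft_add hidem
      zero_mem' := by simp
      smul_mem' := fun c x hx => by
        have : LinearMap.mulLeft F (c • x) = c • LinearMap.mulLeft F x := by
          ext z
          exact smul_mul_assoc c x z
        simpa [this] using IsNilpotent.smul hx c }
  rcases hsimple N fun x hx y => isNilpotent_mulLeft_mul hidem hx y with h | h
  · have hscalar : ∀ x : B, ∃ c : F, x = c • 1 := fun x => by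
      obtain ⟨c, hc⟩ := Module.End.exists_eigenvalue (LinearMap.mulLeft F x)
      obtain ⟨z, hz, hz0⟩ := hc.exists_hasEigenvector
      refine ⟨c, sub_eq_zero.1 ?_⟩
      have : x - c • 1 ∈ N := by
        refine isNilpotent_mulLeft_of_mul_eq_zero hidem (Or.inr ⟨z, hz0, ?_⟩)
        rw [Module.End.mem_eigenspace_iff, LinearMap.mulLeft_apply] at hz
        rw [sub_mul, hz, smul_mul_assoc, one_mul, sub_self]
      rwa [h, Submodule.mem_bot] at this
    refine hassoc fun x y z => ?_
    obtain ⟨c, rfl⟩ := hscalar x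
    simp only [smul_mul_assoc, one_mul]
  · have h1 : IsNilpotent (LinearMap.mulLeft F (1 : B)) := by
      have : (1 : B) ∈ N := h ▸ Submodule.mem_top
      exact this
    obtain ⟨z, hz, hz', -⟩ := exists_mul_eq_zero_of_isNilpotent h1
    exact hz (by rw [← hz', one_mul])

end Idempotent

end IsAlternativeRing

namespace IsAlternativeRing

/-- A pair of complementary orthogonal idempotents. -/
structure IsPeirce {B : Type*} [NonAssocRing B] (e f : B) : Prop where
  left_idem : e * e = e
  right_idem : f * f = f
  left_right : e * f = 0
  right_left : f * e = 0
  add_eq : e + f = 1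

section Peirce

variable (F : Type*) {B : Type*} [Field F] [NonAssocRing B] [Module F B] [SMulCommClass F B B]
  [IsScalarTower F B B]

/-- The Peirce space `{x | e x = x, x f = x}`. -/
def peirce (e f : B) : Submodule F B where
  carrier := {x | e * x = x ∧ x * f = x}
  add_mem' := fun {x y} hx hy => ⟨by rw [mul_add, hx.1, hy.1], by rw [add_mul, hx.2, hy.2]⟩
  zero_mem' := ⟨mul_zero _, zero_mul _⟩
  smul_mem' := fun c x hx => ⟨by rw [mul_smul_comm, hx.1], by rw [smul_mul_assoc, hx.2]⟩

variable {F} {e f : B}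

theorem mem_peirce {x : B} : x ∈ peirce F e f ↔ e * x = x ∧ x * f = x := Iff.rfl

namespace IsPeirce

omit [SMulCommClass F B B] [IsScalarTower F B B] [Module F B] in
theorem symm (h : IsPeirce e f) : IsPeirce f e :=
  ⟨h.right_idem, h.left_idem, h.right_left, h.left_right, by rw [add_comm, h.add_eq]⟩

omit [SMulCommClass F B B] [IsScalarTower F B B] [Module F B] in
theorem right_mul (h : IsPeirce e f) (x : B) : f * x = x - e * x := by
  rw [eq_sub_iff_add_eq', ← add_mul, h.add_eq, one_mul]

omit [SMulCommClass F B B] [IsScalarTower F B B] [Module F B] in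
theorem mul_right (h : IsPeirce e f) (x : B) : x * f = x - x * e := by
  rw [eq_sub_iff_add_eq', ← mul_add, h.add_eq, mul_one]

theorem mem_ee (h : IsPeirce e f) {x : B} :
    x ∈ peirce F e e ↔ e * x = x ∧ x * e = x ∧ f * x = 0 ∧ x * f = 0 := by
  rw [mem_peirce, h.right_mul, h.mul_right]
  grind

theorem mem_ef (h : IsPeirce e f) {x : B} :
    x ∈ peirce F e f ↔ e * x = x ∧ x * e = 0 ∧ f * x = 0 ∧ x * f = x := by
  rw [mem_peirce, h.right_mul, h.mul_right]
  grind

theorem mem_fe (h : IsPeirce e f) {x : B} :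
    x ∈ peirce F f e ↔ e * x = 0 ∧ x * e = x ∧ f * x = x ∧ x * f = 0 := by
  rw [mem_peirce, h.right_mul, h.mul_right]
  grind

theorem mem_ff (h : IsPeirce e f) {x : B} :
    x ∈ peirce F f f ↔ e * x = 0 ∧ x * e = 0 ∧ f * x = x ∧ x * f = x := by
  rw [mem_peirce, h.right_mul, h.mul_right]
  grind

theorem e_mem (h : IsPeirce e f) : e ∈ peirce F e e := ⟨h.left_idem, h.left_idem⟩

omit [SMulCommClass F B B] [IsScalarTower F B B] [Module F B] in
theorem eq_zero_of_left (h : IsPeirce e f) {x : B} (h1 : e * x = x) (h2 : f * x = x) : x = 0 := by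
  rw [h.right_mul, h1, sub_self] at h2
  exact h2.symm

omit [SMulCommClass F B B] [IsScalarTower F B B] [Module F B] in
theorem eq_zero_of_right (h : IsPeirce e f) {x : B} (h1 : x * e = x) (h2 : x * f = x) :
    x = 0 := by
  rw [h.mul_right, h1, sub_self] at h2
  exact h2.symm

variable [IsAlternativeRing B]

omit [SMulCommClass F B B] [IsScalarTower F B B] [Module F B] [IsAlternativeRing B] in
theorem assoc_symm (h : IsPeirce e f) (x y : B) : associator f x y = -associator e x y := by
  have : associator (e + f) x y = 0 := by rw [h.add_eq]; simp [associator]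
  rw [assoc_add_left] at this
  grind

theorem assoc_ee (_h : IsPeirce e f) {x : B} (hx : x ∈ peirce F e e) (y : B) :
    associator e x y ∈ peirce F e e := by
  have h1 := assoc_mul_left e x y
  have h2 := assoc_mul_right e x y
  rw [hx.1] at h1
  rw [hx.2] at h2
  exact ⟨h2.symm, h1.symm⟩

theorem assoc_ef (h : IsPeirce e f) {x : B} (hx : x ∈ peirce F e f) (y : B) :
    associator e x y ∈ peirce F f e := by
  have h1 := assoc_mul_left e x y
  have h2 := assoc_mul_right e x y
  rw [h.mem_ef] at hx
  rw [h.mem_fe, h.right_mul, h.mul_right]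
  rw [hx.1] at h1
  rw [hx.2.1, show associator e 0 y = 0 by simp [associator]] at h2
  grind

theorem assoc_fe (h : IsPeirce e f) {x : B} (hx : x ∈ peirce F f e) (y : B) :
    associator e x y ∈ peirce F e f := by
  rw [h.symm.assoc_symm]
  exact neg_mem (h.symm.assoc_ef hx y)

theorem assoc_ff (h : IsPeirce e f) {x : B} (hx : x ∈ peirce F f f) (y : B) :
    associator e x y ∈ peirce F f f := by
  rw [h.symm.assoc_symm]
  exact neg_mem (h.symm.assoc_ee hx y)

theorem ee_ee (h : IsPeirce e f) {x y : B} (hx : x ∈ peirce F e e) (hy : y ∈ peirce F e e) :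
    x * y ∈ peirce F e e := by
  have h1 := h.assoc_ee hx y
  have h2 := h.assoc_ee hy x
  have h3 := assoc_cyclic e y x
  have h4 := assoc_swap_right e x y
  have h5 := assoc_self_left e (x * y)
  have h6 := assoc_self_right e (x * y)
  have h7 : associator x y e = associator e x y := by rw [assoc_cyclic]
  rw [mem_peirce] at *
  simp only [associator, hx.1, hx.2, hy.1, hy.2, h.left_idem, mul_sub, sub_mul] at *
  grind

theorem ee_ef (h : IsPeirce e f) {x y : B} (hx : x ∈ peirce F e e) (hy : y ∈ peirce F e f) :
    x * y ∈ peirce F e f := by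
  have h1 := h.assoc_ee hx y
  have h2 := h.assoc_ef hy x
  rw [assoc_swap_right, neg_mem_iff] at h2
  have h8 : associator e x y = 0 := h.eq_zero_of_left h1.1 h2.1
  have h7 := assoc_cyclic e x y
  rw [h.mem_ef, h.right_mul, h.mul_right]
  rw [h.mem_ef] at hy
  rw [h.mem_ee] at hx
  rw [h8] at h7
  simp only [associator, hx, hy, mul_zero] at h7 h8
  grind

theorem ef_ff (h : IsPeirce e f) {x y : B} (hx : x ∈ peirce F e f) (hy : y ∈ peirce F f f) :
    x * y ∈ peirce F e f := by
  have h1 := h.assoc_ef hx y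
  have h2 := h.assoc_ff hy x
  rw [assoc_swap_right, neg_mem_iff] at h2
  have h8 : associator e x y = 0 := h.eq_zero_of_right h1.2 h2.2
  have h7 := assoc_cyclic e x y
  rw [h.mem_ef, h.right_mul, h.mul_right]
  rw [h.mem_ef] at hx
  rw [h.mem_ff] at hy
  rw [h8] at h7
  simp only [associator, hx, hy, mul_zero] at h7 h8
  grind

theorem ef_fe (h : IsPeirce e f) {x y : B} (hx : x ∈ peirce F e f) (hy : y ∈ peirce F f e) :
    x * y ∈ peirce F e e := by
  have h1 := h.assoc_ef hx y
  have h2 := h.assoc_fe hy x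
  rw [assoc_swap_right, neg_mem_iff] at h2
  have h8 : associator e x y = 0 := h.eq_zero_of_left h2.1 h1.1
  have h7 := assoc_cyclic e x y
  rw [h.mem_ee, h.right_mul, h.mul_right]
  rw [h.mem_ef] at hx
  rw [h.mem_fe] at hy
  rw [h8] at h7
  simp only [associator, hx, hy] at h7 h8
  grind

theorem ef_ef (h : IsPeirce e f) {x y : B} (hx : x ∈ peirce F e f) (hy : y ∈ peirce F e f) :
    x * y ∈ peirce F f e := by
  have h1 := h.assoc_ef hx y
  have h9 := assoc_swap_left e x y
  rw [h.mem_ef] at hx hy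
  rw [associator, hx.2.1, hy.1, zero_mul, zero_sub, neg_inj] at h9
  rwa [h9]

theorem ee_ff (h : IsPeirce e f) {x y : B} (hx : x ∈ peirce F e e) (hy : y ∈ peirce F f f) :
    x * y = 0 := by
  have h1 := h.assoc_ee hx y
  have h2 := h.assoc_ff hy x
  rw [assoc_swap_right, neg_mem_iff] at h2
  have h8 : associator e x y = 0 := h.eq_zero_of_left h1.1 h2.1
  have h9 := assoc_swap_left e x y
  rw [h.mem_ee] at hx
  rw [h.mem_ff] at hy
  rw [h8] at h9
  simpa only [associator, hx, hy, mul_zero, sub_zero, neg_zero] using h9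

theorem ee_fe (h : IsPeirce e f) {x y : B} (hx : x ∈ peirce F e e) (hy : y ∈ peirce F f e) :
    x * y = 0 := by
  have h1 := h.assoc_ee hx y
  have h2 := h.assoc_fe hy x
  rw [assoc_swap_right, neg_mem_iff] at h2
  have h8 : associator e x y = 0 := h.eq_zero_of_right h1.2 h2.2
  have h9 := assoc_swap_left e x y
  rw [h.mem_ee] at hx
  rw [h.mem_fe] at hy
  rw [h8] at h9
  simpa only [associator, hx, hy, mul_zero, sub_zero, neg_zero] using h9

theorem ef_ee (h : IsPeirce e f) {x y : B} (hx : x ∈ peirce F e f) (hy : y ∈ peirce F e e) :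
    x * y = 0 := by
  have h1 := h.assoc_ef hx y
  have h2 := h.assoc_ee hy x
  rw [assoc_swap_right, neg_mem_iff] at h2
  have h8 : associator e x y = 0 := h.eq_zero_of_left h2.1 h1.1
  have h9 := assoc_swap_left e x y
  rw [h.mem_ef] at hx
  rw [h.mem_ee] at hy
  rw [h8] at h9
  simpa only [associator, hx, hy, zero_mul, zero_sub, neg_zero, neg_eq_zero] using h9

theorem ef_sq (h : IsPeirce e f) {x : B} (hx : x ∈ peirce F e f) : x * x = 0 := by
  have h1 := assoc_self_right x e
  have h2 := assoc_swap_left e x x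
  rw [h1, neg_zero] at h2
  rw [h.mem_ef] at hx
  simpa only [associator, hx, zero_mul, zero_sub, neg_eq_zero] using h2

theorem ef_swap (h : IsPeirce e f) {x y : B} (hx : x ∈ peirce F e f) (hy : y ∈ peirce F e f) :
    y * x = -(x * y) := by
  have := h.ef_sq (add_mem hx hy)
  rw [add_mul, mul_add, mul_add, h.ef_sq hx, h.ef_sq hy] at this
  grind

theorem ee_ef_fe (h : IsPeirce e f) {a x u : B} (ha : a ∈ peirce F e e) (hx : x ∈ peirce F e f)
    (hu : u ∈ peirce F f e) : (a * x) * u = a * (x * u) := by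
  have h1 := assoc_cyclic u a x
  have h2 : associator a x u ∈ peirce F e e :=
    sub_mem (h.ef_fe (h.ee_ef ha hx) hu) (h.ee_ee ha (h.ef_fe hx hu))
  have h3 : associator u a x ∈ peirce F f f :=
    sub_mem (h.symm.ef_fe (h.symm.ef_ff hu ha) hx) (h.symm.ef_fe hu (h.ee_ef ha hx))
  rw [← h1] at h3
  exact sub_eq_zero.1 (h.eq_zero_of_left h2.1 h3.1)

theorem fe_ee_ef (h : IsPeirce e f) {a x u : B} (ha : a ∈ peirce F e e) (hx : x ∈ peirce F e f)
    (hu : u ∈ peirce F f e) : (u * a) * x = u * (a * x) := by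
  have h1 := assoc_cyclic u a x
  rw [associator, h.ee_ef_fe ha hx hu, sub_self] at h1
  exact sub_eq_zero.1 h1.symm

theorem ef_fe_ee (h : IsPeirce e f) {a x u : B} (ha : a ∈ peirce F e e) (hx : x ∈ peirce F e f)
    (hu : u ∈ peirce F f e) : (x * u) * a = x * (u * a) := by
  have h1 := assoc_cyclic a x u
  rw [associator, associator, h.ee_ef_fe ha hx hu, sub_self] at h1
  exact sub_eq_zero.1 h1

theorem ee_ee_ef (h : IsPeirce e f) {a a' x : B} (ha : a ∈ peirce F e e)
    (ha' : a' ∈ peirce F e e) (hx : x ∈ peirce F e f) : (a * a') * x = a * (a' * x) := by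
  have h1 := assoc_cyclic a a' x
  rw [associator, associator, h.ef_ee hx ha, mul_zero, h.ef_ee (h.ee_ef ha' hx) ha, sub_self] at h1
  exact sub_eq_zero.1 h1.symm

theorem fe_ee_ee (h : IsPeirce e f) {a a' u : B} (ha : a ∈ peirce F e e)
    (ha' : a' ∈ peirce F e e) (hu : u ∈ peirce F f e) : (u * a) * a' = u * (a * a') := by
  have h1 := assoc_cyclic u a a'
  rw [associator, associator, h.ee_fe ha' hu, mul_zero,
    h.ee_fe (h.ee_ee ha ha') hu, sub_self] at h1
  exact sub_eq_zero.1 h1.symm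

theorem ee_ef_ff (h : IsPeirce e f) {a x b : B} (ha : a ∈ peirce F e e) (hx : x ∈ peirce F e f)
    (hb : b ∈ peirce F f f) : (a * x) * b = a * (x * b) := by
  have h1 := assoc_cyclic b a x
  rw [associator, associator, h.symm.ee_ff hb ha, zero_mul,
    h.symm.ee_fe hb (h.ee_ef ha hx), sub_self] at h1
  exact sub_eq_zero.1 h1

theorem ee_ef_ef (h : IsPeirce e f) {a x y : B} (ha : a ∈ peirce F e e) (hx : x ∈ peirce F e f)
    (hy : y ∈ peirce F e f) : (a * x) * y = (x * y) * a := by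
  have h1 := assoc_cyclic a x y
  rw [associator, associator, h.ef_ee hy ha, mul_zero, h.ee_fe ha (h.ef_ef hx hy), sub_zero,
    sub_zero] at h1
  exact h1.symm

theorem ef_ee_ef (h : IsPeirce e f) {a x y : B} (ha : a ∈ peirce F e e) (hx : x ∈ peirce F e f)
    (hy : y ∈ peirce F e f) : x * (a * y) = (x * y) * a := by
  have h1 := assoc_swap_left a x y
  rw [associator, associator, h.ef_ee hx ha, zero_mul, h.ee_fe ha (h.ef_ef hx hy),
    sub_zero, zero_sub, neg_inj] at h1
  rw [h1, h.ee_ef_ef ha hx hy]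

theorem ef_ff_ef (h : IsPeirce e f) {b x y : B} (hb : b ∈ peirce F f f) (hx : x ∈ peirce F e f)
    (hy : y ∈ peirce F e f) : (x * b) * y = b * (x * y) := by
  have h1 := assoc_swap_left b x y
  rw [associator, associator, h.symm.ee_fe hb hx, zero_mul, h.symm.ee_fe hb hy, mul_zero,
    sub_zero, zero_sub, neg_neg] at h1
  exact h1

theorem ef_ef_ff (h : IsPeirce e f) {b x y : B} (hb : b ∈ peirce F f f) (hx : x ∈ peirce F e f)
    (hy : y ∈ peirce F e f) : x * (y * b) = b * (x * y) := by
  have h1 := assoc_cyclic b x y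
  rw [associator, associator, h.symm.ee_fe hb hx, zero_mul,
    h.symm.ef_ee (h.ef_ef hx hy) hb, zero_sub, zero_sub, neg_inj] at h1
  exact h1

theorem mul_fe_ef (h : IsPeirce e f) {x z v : B} (hx : x ∈ peirce F e f) (hz : z ∈ peirce F e f)
    (hv : v ∈ peirce F f e) : z * (v * x) = (z * v) * x + (z * x) * v := by
  have h1 := assoc_swap_right z v x
  rw [associator, associator, h.ef_ee hz (h.ef_fe hx hv), sub_zero] at h1
  rw [h1]
  abel

theorem ef_fe_mul (h : IsPeirce e f) {x z v : B} (hx : x ∈ peirce F e f) (hz : z ∈ peirce F e f)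
    (hv : v ∈ peirce F f e) : (x * v) * z = x * (v * z) + v * (x * z) := by
  have h1 := assoc_swap_left v x z
  rw [associator, associator, h.symm.ee_fe (h.symm.ef_fe hv hx) hz, zero_sub, neg_neg] at h1
  rw [← h1]
  abel

theorem ef_cyclic (h : IsPeirce e f) {x y z : B} (hx : x ∈ peirce F e f)
    (hy : y ∈ peirce F e f) (hz : z ∈ peirce F e f) :
    z * (x * y) = x * (y * z) ∧ (z * x) * y = (x * y) * z := by
  have h1 := assoc_cyclic z x y
  rw [associator, associator, sub_eq_sub_iff_add_eq_add] at h1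
  have h2 := h.ef_fe hz (h.ef_ef hx hy)
  have h3 := h.ef_fe hx (h.ef_ef hy hz)
  have h4 := h.symm.ef_fe (h.ef_ef hx hy) hz
  have h5 := h.symm.ef_fe (h.ef_ef hz hx) hy
  rw [h.mem_ee] at h2 h3
  rw [h.mem_ff] at h4 h5
  have h6 := congrArg (e * ·) h1
  have h7 := congrArg (f * ·) h1
  simp only [mul_add, h2, h3, h4, h5, zero_add, add_zero] at h6 h7
  exact ⟨h6, h7.symm⟩

end IsPeirce

end Peirce

end IsAlternativeRing

namespace IsAlternativeRing

section Simple

variable {F B : Type*} [Field F] [NonAssocRing B] [Module F B] [SMulCommClass F B B]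
  [IsScalarTower F B B] {e f : B}

/-- Half of the closure conditions for a sum of subspaces of the Peirce spaces to be an ideal. -/
structure PeirceClosed (e f : B) (Jee Jef Jfe Jff : Submodule F B) : Prop where
  le_ee : Jee ≤ peirce F e e
  le_ef : Jef ≤ peirce F e f
  ee_ee_left : ∀ a ∈ Jee, ∀ a' ∈ peirce F e e, a * a' ∈ Jee
  ee_ee_right : ∀ a ∈ Jee, ∀ a' ∈ peirce F e e, a' * a ∈ Jee
  ee_ef : ∀ a ∈ Jee, ∀ x ∈ peirce F e f, a * x ∈ Jef
  fe_ee : ∀ a ∈ Jee, ∀ u ∈ peirce F f e, u * a ∈ Jfe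
  ee_mul_ef : ∀ x ∈ Jef, ∀ a ∈ peirce F e e, a * x ∈ Jef
  ef_mul_ff : ∀ x ∈ Jef, ∀ b ∈ peirce F f f, x * b ∈ Jef
  ef_mul_fe : ∀ x ∈ Jef, ∀ u ∈ peirce F f e, x * u ∈ Jee
  fe_mul_ef : ∀ x ∈ Jef, ∀ u ∈ peirce F f e, u * x ∈ Jff
  ef_mul_ef : ∀ x ∈ Jef, ∀ y ∈ peirce F e f, x * y ∈ Jfe

variable (F B) in
/-- Every two-sided ideal is trivial. -/
def HasTrivialIdeals : Prop :=
  ∀ I : Submodule F B, (∀ x ∈ I, ∀ y, x * y ∈ I ∧ y * x ∈ I) → I = ⊥ ∨ I = ⊤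

namespace IsPeirce

variable [IsAlternativeRing B]

theorem ee_part_mem (h : IsPeirce e f) (x : B) : e * (x * e) ∈ peirce F e e := by
  refine ⟨?_, ?_⟩
  · rw [IsAlternativeRing.left_alt, h.left_idem]
  · rw [← flexible, IsAlternativeRing.right_alt, h.left_idem]

theorem ef_part_mem (h : IsPeirce e f) (x : B) : e * (x * f) ∈ peirce F e f := by
  refine ⟨?_, ?_⟩
  · rw [IsAlternativeRing.left_alt, h.left_idem]
  · have : e * (x * f) = (e * x) * f := by
      rw [h.mul_right, h.mul_right, mul_sub, flexible]
    rw [this, IsAlternativeRing.right_alt, h.right_idem]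

omit [IsAlternativeRing B] in
theorem sum_parts (h : IsPeirce e f) (x : B) :
    x = e * (x * e) + e * (x * f) + f * (x * e) + f * (x * f) := by
  rw [add_assoc, ← mul_add, ← mul_add, ← mul_add, ← mul_add, h.add_eq, mul_one, ← add_mul, h.add_eq,
    one_mul]

theorem mul_mem_of_closed (h : IsPeirce e f) {Jee Jef Jfe Jff I : Submodule F B}
    (hJ : PeirceClosed e f Jee Jef Jfe Jff) (h1 : Jee ≤ I) (h2 : Jef ≤ I) (h3 : Jfe ≤ I)
    (h4 : Jff ≤ I) {x : B} (hx : x ∈ Jee ∨ x ∈ Jef) (y : B) : x * y ∈ I ∧ y * x ∈ I := by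
  have p1 := h.ee_part_mem (F := F) y
  have p2 := h.ef_part_mem (F := F) y
  have p3 := h.symm.ef_part_mem (F := F) y
  have p4 := h.symm.ee_part_mem (F := F) y
  rw [h.sum_parts y]
  generalize e * (y * e) = a at *
  generalize e * (y * f) = p at *
  generalize f * (y * e) = q at *
  generalize f * (y * f) = b at *
  simp only [mul_add, add_mul]
  rcases hx with hx | hx
  · have hx' := hJ.le_ee hx
    rw [h.ee_fe hx' p3, h.ee_ff hx' p4, h.ef_ee p2 hx', h.symm.ee_ff p4 hx']
    simp only [add_zero]
    exact ⟨add_mem (h1 (hJ.ee_ee_left _ hx _ p1)) (h2 (hJ.ee_ef _ hx _ p2)),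
      add_mem (h1 (hJ.ee_ee_right _ hx _ p1)) (h3 (hJ.fe_ee _ hx _ p3))⟩
  · have hx' := hJ.le_ef hx
    rw [h.ef_ee hx' p1, h.symm.ee_fe p4 hx', h.ef_swap hx' p2]
    simp only [add_zero, zero_add]
    exact ⟨add_mem (add_mem (h3 (hJ.ef_mul_ef _ hx _ p2)) (h1 (hJ.ef_mul_fe _ hx _ p3)))
      (h2 (hJ.ef_mul_ff _ hx _ p4)),
      add_mem (add_mem (h2 (hJ.ee_mul_ef _ hx _ p1)) (neg_mem (h3 (hJ.ef_mul_ef _ hx _ p2))))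
      (h4 (hJ.fe_mul_ef _ hx _ p3))⟩

theorem bot_or_of_closed (h : IsPeirce e f) (hs : HasTrivialIdeals F B)
    {Jee Jef Jfe Jff : Submodule F B} (hJ : PeirceClosed e f Jee Jef Jfe Jff)
    (hJ' : PeirceClosed f e Jff Jfe Jef Jee) :
    (e ∈ Jee ∧ f ∈ Jff) ∨ (Jee = ⊥ ∧ Jef = ⊥ ∧ Jfe = ⊥ ∧ Jff = ⊥) := by
  set I := Jee ⊔ Jef ⊔ Jfe ⊔ Jff with hI
  have h1 : Jee ≤ I := le_sup_left.trans (le_sup_left.trans le_sup_left)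
  have h2 : Jef ≤ I := le_sup_right.trans (le_sup_left.trans le_sup_left)
  have h3 : Jfe ≤ I := le_sup_right.trans le_sup_left
  have h4 : Jff ≤ I := le_sup_right
  have hmem : ∀ {x}, x ∈ I → ∃ a ∈ Jee, ∃ p ∈ Jef, ∃ q ∈ Jfe, ∃ b ∈ Jff, a + p + q + b = x := by
    intro x hx
    obtain ⟨y, hy, b, hb, rfl⟩ := Submodule.mem_sup.1 hx
    obtain ⟨z, hz, q, hq, rfl⟩ := Submodule.mem_sup.1 hy
    obtain ⟨a, ha, p, hp, rfl⟩ := Submodule.mem_sup.1 hz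
    exact ⟨a, ha, p, hp, q, hq, b, hb, rfl⟩
  have hideal : ∀ x ∈ I, ∀ y, x * y ∈ I ∧ y * x ∈ I := by
    intro x hx y
    obtain ⟨a, ha, p, hp, q, hq, b, hb, rfl⟩ := hmem hx
    have ka := h.mul_mem_of_closed hJ h1 h2 h3 h4 (Or.inl ha) y
    have kp := h.mul_mem_of_closed hJ h1 h2 h3 h4 (Or.inr hp) y
    have kq := h.symm.mul_mem_of_closed hJ' h4 h3 h2 h1 (Or.inr hq) y
    have kb := h.symm.mul_mem_of_closed hJ' h4 h3 h2 h1 (Or.inl hb) y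
    simp only [add_mul, mul_add]
    exact ⟨add_mem (add_mem (add_mem ka.1 kp.1) kq.1) kb.1,
      add_mem (add_mem (add_mem ka.2 kp.2) kq.2) kb.2⟩
  rcases hs I hideal with hbot | htop
  · right
    rw [hbot] at h1 h2 h3 h4
    exact ⟨le_bot_iff.1 h1, le_bot_iff.1 h2, le_bot_iff.1 h3, le_bot_iff.1 h4⟩
  · left
    obtain ⟨a, ha, p, hp, q, hq, b, hb, h1⟩ := hmem (htop ▸ Submodule.mem_top : (1 : B) ∈ I)
    have ha' := h.mem_ee.1 (hJ.le_ee ha)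
    have hp' := h.mem_ef.1 (hJ.le_ef hp)
    have hq' := h.mem_fe.1 (hJ'.le_ef hq)
    have hb' := h.mem_ff.1 (hJ'.le_ee hb)
    have he := congrArg (fun x => e * (x * e)) h1
    have hf := congrArg (fun x => f * (x * f)) h1
    simp only [add_mul, ha', hp', hq', hb', mul_add, add_zero, zero_add, one_mul, h.left_idem,
      h.right_idem] at he hf
    exact ⟨he ▸ ha, hf ▸ hb⟩

variable (hs : HasTrivialIdeals F B)
include hs

theorem eq_zero_of_ee (h : IsPeirce e f) (hf : f ≠ 0) {a : B} (ha : a ∈ peirce F e e)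
    (h1 : ∀ x ∈ peirce F e f, a * x = 0) (h2 : ∀ u ∈ peirce F f e, u * a = 0) : a = 0 := by
  let K : Submodule F B :=
    { carrier := {a | a ∈ peirce F e e ∧ (∀ x ∈ peirce F e f, a * x = 0) ∧
        ∀ u ∈ peirce F f e, u * a = 0}
      add_mem' := fun {a b} ha hb => ⟨add_mem ha.1 hb.1,
        fun x hx => by rw [add_mul, ha.2.1 x hx, hb.2.1 x hx, add_zero],
        fun x hx => by rw [mul_add, ha.2.2 x hx, hb.2.2 x hx, add_zero]⟩
      zero_mem' := ⟨zero_mem _, fun x _ => zero_mul x, fun x _ => mul_zero x⟩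
      smul_mem' := fun c a ha => ⟨Submodule.smul_mem _ c ha.1,
        fun x hx => by rw [smul_mul_assoc, ha.2.1 x hx, smul_zero],
        fun x hx => by rw [mul_smul_comm, ha.2.2 x hx, smul_zero]⟩ }
  have hJ : PeirceClosed e f K ⊥ ⊥ ⊥ :=
    { le_ee := fun a ha => ha.1
      le_ef := bot_le
      ee_ee_left := fun a ha a' ha' => ⟨h.ee_ee ha.1 ha',
        fun x hx => by rw [h.ee_ee_ef ha.1 ha' hx, ha.2.1 _ (h.ee_ef ha' hx)],
        fun u hu => by rw [← h.fe_ee_ee ha.1 ha' hu, ha.2.2 u hu, zero_mul]⟩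
      ee_ee_right := fun a ha a' ha' => ⟨h.ee_ee ha' ha.1,
        fun x hx => by rw [h.ee_ee_ef ha' ha.1 hx, ha.2.1 x hx, mul_zero],
        fun u hu => by rw [← h.fe_ee_ee ha' ha.1 hu, ha.2.2 _ (h.symm.ef_ff hu ha')]⟩
      ee_ef := fun a ha x hx => ha.2.1 x hx
      fe_ee := fun a ha u hu => ha.2.2 u hu
      ee_mul_ef := by rintro x rfl a -; simp
      ef_mul_ff := by rintro x rfl a -; simp
      ef_mul_fe := by rintro x rfl a -; simp
      fe_mul_ef := by rintro x rfl a -; simp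
      ef_mul_ef := by rintro x rfl a -; simp }
  have hJ' : PeirceClosed f e ⊥ ⊥ ⊥ K := by
    constructor <;> first | exact bot_le | (rintro x rfl a -; simp)
  rcases h.bot_or_of_closed hs hJ hJ' with h' | h'
  · exact absurd h'.2 hf
  · exact (h'.1 ▸ (⟨ha, h1, h2⟩ : a ∈ K) : a ∈ (⊥ : Submodule F B))

theorem ee_assoc (h : IsPeirce e f) (hf : f ≠ 0) {a b c : B} (ha : a ∈ peirce F e e)
    (hb : b ∈ peirce F e e) (hc : c ∈ peirce F e e) : (a * b) * c = a * (b * c) := by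
  refine sub_eq_zero.1 (h.eq_zero_of_ee hs hf (sub_mem (h.ee_ee (h.ee_ee ha hb) hc)
    (h.ee_ee ha (h.ee_ee hb hc))) (fun x hx => ?_) fun u hu => ?_)
  · rw [sub_mul, h.ee_ee_ef (h.ee_ee ha hb) hc hx, h.ee_ee_ef ha hb (h.ee_ef hc hx),
      h.ee_ee_ef ha (h.ee_ee hb hc) hx, h.ee_ee_ef hb hc hx, sub_self]
  · rw [mul_sub, ← h.fe_ee_ee (h.ee_ee ha hb) hc hu, ← h.fe_ee_ee ha hb hu,
      ← h.fe_ee_ee ha (h.ee_ee hb hc) hu, ← h.fe_ee_ee hb hc (h.symm.ef_ff hu ha), sub_self]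

theorem eq_zero_of_ef (h : IsPeirce e f) (he : e ≠ 0) {x : B} (hx : x ∈ peirce F e f)
    (h1 : ∀ u ∈ peirce F f e, x * u = 0) (h2 : ∀ u ∈ peirce F f e, u * x = 0) : x = 0 := by
  let J : B → B → Submodule F B := fun e f =>
    { carrier := {x | x ∈ peirce F e f ∧ (∀ u ∈ peirce F f e, x * u = 0) ∧
        ∀ u ∈ peirce F f e, u * x = 0}
      add_mem' := fun {a b} ha hb => ⟨add_mem ha.1 hb.1,
        fun x hx => by rw [add_mul, ha.2.1 x hx, hb.2.1 x hx, add_zero],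
        fun x hx => by rw [mul_add, ha.2.2 x hx, hb.2.2 x hx, add_zero]⟩
      zero_mem' := ⟨zero_mem _, fun x _ => zero_mul x, fun x _ => mul_zero x⟩
      smul_mem' := fun c a ha => ⟨Submodule.smul_mem _ c ha.1,
        fun x hx => by rw [smul_mul_assoc, ha.2.1 x hx, smul_zero],
        fun x hx => by rw [mul_smul_comm, ha.2.2 x hx, smul_zero]⟩ }
  have hJ : ∀ {e f : B}, IsPeirce e f → PeirceClosed e f ⊥ (J e f) (J f e) ⊥ := fun {e f} h =>
    { le_ee := bot_le
      le_ef := fun x hx => hx.1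
      ee_ee_left := by rintro x rfl a -; simp
      ee_ee_right := by rintro x rfl a -; simp
      ee_ef := by rintro x rfl a -; simp
      fe_ee := by rintro x rfl a -; simp
      ee_mul_ef := fun x hx a ha => ⟨h.ee_ef ha hx.1,
        fun u hu => by rw [h.ee_ef_fe ha hx.1 hu, hx.2.1 u hu, mul_zero],
        fun u hu => by rw [← h.fe_ee_ef ha hx.1 hu, hx.2.2 _ (h.symm.ef_ff hu ha)]⟩
      ef_mul_ff := fun x hx b hb => ⟨h.ef_ff hx.1 hb,
        fun u hu => by rw [h.symm.fe_ee_ef hb hu hx.1, hx.2.1 _ (h.symm.ee_ef hb hu)],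
        fun u hu => by rw [← h.symm.ef_fe_ee hb hu hx.1, hx.2.2 u hu, zero_mul]⟩
      ef_mul_fe := fun x hx u hu => hx.2.1 u hu
      fe_mul_ef := fun x hx u hu => hx.2.2 u hu
      ef_mul_ef := fun x hx y hy => ⟨h.ef_ef hx.1 hy,
        fun z hz => by rw [(h.ef_cyclic hy hz hx.1).2, hx.2.2 _ (h.ef_ef hy hz)],
        fun z hz => by rw [(h.ef_cyclic hx.1 hy hz).1, hx.2.1 _ (h.ef_ef hy hz)]⟩ }
  rcases h.bot_or_of_closed hs (hJ h) (hJ h.symm) with h' | h'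
  · exact absurd h'.1 he
  · exact (h'.2.1 ▸ (⟨hx, h1, h2⟩ : x ∈ J e f) : x ∈ (⊥ : Submodule F B))

end IsPeirce

end Simple

end IsAlternativeRing

namespace IsAlternativeRing

section Simple

variable {F B : Type*} [Field F] [NonAssocRing B] [Module F B] [SMulCommClass F B B]
  [IsScalarTower F B B] {e f : B}

namespace IsPeirce

variable [IsAlternativeRing B] (hs : HasTrivialIdeals F B)
include hs

/-- A nonzero central element of a diagonal Peirce space is not a zero divisor there. -/
theorem eq_zero_of_central (h : IsPeirce e f) (hf : f ≠ 0) {c b : B} (hc : c ∈ peirce F e e)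
    (hcomm : ∀ a ∈ peirce F e e, c * a = a * c) (hb : b ∈ peirce F e e) (hb0 : b ≠ 0)
    (hcb : c * b = 0) : c = 0 := by
  let Jee : Submodule F B := peirce F e e ⊓ LinearMap.ker (LinearMap.mulLeft F c)
  let Jef : Submodule F B := peirce F e f ⊓ LinearMap.ker (LinearMap.mulLeft F c)
  let Jfe : Submodule F B := peirce F f e ⊓ LinearMap.ker (LinearMap.mulRight F c)
  let Jff : Submodule F B :=
    { carrier := {b | b ∈ peirce F f f ∧ (∀ z ∈ peirce F e f, c * (z * b) = 0) ∧
        ∀ v ∈ peirce F f e, (b * v) * c = 0}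
      add_mem' := fun {a b} ha hb => ⟨add_mem ha.1 hb.1,
        fun x hx => by rw [mul_add, mul_add, ha.2.1 x hx, hb.2.1 x hx, add_zero],
        fun x hx => by rw [add_mul, add_mul, ha.2.2 x hx, hb.2.2 x hx, add_zero]⟩
      zero_mem' := ⟨zero_mem _, fun x _ => by rw [mul_zero, mul_zero],
        fun x _ => by rw [zero_mul, zero_mul]⟩
      smul_mem' := fun c a ha => ⟨Submodule.smul_mem _ c ha.1,
        fun x hx => by rw [mul_smul_comm, mul_smul_comm, ha.2.1 x hx, smul_zero],
        fun x hx => by rw [smul_mul_assoc, smul_mul_assoc, ha.2.2 x hx, smul_zero]⟩ }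
  have hJ : PeirceClosed e f Jee Jef Jfe Jff :=
    { le_ee := fun a ha => ha.1
      le_ef := fun a ha => ha.1
      ee_ee_left := fun a ⟨ha, (ha' : c * a = 0)⟩ a' hp => ⟨h.ee_ee ha hp, by
        change c * (a * a') = 0
        rw [← h.ee_assoc hs hf hc ha hp, ha', zero_mul]⟩
      ee_ee_right := fun a ⟨ha, (ha' : c * a = 0)⟩ a' hp => ⟨h.ee_ee hp ha, by
        change c * (a' * a) = 0
        rw [← h.ee_assoc hs hf hc hp ha, hcomm a' hp, h.ee_assoc hs hf hp hc ha, ha', mul_zero]⟩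
      ee_ef := fun a ⟨ha, (ha' : c * a = 0)⟩ x hx => ⟨h.ee_ef ha hx, by
        change c * (a * x) = 0
        rw [← h.ee_ee_ef hc ha hx, ha', zero_mul]⟩
      fe_ee := fun a ⟨ha, (ha' : c * a = 0)⟩ u hu => ⟨h.symm.ef_ff hu ha, by
        change (u * a) * c = 0
        rw [h.fe_ee_ee ha hc hu, ← hcomm a ha, ha', mul_zero]⟩
      ee_mul_ef := fun x ⟨hx, (hx' : c * x = 0)⟩ a ha => ⟨h.ee_ef ha hx, by
        change c * (a * x) = 0
        rw [← h.ee_ee_ef hc ha hx, hcomm a ha, h.ee_ee_ef ha hc hx, hx', mul_zero]⟩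
      ef_mul_ff := fun x ⟨hx, (hx' : c * x = 0)⟩ b hb => ⟨h.ef_ff hx hb, by
        change c * (x * b) = 0
        rw [← h.ee_ef_ff hc hx hb, hx', zero_mul]⟩
      ef_mul_fe := fun x ⟨hx, (hx' : c * x = 0)⟩ u hu => ⟨h.ef_fe hx hu, by
        change c * (x * u) = 0
        rw [← h.ee_ef_fe hc hx hu, hx', zero_mul]⟩
      fe_mul_ef := fun x ⟨hx, (hx' : c * x = 0)⟩ u hu => ⟨h.symm.ef_fe hu hx, fun z hz => by
          rw [h.mul_fe_ef hx hz hu, mul_add, ← h.ee_ee_ef hc (h.ef_fe hz hu) hx,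
            hcomm _ (h.ef_fe hz hu), h.ee_ee_ef (h.ef_fe hz hu) hc hx, hx', mul_zero,
            h.ef_swap hx hz, neg_mul, mul_neg, ← h.symm.ef_ff_ef hc (h.ef_ef hx hz) hu,
            ← h.ee_ef_ef hc hx hz, hx', zero_mul, zero_mul, neg_zero, add_zero],
        fun v hv => by
          rw [h.symm.ef_fe_mul hu hv hx, add_mul, h.fe_ee_ee (h.ef_fe hx hv) hc hu,
            ← hcomm _ (h.ef_fe hx hv), ← h.ee_ef_fe hc hx hv, hx', zero_mul, mul_zero,
            ← h.ee_ef_ef hc hx (h.symm.ef_ef hu hv), hx', zero_mul, add_zero]⟩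
      ef_mul_ef := fun x ⟨hx, (hx' : c * x = 0)⟩ y hy => ⟨h.ef_ef hx hy, by
        change (x * y) * c = 0
        rw [← h.ee_ef_ef hc hx hy, hx', zero_mul]⟩ }
  have hJ' : PeirceClosed f e Jff Jfe Jef Jee :=
    { le_ee := fun a ha => ha.1
      le_ef := fun a ha => ha.1
      ee_ee_left := fun b hb b' hb' => ⟨h.symm.ee_ee hb.1 hb', fun z hz => by
          rw [← h.symm.fe_ee_ee hb.1 hb' hz, ← h.ee_ef_ff hc (h.ef_ff hz hb.1) hb', hb.2.1 z hz,
            zero_mul],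
        fun v hv => by rw [h.symm.ee_ee_ef hb.1 hb' hv, hb.2.2 _ (h.symm.ee_ef hb' hv)]⟩
      ee_ee_right := fun b hb b' hb' => ⟨h.symm.ee_ee hb' hb.1, fun z hz => by
          rw [← h.symm.fe_ee_ee hb' hb.1 hz, hb.2.1 _ (h.ef_ff hz hb')],
        fun v hv => by
          rw [h.symm.ee_ee_ef hb' hb.1 hv, h.symm.ee_ef_ff hb' (h.symm.ee_ef hb.1 hv) hc,
            hb.2.2 _ hv, mul_zero]⟩
      ee_ef := fun b hb v hv => ⟨h.symm.ee_ef hb.1 hv, hb.2.2 v hv⟩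
      fe_ee := fun b hb z hz => ⟨h.ef_ff hz hb.1, hb.2.1 z hz⟩
      ee_mul_ef := fun u ⟨hu, (hu' : u * c = 0)⟩ b hb => ⟨h.symm.ee_ef hb hu, by
        change (b * u) * c = 0
        rw [h.symm.ee_ef_ff hb hu hc, hu', mul_zero]⟩
      ef_mul_ff := fun u ⟨hu, (hu' : u * c = 0)⟩ a ha => ⟨h.symm.ef_ff hu ha, by
        change (u * a) * c = 0
        rw [h.fe_ee_ee ha hc hu, ← hcomm a ha, ← h.fe_ee_ee hc ha hu, hu', zero_mul]⟩
      ef_mul_fe := fun u ⟨hu, (hu' : u * c = 0)⟩ x hx => ⟨h.symm.ef_fe hu hx, fun z hz => by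
          rw [h.mul_fe_ef hx hz hu, mul_add, ← h.ee_ee_ef hc (h.ef_fe hz hu) hx,
            hcomm _ (h.ef_fe hz hu), h.ef_fe_ee hc hz hu, hu', mul_zero, zero_mul, zero_add,
            ← h.symm.ef_ef_ff hc (h.ef_ef hz hx) hu, hu', mul_zero],
        fun v hv => by
          rw [h.symm.ef_fe_mul hu hv hx, add_mul, h.fe_ee_ee (h.ef_fe hx hv) hc hu,
            ← hcomm _ (h.ef_fe hx hv), ← h.fe_ee_ee hc (h.ef_fe hx hv) hu, hu', zero_mul,
            ← h.ef_ee_ef hc hx (h.symm.ef_ef hu hv), ← h.symm.ef_ff_ef hc hu hv, hu', zero_mul,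
            mul_zero, add_zero]⟩
      fe_mul_ef := fun u ⟨hu, (hu' : u * c = 0)⟩ x hx => ⟨h.ef_fe hx hu, by
        change c * (x * u) = 0
        rw [hcomm _ (h.ef_fe hx hu), h.ef_fe_ee hc hx hu, hu', mul_zero]⟩
      ef_mul_ef := fun u ⟨hu, (hu' : u * c = 0)⟩ v hv => ⟨h.symm.ef_ef hu hv, by
        change c * (u * v) = 0
        rw [← h.symm.ef_ff_ef hc hu hv, hu', zero_mul]⟩ }
  rcases h.bot_or_of_closed hs hJ hJ' with h' | h'
  · have : c * e = 0 := h'.1.2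
    rwa [hc.2] at this
  · exact absurd (h'.1 ▸ (⟨hb, hcb⟩ : b ∈ Jee) : b ∈ (⊥ : Submodule F B)) hb0

theorem exists_smul_of_central [IsAlgClosed F] [Module.Finite F B] (h : IsPeirce e f)
    (he : e ≠ 0) (hf : f ≠ 0) {c : B} (hc : c ∈ peirce F e e)
    (hcomm : ∀ a ∈ peirce F e e, c * a = a * c) : ∃ r : F, c = r • e := by
  let L : peirce F e e →ₗ[F] peirce F e e :=
    (LinearMap.mulLeft F c).restrict fun a ha => h.ee_ee hc ha
  have : Nontrivial (peirce F e e) :=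
    ⟨⟨⟨e, h.e_mem⟩, 0, fun h0 => he (congrArg Subtype.val h0)⟩⟩
  obtain ⟨r, hr⟩ := Module.End.exists_eigenvalue L
  obtain ⟨b, hb, hb0⟩ := hr.exists_hasEigenvector
  rw [Module.End.mem_eigenspace_iff] at hb
  have hb' : c * b.1 = r • b.1 := congrArg Subtype.val hb
  refine ⟨r, sub_eq_zero.1 (h.eq_zero_of_central hs hf
    (sub_mem hc (Submodule.smul_mem _ r h.e_mem)) (fun a ha => ?_) b.2
    (fun h0 => hb0 (Subtype.ext h0)) ?_)⟩
  · rw [sub_mul, mul_sub, hcomm a ha, smul_mul_assoc, mul_smul_comm, ha.1, ha.2]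
  · rw [sub_mul, hb', smul_mul_assoc, b.2.1, sub_self]

/-- If the Peirce space `P_{ef}` has a nonzero triple product then `P_{ee}` is one-dimensional. -/
theorem ee_scalar_of_mul_ne_zero [IsAlgClosed F] [Module.Finite F B] (h : IsPeirce e f)
    (he : e ≠ 0) (hf : f ≠ 0) {x y z : B} (hx : x ∈ peirce F e f) (hy : y ∈ peirce F e f)
    (hz : z ∈ peirce F e f) (h0 : z * (x * y) ≠ 0) {a : B} (ha : a ∈ peirce F e e) :
    ∃ r : F, a = r • e := by
  have key : ∀ {x y z a : B}, x ∈ peirce F e f → y ∈ peirce F e f → z ∈ peirce F e f →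
      a ∈ peirce F e e → (z * (x * y)) * a = a * (z * (x * y)) := by
    intro x y z a hx hy hz ha
    rw [h.ef_fe_ee ha hz (h.ef_ef hx hy), ← h.ee_ef_ef ha hx hy,
      (h.ef_cyclic (h.ee_ef ha hx) hy hz).1, (h.ef_cyclic hx hy hz).1,
      h.ee_ef_fe ha hx (h.ef_ef hy hz)]
  have hscalar : ∀ {x y z : B}, x ∈ peirce F e f → y ∈ peirce F e f → z ∈ peirce F e f →
      ∃ r : F, z * (x * y) = r • e := fun hx hy hz =>
    h.exists_smul_of_central hs he hf (h.ef_fe hz (h.ef_ef hx hy)) fun a ha => key hx hy hz ha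
  obtain ⟨r, hr⟩ := hscalar hx hy hz
  obtain ⟨s, hs'⟩ := hscalar hx hy (h.ee_ef ha hz)
  have hr0 : r ≠ 0 := by
    rintro rfl
    exact h0 (by rw [hr, zero_smul])
  refine ⟨r⁻¹ * s, ?_⟩
  rw [h.ee_ef_fe ha hz (h.ef_ef hx hy), hr, mul_smul_comm, ha.2] at hs'
  rw [mul_smul, ← hs', smul_smul, inv_mul_cancel₀ hr0, one_smul]

theorem ff_scalar_of_mul_ne_zero [IsAlgClosed F] [Module.Finite F B] (h : IsPeirce e f)
    (he : e ≠ 0) (hf : f ≠ 0) {x y z : B} (hx : x ∈ peirce F e f) (hy : y ∈ peirce F e f)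
    (hz : z ∈ peirce F e f) (h0 : (x * y) * z ≠ 0) {b : B} (hb : b ∈ peirce F f f) :
    ∃ r : F, b = r • f := by
  have hleft : ∀ {x y z b : B}, x ∈ peirce F e f → y ∈ peirce F e f → z ∈ peirce F e f →
      b ∈ peirce F f f → b * ((x * y) * z) = ((x * b) * y) * z := by
    intro x y z b hx hy hz hb
    rw [h.ef_ff_ef hb hx hy, h.symm.ee_ef_fe hb (h.ef_ef hx hy) hz]
  have key : ∀ {x y z b : B}, x ∈ peirce F e f → y ∈ peirce F e f → z ∈ peirce F e f →
      b ∈ peirce F f f → ((x * y) * z) * b = b * ((x * y) * z) := by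
    intro x y z b hx hy hz hb
    rw [h.symm.ef_fe_ee hb (h.ef_ef hx hy) hz, ← (h.ef_cyclic hx hy hz).2, hleft hz hx hy hb,
      (h.ef_cyclic hx hy (h.ef_ff hz hb)).2]
  have hscalar : ∀ {x y z : B}, x ∈ peirce F e f → y ∈ peirce F e f → z ∈ peirce F e f →
      ∃ r : F, (x * y) * z = r • f := fun hx hy hz =>
    h.symm.exists_smul_of_central hs hf he (h.symm.ef_fe (h.ef_ef hx hy) hz)
      fun a ha => key hx hy hz ha
  obtain ⟨r, hr⟩ := hscalar hx hy hz
  obtain ⟨s, hs'⟩ := hscalar (h.ef_ff hx hb) hy hz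
  have hr0 : r ≠ 0 := by
    rintro rfl
    exact h0 (by rw [hr, zero_smul])
  refine ⟨r⁻¹ * s, ?_⟩
  rw [← hleft hx hy hz hb, hr, mul_smul_comm, hb.2] at hs'
  rw [mul_smul, ← hs', smul_smul, inv_mul_cancel₀ hr0, one_smul]

end IsPeirce

end Simple

end IsAlternativeRing

namespace IsAlternativeRing

section Simple

variable {F B : Type*} [Field F] [NonAssocRing B] [Module F B] [SMulCommClass F B B]
  [IsScalarTower F B B] {e f : B}

namespace IsPeirce

variable [IsAlternativeRing B]

theorem assoc_ee_eq_zero (h : IsPeirce e f) {x : B} (hx : x ∈ peirce F e e) (y : B) :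
    associator e x y = 0 := by
  have h1 := (h.assoc_ee hx y).1
  rw [associator, hx.1, mul_sub, IsAlternativeRing.left_alt, h.left_idem, sub_self] at h1
  rw [associator, hx.1, h1]

theorem assoc_ff_eq_zero (h : IsPeirce e f) {x : B} (hx : x ∈ peirce F f f) (y : B) :
    associator e x y = 0 := by
  rw [h.symm.assoc_symm, h.symm.assoc_ee_eq_zero hx, neg_zero]

theorem assoc_ef_eq_zero (h : IsPeirce e f)
    (h1 : ∀ x ∈ peirce F e f, ∀ y ∈ peirce F e f, x * y = 0) {x : B} (hx : x ∈ peirce F e f)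
    (y : B) : associator e x y = 0 := by
  rw [h.sum_parts y, assoc_add_right, assoc_add_right, assoc_add_right,
    assoc_swap_right e (e * (y * e)) x,
    assoc_swap_right e (f * (y * f)) x, h.assoc_ee_eq_zero (h.ee_part_mem (F := F) y),
    h.assoc_ff_eq_zero (h.symm.ee_part_mem (F := F) y)]
  have h2 : associator e x (e * (y * f)) = 0 := by
    rw [associator, hx.1, h1 x hx _ (h.ef_part_mem y), mul_zero, sub_zero]
  have h3 : associator e x (f * (y * e)) = 0 := by
    have h3 := h.assoc_fe (F := F) (h.symm.ef_part_mem y) x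
    rw [assoc_swap_right, neg_mem_iff] at h3
    exact h.eq_zero_of_left h3.1 (h.assoc_ef hx _).1
  simp [h2, h3]

theorem assoc_eq_zero (h : IsPeirce e f)
    (h1 : ∀ x ∈ peirce F e f, ∀ y ∈ peirce F e f, x * y = 0)
    (h2 : ∀ x ∈ peirce F f e, ∀ y ∈ peirce F f e, x * y = 0) (x y : B) :
    associator e x y = 0 := by
  rw [h.sum_parts x, assoc_add_mid, assoc_add_mid, assoc_add_mid,
    h.assoc_ee_eq_zero (h.ee_part_mem (F := F) x), h.assoc_ef_eq_zero h1 (h.ef_part_mem x),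
    h.assoc_ff_eq_zero (h.symm.ee_part_mem (F := F) x), h.symm.assoc_symm,
    h.symm.assoc_ef_eq_zero h2 (h.symm.ef_part_mem x)]
  simp

/-- If `e` associates with everything, multiplying an associator by `e` projects its arguments. -/
theorem mul_assoc_of_nucleus (h : IsPeirce e f) (hn : ∀ x y : B, associator e x y = 0)
    (x y z : B) :
    e * associator x y z = associator (e * (x * e)) (e * (y * e)) (e * (z * e)) := by
  have l : ∀ x y : B, (e * x) * y = e * (x * y) := fun x y => sub_eq_zero.1 (hn x y)
  have m : ∀ x y : B, (x * e) * y = x * (e * y) := fun x y =>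
    sub_eq_zero.1 (by
      have := assoc_swap_left e x y
      rwa [hn, neg_zero] at this)
  have h1 : ∀ x y z : B, associator (e * x) y z = e * associator x y z := fun x y z => by
    simp only [associator, l, mul_sub]
  have h2 : ∀ x y z : B, associator (x * e) y z = e * associator x y z := fun x y z => by
    have : associator (x * e) y z = associator x (e * y) z := by
      simp only [associator, l, m]
    rw [this, assoc_swap_left, h1, assoc_swap_left, mul_neg, neg_neg]
  have h3 : ∀ x y z : B, associator (e * (x * e)) y z = e * associator x y z := fun x y z => by
    rw [h1, h2, ← l, h.left_idem]
  have h4 : ∀ x y z : B, associator x (e * (y * e)) z = e * associator x y z := fun x y z => by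
    rw [assoc_swap_left, h3, assoc_swap_left, mul_neg, neg_neg]
  have h5 : ∀ x y z : B, associator x y (e * (z * e)) = e * associator x y z := fun x y z => by
    rw [assoc_swap_right, h4, assoc_swap_right, mul_neg, neg_neg]
  rw [h3, h4, h5, ← l e, h.left_idem, ← l e, h.left_idem]

theorem exists_mul_ne_zero (h : IsPeirce e f) (hs : HasTrivialIdeals F B) (he : e ≠ 0)
    (hf : f ≠ 0) (hassoc : ¬ ∀ x y z : B, (x * y) * z = x * (y * z)) :
    (∃ x ∈ peirce F e f, ∃ y ∈ peirce F e f, x * y ≠ 0) ∨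
      ∃ x ∈ peirce F f e, ∃ y ∈ peirce F f e, x * y ≠ 0 := by
  by_contra! hcon
  refine hassoc fun x y z => sub_eq_zero.1 ?_
  have h1 := h.mul_assoc_of_nucleus (h.assoc_eq_zero hcon.1 hcon.2) x y z
  have h2 := h.symm.mul_assoc_of_nucleus (h.symm.assoc_eq_zero hcon.2 hcon.1) x y z
  have h4 := sub_eq_zero.2 (h.ee_assoc hs hf (h.ee_part_mem x) (h.ee_part_mem y)
    (h.ee_part_mem z))
  have h5 := sub_eq_zero.2 (h.symm.ee_assoc hs he (h.symm.ee_part_mem x) (h.symm.ee_part_mem y)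
    (h.symm.ee_part_mem z))
  rw [← associator] at h4 h5
  rw [h4] at h1
  rw [h5] at h2
  change associator x y z = 0
  rw [← one_mul (associator x y z), ← h.add_eq, add_mul, h1, h2, add_zero]

end IsPeirce

/-- A simple nonassociative algebra contains a split Peirce decomposition with one-dimensional
diagonal. -/
theorem exists_split [IsAlternativeRing B] [IsAlgClosed F] [Module.Finite F B]
    (hs : HasTrivialIdeals F B) (hassoc : ¬ ∀ x y z : B, (x * y) * z = x * (y * z)) :
    ∃ e f : B, IsPeirce e f ∧ e ≠ 0 ∧ f ≠ 0 ∧ (∀ a ∈ peirce F e e, ∃ r : F, a = r • e) ∧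
      (∀ b ∈ peirce F f f, ∃ r : F, b = r • f) ∧
      ∃ z ∈ peirce F e f, ∃ u ∈ peirce F f e, z * u ≠ 0 := by
  have key : ∀ e f : B, IsPeirce e f → e ≠ 0 → f ≠ 0 →
      (∃ x ∈ peirce F e f, ∃ y ∈ peirce F e f, x * y ≠ 0) →
      (∀ a ∈ peirce F e e, ∃ r : F, a = r • e) ∧ (∀ b ∈ peirce F f f, ∃ r : F, b = r • f) ∧
      ∃ z ∈ peirce F e f, ∃ u ∈ peirce F f e, z * u ≠ 0 ∧ u * z ≠ 0 := by
    rintro e f h he hf ⟨x, hx, y, hy, hxy⟩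
    have hu := h.ef_ef hx hy
    obtain ⟨z, hz, h1⟩ : ∃ z ∈ peirce F e f, z * (x * y) ≠ 0 ∨ (x * y) * z ≠ 0 := by
      by_contra! hcon
      exact hxy (h.symm.eq_zero_of_ef hs hf hu (fun z hz => (hcon z hz).2)
        fun z hz => (hcon z hz).1)
    have h2 : z * (x * y) ≠ 0 ∧ (x * y) * z ≠ 0 := by
      have hz0 : z ≠ 0 := by
        rintro rfl
        simp at h1
      have e1 : z * ((x * y) * z) = (z * (x * y)) * z := by
        rw [h.mul_fe_ef hz hz hu, h.ef_sq hz, zero_mul, add_zero]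
      rcases h1 with h1 | h1
      · refine ⟨h1, fun h3 => ?_⟩
        obtain ⟨r, hr⟩ := h.ee_scalar_of_mul_ne_zero hs he hf hx hy hz h1 (h.ef_fe hz hu)
        rw [h3, hr, mul_zero, smul_mul_assoc, hz.1] at e1
        rcases smul_eq_zero.1 e1.symm with rfl | h4
        · exact h1 (by rw [hr, zero_smul])
        · exact hz0 h4
      · refine ⟨fun h3 => ?_, h1⟩
        obtain ⟨r, hr⟩ := h.ff_scalar_of_mul_ne_zero hs he hf hx hy hz h1 (h.symm.ef_fe hu hz)
        rw [h3, hr, zero_mul, mul_smul_comm, hz.2] at e1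
        rcases smul_eq_zero.1 e1 with rfl | h4
        · exact h1 (by rw [hr, zero_smul])
        · exact hz0 h4
    exact ⟨fun a ha => h.ee_scalar_of_mul_ne_zero hs he hf hx hy hz h2.1 ha,
      fun b hb => h.ff_scalar_of_mul_ne_zero hs he hf hx hy hz h2.2 hb, z, hz, _, hu, h2⟩
  obtain ⟨e, hee, he, he1⟩ := exists_idempotent hs hassoc
  have h : IsPeirce e (1 - e) :=
    ⟨hee, by simp [mul_sub, sub_mul, hee], by simp [mul_sub, hee], by simp [sub_mul, hee],
      add_sub_cancel e 1⟩
  have hf : 1 - e ≠ 0 := fun h => he1 (sub_eq_zero.1 h).symm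
  rcases h.exists_mul_ne_zero hs he hf hassoc with h1 | h1
  · obtain ⟨ha, hb, z, hz, u, hu, h2, -⟩ := key _ _ h he hf h1
    exact ⟨e, 1 - e, h, he, hf, ha, hb, z, hz, u, hu, h2⟩
  · obtain ⟨ha, hb, z, hz, u, hu, h2, -⟩ := key _ _ h.symm hf he h1
    exact ⟨1 - e, e, h.symm, hf, he, ha, hb, z, hz, u, hu, h2⟩

end Simple

end IsAlternativeRing

namespace IsAlternativeRing

section Trace

variable {F B : Type*} [Field F] [NonAssocRing B] [Module F B] [SMulCommClass F B B]
  [IsScalarTower F B B] [IsAlternativeRing B] {e f : B}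

theorem IsPeirce.mul_comm_scalar (h : IsPeirce e f) (he : e ≠ 0) (hf : f ≠ 0)
    (hee : ∀ a ∈ peirce F e e, ∃ r : F, a = r • e) (hff : ∀ b ∈ peirce F f f, ∃ r : F, b = r • f)
    {p q : B} (hp : p ∈ peirce F e f) (hq : q ∈ peirce F f e) :
    ∃ r : F, p * q = r • e ∧ q * p = r • f := by
  obtain ⟨r, hr⟩ := hee _ (h.ef_fe hp hq)
  obtain ⟨s, hs⟩ := hff _ (h.symm.ef_fe hq hp)
  have h1 := flexible p q
  rw [hr, hs, smul_mul_assoc, mul_smul_comm, hp.1, hp.2] at h1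
  by_cases hp0 : p = 0
  · have hr0 : r = 0 := by
      rw [hp0, zero_mul] at hr
      exact (smul_eq_zero.1 hr.symm).resolve_right he
    have hs0 : s = 0 := by
      rw [hp0, mul_zero] at hs
      exact (smul_eq_zero.1 hs.symm).resolve_right hf
    exact ⟨r, hr, by rw [hs, hs0, hr0]⟩
  · have hrs : r = s := smul_left_injective F hp0 h1
    exact ⟨r, hr, by rw [hs, hrs]⟩

/-- A simple nonassociative alternative algebra satisfies a quadratic equation. -/
theorem exists_trace_sq [IsAlgClosed F] [Module.Finite F B]
    (hs : HasTrivialIdeals F B) (hassoc : ¬ ∀ x y z : B, (x * y) * z = x * (y * z)) :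
    ∃ t : B →ₗ[F] F, t 1 = 2 ∧ (∀ x, ∃ n : F, x * x = t x • x - n • 1) ∧
      ∃ p q y a b : B, (⁅⁅p, q⁆, y⁆) * ⁅a, b⁆ + ⁅a, b⁆ * ⁅⁅p, q⁆, y⁆ ≠ 0 := by
  obtain ⟨e, f, h, he, hf, hee, hff, z, hz, u, hu, hzu⟩ := exists_split hs hassoc
  obtain ⟨ℓ, hℓ⟩ := Module.Projective.exists_dual_eq_one F he
  obtain ⟨m, hm⟩ := Module.Projective.exists_dual_eq_one F hf
  let α : B →ₗ[F] F := ℓ ∘ₗ LinearMap.mulLeft F e ∘ₗ LinearMap.mulRight F e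
  let β : B →ₗ[F] F := m ∘ₗ LinearMap.mulLeft F f ∘ₗ LinearMap.mulRight F f
  have hα : ∀ x, e * (x * e) = α x • e := fun x => by
    obtain ⟨r, hr⟩ := hee _ (h.ee_part_mem x)
    change _ = ℓ (e * (x * e)) • e
    rw [hr, map_smul, hℓ, smul_eq_mul, mul_one]
  have hβ : ∀ x, f * (x * f) = β x • f := fun x => by
    obtain ⟨r, hr⟩ := hff _ (h.symm.ee_part_mem x)
    change _ = m (f * (x * f)) • f
    rw [hr, map_smul, hm, smul_eq_mul, mul_one]
  refine ⟨α + β, ?_, fun x => ?_, e, z, e, e, u, ?_⟩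
  · have h1 : α 1 = 1 := by
      change ℓ (e * (1 * e)) = 1
      rw [one_mul, h.left_idem, hℓ]
    have h2 : β 1 = 1 := by
      change m (f * (1 * f)) = 1
      rw [one_mul, h.right_idem, hm]
    rw [LinearMap.add_apply, h1, h2, one_add_one_eq_two]
  · have hp := h.ef_part_mem (F := F) x
    have hq := h.symm.ef_part_mem (F := F) x
    obtain ⟨r, hr, hr'⟩ := h.mul_comm_scalar he hf hee hff hp hq
    refine ⟨α x * β x - r, ?_⟩
    have hx := h.sum_parts x
    have hpp := h.ef_sq hp
    have hqq := h.symm.ef_sq hq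
    rw [h.mem_ef] at hp
    rw [h.mem_fe] at hq
    rw [hα, hβ] at hx
    generalize e * (x * f) = p at *
    generalize f * (x * e) = q at *
    rw [← h.add_eq, LinearMap.add_apply]
    generalize α x = a at *
    generalize β x = b at *
    subst hx
    simp only [mul_add, add_mul, smul_mul_assoc, mul_smul_comm, hp, hq, hpp, hqq, hr, hr',
      h.left_idem, h.right_idem, h.left_right, h.right_left, smul_zero]
    module
  · obtain ⟨r, hr, hr'⟩ := h.mul_comm_scalar he hf hee hff hz hu
    have hr0 : r ≠ 0 := by
      rintro rfl
      exact hzu (by rw [hr, zero_smul])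
    rw [h.mem_ef] at hz
    rw [h.mem_fe] at hu
    simp only [Ring.lie_def, hz, hu, sub_zero, zero_sub, mul_neg, neg_mul, neg_neg, hr, hr']
    rw [← smul_add, h.add_eq]
    intro h0
    rcases smul_eq_zero.1 h0 with h1 | h1
    · exact hr0 h1
    · exact he (by rw [← mul_one e, h1, mul_zero])

/-- A simple nonassociative alternative algebra has a trace form. -/
theorem exists_trace [IsAlgClosed F] [Module.Finite F B] (h2 : (2 : F) ≠ 0)
    (hs : HasTrivialIdeals F B) (hassoc : ¬ ∀ x y z : B, (x * y) * z = x * (y * z)) :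
    ∃ t : B →ₗ[F] F, t 1 = 2 ∧ (∀ x y, t (x * y) = t (y * x)) ∧
      (∀ x y, x * y + y * x = t x • y + t y • x + (t (x * y) - t x * t y) • 1) ∧
      ∃ p q y a b : B, (⁅⁅p, q⁆, y⁆) * ⁅a, b⁆ + ⁅a, b⁆ * ⁅⁅p, q⁆, y⁆ ≠ 0 := by
  obtain ⟨t, ht1, hsq, hne⟩ := exists_trace_sq hs hassoc
  have hpolar : ∀ x y, ∃ n : F, x * y + y * x = t x • y + t y • x - n • 1 := fun x y => by
    obtain ⟨n₁, hn₁⟩ := hsq x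
    obtain ⟨n₂, hn₂⟩ := hsq y
    obtain ⟨n₃, hn₃⟩ := hsq (x + y)
    refine ⟨n₃ - n₁ - n₂, ?_⟩
    simp only [add_mul, mul_add, map_add] at hn₃
    linear_combination (norm := module) hn₃ - hn₁ - hn₂
  have hcomm : ∀ x y, t (x * y) = t (y * x) := fun x y => by
    by_cases hx : ∃ r : F, x = r • (1 : B)
    · obtain ⟨r, rfl⟩ := hx
      rw [smul_mul_assoc, mul_smul_comm, one_mul, mul_one]
    · obtain ⟨n, hn⟩ := hsq x
      obtain ⟨n₁, hn₁⟩ := hpolar x (x * y)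
      obtain ⟨n₂, hn₂⟩ := hpolar x (y * x)
      have e1 : x * (x * y) = t x • (x * y) - n • y := by
        rw [left_alt, hn, sub_mul, smul_mul_assoc, smul_mul_assoc, one_mul]
      have e2 : (y * x) * x = t x • (y * x) - n • y := by
        rw [right_alt, hn, mul_sub, mul_smul_comm, mul_smul_comm, mul_one]
      have e3 := flexible x y
      by_contra hne
      refine hx ⟨(t (x * y) - t (y * x))⁻¹ * (n₁ - n₂), ?_⟩
      have key : (t (x * y) - t (y * x)) • x = (n₁ - n₂) • (1 : B) := by
        linear_combination (norm := module) hn₂ - hn₁ + e1 - e2 + e3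
      rw [mul_smul, ← key, smul_smul, inv_mul_cancel₀ (sub_ne_zero.2 hne), one_smul]
  refine ⟨t, ht1, hcomm, fun x y => ?_, hne⟩
  obtain ⟨n, hn⟩ := hpolar x y
  have h1 := congrArg t hn
  simp only [map_add, map_sub, map_smul, smul_eq_mul, ht1, ← hcomm x y] at h1
  have h3 : n = t x * t y - t (x * y) := by
    apply mul_left_cancel₀ h2
    linear_combination h1
  rw [hn, h3]
  module

end Trace

end IsAlternativeRing

namespace IsAlternativeRing

section Quotient

universe v

theorem exists_quotient {F : Type*} {B : Type v} [Field F] [NonAssocRing B] [Module F B]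
    [SMulCommClass F B B] [IsScalarTower F B B] (I : Submodule F B)
    (hI : ∀ x ∈ I, ∀ y, x * y ∈ I ∧ y * x ∈ I) :
    ∃ (C : Type v) (_ : NonAssocRing C) (_ : Module F C) (_ : SMulCommClass F C C)
      (_ : IsScalarTower F C C) (q : B →ₗ[F] C), Function.Surjective q ∧
      (∀ x y, q (x * y) = q x * q y) ∧ q 1 = 1 ∧ ∀ x, q x = 0 ↔ x ∈ I := by
  let c : RingCon B :=
    { r := fun x y => x - y ∈ I
      iseqv := ⟨fun x => by simp, fun {x y} h => by simpa using I.neg_mem h,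
        fun {x y z} h h' => by simpa using I.add_mem h h'⟩
      add' := fun {w x y z} h h' => by
        have := I.add_mem h h'
        rwa [← add_sub_add_comm] at this
      mul' := fun {w x y z} h h' => by
        have := I.add_mem (hI _ h y).1 (hI _ h' x).2
        rwa [sub_mul, mul_sub, sub_add_sub_cancel] at this }
  have hsurj : Function.Surjective (fun x : B => (x : c.Quotient)) := Quotient.mk_surjective
  let : Module F c.Quotient :=
    { add_smul := fun r s x => by
        obtain ⟨x, rfl⟩ := hsurj x
        exact congrArg (fun x : B => (x : c.Quotient)) (add_smul r s x)
      zero_smul := fun x => by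
        obtain ⟨x, rfl⟩ := hsurj x
        exact congrArg (fun x : B => (x : c.Quotient)) (zero_smul F x) }
  refine ⟨c.Quotient, inferInstance, inferInstance, inferInstance, inferInstance,
    { toFun := fun x => x, map_add' := fun _ _ => rfl, map_smul' := fun _ _ => rfl },
    hsurj, fun _ _ => rfl, rfl, fun x => ?_⟩
  change (x : c.Quotient) = ((0 : B) : c.Quotient) ↔ _
  rw [RingCon.eq]
  change x - 0 ∈ I ↔ _
  rw [sub_zero]

theorem exists_smul_one_of_central {F B : Type*} [Field F] [IsAlgClosed F] [NonAssocRing B]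
    [Module F B] [SMulCommClass F B B] [IsScalarTower F B B] [Module.Finite F B]
    [IsAlternativeRing B] (hs : HasTrivialIdeals F B) (hB : (1 : B) ≠ 0) {c : B}
    (hcomm : ∀ x, c * x = x * c)
    (hleft : ∀ x y, c * (x * y) = (c * x) * y) : ∃ r : F, c = r • (1 : B) := by
  have : Nontrivial B := ⟨⟨1, 0, hB⟩⟩
  obtain ⟨r, hr⟩ := Module.End.exists_eigenvalue (LinearMap.mulLeft F c)
  refine ⟨r, ?_⟩
  have hmem : ∀ x, x ∈ Module.End.eigenspace (LinearMap.mulLeft F c) r ↔ c * x = r • x :=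
    fun x => Module.End.mem_eigenspace_iff
  have hideal : ∀ x ∈ Module.End.eigenspace (LinearMap.mulLeft F c) r, ∀ y,
      x * y ∈ Module.End.eigenspace (LinearMap.mulLeft F c) r ∧
      y * x ∈ Module.End.eigenspace (LinearMap.mulLeft F c) r := fun x hx y => by
    rw [hmem] at hx ⊢
    rw [hmem]
    refine ⟨by rw [hleft, hx, smul_mul_assoc], ?_⟩
    have h1 := assoc_swap_left c y x
    have h2 := hleft y x
    simp only [associator_apply] at h1
    rw [← mul_smul_comm, ← hx, h2, hcomm y, ← sub_eq_zero, h1, h2, sub_self, neg_zero]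
  rcases hs _ hideal with h | h
  · exact absurd h hr
  · have := (hmem 1).1 (h ▸ Submodule.mem_top)
    rwa [mul_one] at this

theorem exists_maximal_ideal {F B : Type*} [Field F] [NonAssocRing B] [Module F B]
    [Module.Finite F B] [Nontrivial B] :
    ∃ I : Submodule F B, (∀ x ∈ I, ∀ y, x * y ∈ I ∧ y * x ∈ I) ∧ I ≠ ⊤ ∧
      ∀ J : Submodule F B, (∀ x ∈ J, ∀ y, x * y ∈ J ∧ y * x ∈ J) → I ≤ J → J = I ∨ J = ⊤ := by
  obtain ⟨I, ⟨hI, hI'⟩, hmax⟩ := set_has_maximal_iff_noetherian.2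
    (inferInstance : IsNoetherian F B)
    {I : Submodule F B | (∀ x ∈ I, ∀ y, x * y ∈ I ∧ y * x ∈ I) ∧ I ≠ ⊤}
    ⟨⊥, fun x hx y => by simp [(Submodule.mem_bot F).1 hx], bot_ne_top⟩
  refine ⟨I, hI, hI', fun J hJ hIJ => ?_⟩
  by_cases h : J = ⊤
  · exact Or.inr h
  · exact Or.inl (((hIJ.lt_or_eq).resolve_left (hmax J ⟨hJ, h⟩)).symm)

/-- A nonzero finite-dimensional algebra has a simple quotient. -/
theorem exists_simple_quotient {F : Type*} {B : Type v} [Field F] [NonAssocRing B] [Module F B]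
    [SMulCommClass F B B] [IsScalarTower F B B] [Module.Finite F B] [Nontrivial B] :
    ∃ (C : Type v) (_ : NonAssocRing C) (_ : Module F C) (_ : SMulCommClass F C C)
      (_ : IsScalarTower F C C) (q : B →ₗ[F] C), Function.Surjective q ∧
      (∀ x y, q (x * y) = q x * q y) ∧ q 1 = 1 ∧ HasTrivialIdeals F C ∧ (1 : C) ≠ 0 := by
  obtain ⟨I, hI, hI', hmax⟩ := exists_maximal_ideal (F := F) (B := B)
  obtain ⟨C, _, _, _, _, q, hq, hmul, hone, hker⟩ := exists_quotient I hI
  refine ⟨C, _, _, ‹_›, ‹_›, q, hq, hmul, hone, fun J hJ => ?_, fun h => hI' ?_⟩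
  · have hJ' : ∀ x ∈ J.comap q, ∀ y, x * y ∈ J.comap q ∧ y * x ∈ J.comap q := fun x hx y => by
      rw [Submodule.mem_comap, Submodule.mem_comap, hmul, hmul]
      exact hJ _ hx _
    have hIJ : I ≤ J.comap q := fun x hx => by
      rw [Submodule.mem_comap, (hker x).2 hx]
      exact J.zero_mem
    rcases hmax (J.comap q) hJ' hIJ with h | h
    · left
      rw [eq_bot_iff]
      intro y hy
      obtain ⟨x, rfl⟩ := hq y
      have : x ∈ J.comap q := hy
      rw [h] at this
      simpa using (hker x).2 this
    · right
      rw [eq_top_iff]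
      intro y _
      obtain ⟨x, rfl⟩ := hq y
      have : x ∈ J.comap q := h ▸ Submodule.mem_top
      exact this
  · rw [eq_top_iff]
    intro x _
    rw [← hker, ← one_mul x, hmul, hone, h, zero_mul]

end Quotient

section BaseChange

open scoped TensorProduct

variable {k F A : Type*} [Field k] [Field F] [Algebra k F] [NonAssocRing A] [Module k A]
  [SMulCommClass k A A] [IsScalarTower k A A]

theorem associator_tmul (a b c : F) (x y z : A) :
    associator (a ⊗ₜ[k] x) (b ⊗ₜ[k] y) (c ⊗ₜ[k] z) = (a * b * c) ⊗ₜ[k] associator x y z := by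
  simp only [associator_apply, Algebra.TensorProduct.tmul_mul_tmul, TensorProduct.tmul_sub,
    mul_assoc]

variable [IsAlternativeRing A]

theorem assoc_swap_left_tensor (x y z : F ⊗[k] A) :
    associator y x z = -associator x y z := by
  induction x with
  | zero => simp [associator_apply]
  | add u v hu hv => rw [assoc_add_left, assoc_add_mid, hu, hv, neg_add]
  | tmul a x =>
    induction y with
    | zero => simp [associator_apply]
    | add u v hu hv => rw [assoc_add_left, assoc_add_mid, hu, hv, neg_add]
    | tmul b y =>
      induction z with
      | zero => simp [associator_apply]
      | add u v hu hv => rw [assoc_add_right, assoc_add_right, hu, hv, neg_add]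
      | tmul c z =>
        rw [associator_tmul, associator_tmul, assoc_swap_left, TensorProduct.tmul_neg, mul_comm a]

theorem assoc_swap_right_tensor (x y z : F ⊗[k] A) :
    associator x z y = -associator x y z := by
  induction x with
  | zero => simp [associator_apply]
  | add u v hu hv => rw [assoc_add_left, assoc_add_left, hu, hv, neg_add]
  | tmul a x =>
    induction y with
    | zero => simp [associator_apply]
    | add u v hu hv => rw [assoc_add_right, assoc_add_mid, hu, hv, neg_add]
    | tmul b y =>
      induction z with
      | zero => simp [associator_apply]
      | add u v hu hv => rw [assoc_add_right, assoc_add_mid, hu, hv, neg_add]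
      | tmul c z =>
        rw [associator_tmul, associator_tmul, assoc_swap_right, TensorProduct.tmul_neg,
          mul_right_comm]

theorem isAlternativeRing_tensor (h2 : (2 : F) ≠ 0) : IsAlternativeRing (F ⊗[k] A) := by
  have h0 : ∀ w : F ⊗[k] A, w = -w → w = 0 := fun w hw => by
    have : (2 : F) • w = 0 := by
      rw [two_smul]
      nth_rewrite 2 [hw]
      exact add_neg_cancel w
    exact (smul_eq_zero.1 this).resolve_left h2
  constructor
  · intro x y
    have := h0 _ (assoc_swap_left_tensor x x y)
    rw [associator_apply, sub_eq_zero] at this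
    exact this.symm
  · intro x y
    have := h0 _ (assoc_swap_right_tensor y x x)
    rwa [associator_apply, sub_eq_zero] at this

end BaseChange

end IsAlternativeRing

namespace AlgebraWithInvolution

open IsAlternativeRing
open scoped TensorProduct

universe v

theorem eq_zero_of_span {F B : Type*} [Field F] [AddCommGroup B] [Module F B] {S : Set B}
    (hS : Submodule.span F S = ⊤) (g : B → B) (hadd : ∀ x y, g (x + y) = g x + g y)
    (hsmul : ∀ (r : F) x, g (r • x) = r • g x) (h0 : ∀ x ∈ S, g x = 0) (x : B) : g x = 0 := by
  let G : B →ₗ[F] B := { toFun := g, map_add' := hadd, map_smul' := hsmul }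
  have : G = 0 := LinearMap.ext_on hS h0
  exact congrArg (fun G : B →ₗ[F] B => G x) this

/-- A nonassociative alternative simple algebra with involution maps to a simple alternative
algebra over an algebraically closed field. -/
theorem exists_embedding {k : Type v} [Field k] (hk2 : (2 : k) ≠ 0) (A : AlgebraWithInvolution k)
    [Module.Finite k A.carrier] [IsAlternativeRing A.carrier]
    (hsimple : ∀ I : Submodule k A.carrier,
      (∀ a ∈ I, ∀ x : A.carrier, x * a ∈ I ∧ a * x ∈ I) → (∀ a ∈ I, A.invol a ∈ I) →
        I = ⊥ ∨ I = ⊤)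
    (hassoc : ¬ ∀ x y z : A, associator x y z = 0) :
    ∃ (F : Type v) (_ : Field F) (_ : Algebra k F) (B : Type v) (_ : NonAssocRing B)
      (_ : Module F B) (_ : SMulCommClass F B B) (_ : IsScalarTower F B B)
      (_ : IsAlternativeRing B) (π : A.carrier →+ B) (t : B →ₗ[F] F),
      (∀ (c : k) a, π (c • a) = algebraMap k F c • π a) ∧ π 1 = 1 ∧
      (∀ x y, π (x * y) = π x * π y) ∧ (∀ a, π a = 0 → π (A.invol a) = 0 → a = 0) ∧
      t 1 = 2 ∧ (∀ x y, t (x * y) = t (y * x)) ∧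
      (∀ x y, x * y + y * x = t x • y + t y • x + (t (x * y) - t x * t y) • 1) ∧
      (∀ c ∈ Set.center A.carrier, ∃ r : F, π c = r • (1 : B)) ∧
      (∃ p q y a b : A, π (⁅⁅p, q⁆, y⁆ * ⁅a, b⁆ + ⁅a, b⁆ * ⁅⁅p, q⁆, y⁆) ≠ 0) := by
  let F := AlgebraicClosure k
  have hF2 : (2 : F) ≠ 0 := by
    have := (map_ne_zero (algebraMap k F)).2 hk2
    rwa [map_ofNat] at this
  have : Nontrivial A.carrier := by
    by_contra h
    rw [not_nontrivial_iff_subsingleton] at h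
    exact hassoc fun x y z => Subsingleton.elim _ _
  have : Nontrivial (F ⊗[k] A.carrier) := by
    apply Module.nontrivial_of_finrank_pos (R := F)
    rw [Module.finrank_baseChange]
    exact Module.finrank_pos
  have : IsAlternativeRing (F ⊗[k] A.carrier) := isAlternativeRing_tensor hF2
  obtain ⟨B, _, _, _, _, q, hq, hmul, hone, hB, hB1⟩ :=
    exists_simple_quotient (F := F) (B := F ⊗[k] A.carrier)
  have : IsAlternativeRing B := by
    constructor
    · intro x y
      obtain ⟨x, rfl⟩ := hq x
      obtain ⟨y, rfl⟩ := hq y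
      simp only [← hmul, left_alt]
    · intro x y
      obtain ⟨x, rfl⟩ := hq x
      obtain ⟨y, rfl⟩ := hq y
      simp only [← hmul, right_alt]
  have : Module.Finite F B := Module.Finite.of_surjective q hq
  let π : A.carrier →+ B :=
    q.toAddMonoidHom.comp (TensorProduct.mk k F A.carrier 1).toAddMonoidHom
  have hπ : ∀ a, π a = q (1 ⊗ₜ a) := fun a => rfl
  have hπsmul : ∀ (c : k) a, π (c • a) = algebraMap k F c • π a := fun c a => by
    rw [hπ, hπ, ← map_smul, ← TensorProduct.smul_tmul, TensorProduct.smul_tmul',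
      Algebra.algebraMap_eq_smul_one, smul_assoc, one_smul]
  have hπ1 : π 1 = 1 := hone
  have hπmul : ∀ x y, π (x * y) = π x * π y := fun x y => by
    rw [hπ, hπ, hπ, ← hmul, Algebra.TensorProduct.tmul_mul_tmul, one_mul]
  have hspan : Submodule.span F (Set.range π) = ⊤ := by
    rw [eq_top_iff]
    intro y _
    obtain ⟨x, rfl⟩ := hq y
    induction x with
    | zero => rw [map_zero]; exact Submodule.zero_mem _
    | add u v hu hv => rw [map_add]; exact Submodule.add_mem _ (hu trivial) (hv trivial)
    | tmul c a =>
      rw [← mul_one c, ← smul_eq_mul, ← TensorProduct.smul_tmul', map_smul]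
      exact Submodule.smul_mem _ _ (Submodule.subset_span ⟨a, rfl⟩)
  have hker : ∀ a, π a = 0 → π (A.invol a) = 0 → a = 0 := by
    let I : Submodule k A.carrier :=
      { carrier := {a | π a = 0 ∧ π (A.invol a) = 0}
        zero_mem' := by simp
        add_mem' := fun {a b} ha hb => by
          simp only [Set.mem_ofPred_eq, map_add] at *
          rw [ha.1, ha.2, hb.1, hb.2, add_zero]
          exact ⟨rfl, rfl⟩
        smul_mem' := fun c a ha => by
          simp only [Set.mem_ofPred_eq, map_smul, hπsmul] at *
          rw [ha.1, ha.2, smul_zero]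
          exact ⟨rfl, rfl⟩ }
    have hI : I = ⊥ ∨ I = ⊤ := by
      refine hsimple I (fun a ha x => ⟨⟨?_, ?_⟩, ?_, ?_⟩) fun a ha => ⟨ha.2, ?_⟩
      · rw [hπmul, ha.1, mul_zero]
      · rw [A.invol_mul, hπmul, ha.2, zero_mul]
      · rw [hπmul, ha.1, zero_mul]
      · rw [A.invol_mul, hπmul, ha.2, mul_zero]
      · rw [A.invol_invol, ha.1]
    intro a h h'
    rcases hI with hI | hI
    · have : a ∈ I := ⟨h, h'⟩
      rwa [hI, Submodule.mem_bot] at this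
    · have : (1 : A) ∈ I := hI ▸ Submodule.mem_top
      exact absurd (hπ1.symm.trans this.1) hB1
  have hBassoc : ¬ ∀ x y z : B, (x * y) * z = x * (y * z) := fun h =>
    hassoc fun x y z => by
      refine hker _ ?_ ?_
      · rw [associator_apply, map_sub, hπmul, hπmul, hπmul, hπmul, h, sub_self]
      · rw [associator_apply, map_sub, map_sub]
        simp only [A.invol_mul, hπmul, h, sub_self]
  obtain ⟨t, ht1, htc, htp, p, r, y, a, b, hne⟩ := exists_trace hF2 hB hBassoc
  refine ⟨F, inferInstance, inferInstance, B, _, _, ‹_›, ‹_›, ‹_›, π, t, hπsmul, hπ1, hπmul,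
    hker, ht1, htc, htp, fun c hc => ?_, ?_⟩
  · have hcomm : ∀ x : B, π c * x = x * π c := fun x => by
      rw [← sub_eq_zero]
      refine eq_zero_of_span hspan (fun x => π c * x - x * π c) (fun u v => ?_) (fun r u => ?_)
        ?_ x
      · simp only [mul_add, add_mul]
        abel
      · simp only [mul_smul_comm, smul_mul_assoc, smul_sub]
      · rintro _ ⟨x, rfl⟩
        simp only [← hπmul, (hc.comm x).eq, sub_self]
    have hleft : ∀ x y : B, π c * (x * y) = (π c * x) * y := fun x y => by
      rw [← sub_eq_zero]
      refine eq_zero_of_span hspan (fun x => π c * (x * y) - (π c * x) * y) (fun u v => ?_)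
        (fun r u => ?_) ?_ x
      · simp only [mul_add, add_mul]
        abel
      · simp only [mul_smul_comm, smul_mul_assoc, smul_sub]
      · rintro _ ⟨x, rfl⟩
        refine eq_zero_of_span hspan (fun y => π c * (π x * y) - (π c * π x) * y) (fun u v => ?_)
          (fun r u => ?_) ?_ y
        · simp only [mul_add]
          abel
        · simp only [mul_smul_comm, smul_sub]
        · rintro _ ⟨y, rfl⟩
          simp only [← hπmul, hc.left_assoc, sub_self]
    exact exists_smul_one_of_central hB hB1 hcomm hleft
  by_contra! hall
  have h5 : ∀ p q y a b : A, ⁅⁅π p, π q⁆, π y⁆ * ⁅π a, π b⁆ + ⁅π a, π b⁆ * ⁅⁅π p, π q⁆, π y⁆ = 0 :=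
    fun p q y a b => by
      simpa only [map_add, hπmul, Ring.lie_def, map_sub] using hall p q y a b
  have h4 : ∀ (p q y a : A) (b : B),
      ⁅⁅π p, π q⁆, π y⁆ * ⁅π a, b⁆ + ⁅π a, b⁆ * ⁅⁅π p, π q⁆, π y⁆ = 0 := fun p q y a b => by
    refine eq_zero_of_span hspan
      (fun b => ⁅⁅π p, π q⁆, π y⁆ * ⁅π a, b⁆ + ⁅π a, b⁆ * ⁅⁅π p, π q⁆, π y⁆) ?_ ?_ ?_ b
    · intro u v
      simp only [Ring.lie_def, mul_add, add_mul, mul_sub, sub_mul]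
      abel
    · intro c u
      simp only [Ring.lie_def, mul_sub, sub_mul, mul_smul_comm, smul_mul_assoc, smul_add, smul_sub]
    · rintro _ ⟨b, rfl⟩
      exact h5 p q y a b
  have h3 : ∀ (p q y : A) (a b : B),
      ⁅⁅π p, π q⁆, π y⁆ * ⁅a, b⁆ + ⁅a, b⁆ * ⁅⁅π p, π q⁆, π y⁆ = 0 := fun p q y a b => by
    refine eq_zero_of_span hspan
      (fun a => ⁅⁅π p, π q⁆, π y⁆ * ⁅a, b⁆ + ⁅a, b⁆ * ⁅⁅π p, π q⁆, π y⁆) ?_ ?_ ?_ a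
    · intro u v
      simp only [Ring.lie_def, mul_add, add_mul, mul_sub, sub_mul]
      abel
    · intro c u
      simp only [Ring.lie_def, mul_sub, sub_mul, mul_smul_comm, smul_mul_assoc, smul_add, smul_sub]
    · rintro _ ⟨a, rfl⟩
      exact h4 p q y a b
  have hh2 : ∀ (p q : A) (y a b : B),
      ⁅⁅π p, π q⁆, y⁆ * ⁅a, b⁆ + ⁅a, b⁆ * ⁅⁅π p, π q⁆, y⁆ = 0 := fun p q y a b => by
    refine eq_zero_of_span hspan
      (fun y => ⁅⁅π p, π q⁆, y⁆ * ⁅a, b⁆ + ⁅a, b⁆ * ⁅⁅π p, π q⁆, y⁆) ?_ ?_ ?_ y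
    · intro u v
      simp only [Ring.lie_def, mul_add, add_mul, mul_sub, sub_mul]
      abel
    · intro c u
      simp only [Ring.lie_def, mul_sub, sub_mul, mul_smul_comm, smul_mul_assoc, smul_add, smul_sub]
    · rintro _ ⟨y, rfl⟩
      exact h3 p q y a b
  have h1 : ∀ (p : A) (q y a b : B),
      ⁅⁅π p, q⁆, y⁆ * ⁅a, b⁆ + ⁅a, b⁆ * ⁅⁅π p, q⁆, y⁆ = 0 := fun p q y a b => by
    refine eq_zero_of_span hspan
      (fun q => ⁅⁅π p, q⁆, y⁆ * ⁅a, b⁆ + ⁅a, b⁆ * ⁅⁅π p, q⁆, y⁆) ?_ ?_ ?_ q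
    · intro u v
      simp only [Ring.lie_def, mul_add, add_mul, mul_sub, sub_mul]
      abel
    · intro c u
      simp only [Ring.lie_def, mul_sub, sub_mul, mul_smul_comm, smul_mul_assoc, smul_add, smul_sub]
    · rintro _ ⟨q, rfl⟩
      exact hh2 p q y a b
  refine hne (eq_zero_of_span hspan
      (fun p => ⁅⁅p, r⁆, y⁆ * ⁅a, b⁆ + ⁅a, b⁆ * ⁅⁅p, r⁆, y⁆) ?_ ?_ ?_ p)
  · intro u v
    simp only [Ring.lie_def, mul_add, add_mul, mul_sub, sub_mul]
    abel
  · intro c u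
    simp only [Ring.lie_def, mul_sub, sub_mul, mul_smul_comm, smul_mul_assoc, smul_add, smul_sub]
  · rintro _ ⟨p, rfl⟩
    exact h1 p r y a b

end AlgebraWithInvolution

namespace IsAlternativeRing

/-- The trace of a quadratic alternative algebra over a commutative ring. -/
structure IsTrace {R B : Type*} [CommRing R] [NonAssocRing B] [Module R B] (t : B →ₗ[R] R) :
    Prop where
  map_one : t 1 = 2
  map_mul_comm : ∀ x y, t (x * y) = t (y * x)
  polar : ∀ x y, x * y + y * x = t x • y + t y • x + (t (x * y) - t x * t y) • (1 : B)

namespace IsTrace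

section Commutators

variable {R B : Type*} [CommRing R] [NonAssocRing B] [Module R B] {t : B →ₗ[R] R}

theorem map_lie (h : IsTrace t) (x y : B) : t ⁅x, y⁆ = 0 := by
  rw [Ring.lie_def, map_sub, h.map_mul_comm, sub_self]

theorem lie_mul_lie_add (h : IsTrace t) (x y a b : B) :
    ⁅x, y⁆ * ⁅a, b⁆ + ⁅a, b⁆ * ⁅x, y⁆ = t (⁅x, y⁆ * ⁅a, b⁆) • (1 : B) := by
  rw [h.polar, h.map_lie, h.map_lie]
  simp

theorem lie_mul_add_lie [SMulCommClass R B B] [IsScalarTower R B B] (h : IsTrace t)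
    (x p q y : B) : ⁅x * ⁅p, q⁆ + ⁅p, q⁆ * x, y⁆ = t x • ⁅⁅p, q⁆, y⁆ := by
  rw [h.polar, h.map_lie]
  generalize ⁅p, q⁆ = c
  rw [Ring.lie_def, Ring.lie_def]
  simp only [add_mul, mul_add, smul_mul_assoc, mul_smul_comm, one_mul, mul_one, zero_smul,
    zero_mul, mul_zero]
  module

end Commutators

section Conj

variable {R B : Type*} [CommRing R] [Invertible (2 : R)] [NonAssocRing B] [Module R B]
  (t : B →ₗ[R] R)

/-- The conjugation of a quadratic algebra. -/
def conj : B →ₗ[R] B := t.smulRight 1 - LinearMap.id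

/-- The norm of a quadratic algebra. -/
def nrm (x : B) : R := ⅟2 * (t x * t x - t (x * x))

omit [Invertible (2 : R)] in
theorem conj_apply (x : B) : conj t x = t x • 1 - x := rfl

variable {t}

omit [Invertible (2 : R)] in
theorem conj_of_trace_eq_zero {x : B} (hx : t x = 0) : conj t x = -x := by
  rw [conj_apply, hx, zero_smul, zero_sub]

variable (h : IsTrace t)
include h

omit [Invertible (2 : R)] in
theorem conj_one : conj t 1 = 1 := by
  rw [conj_apply, h.map_one]
  module

omit [Invertible (2 : R)] in
theorem trace_conj (x : B) : t (conj t x) = t x := by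
  rw [conj_apply, map_sub, map_smul, h.map_one, smul_eq_mul]
  ring

omit [Invertible (2 : R)] in
theorem conj_conj (x : B) : conj t (conj t x) = x := by
  rw [conj_apply, h.trace_conj, conj_apply, sub_sub_cancel]

omit [Invertible (2 : R)] in
theorem conj_smul_one (r : R) : conj t (r • 1) = r • 1 := by
  rw [map_smul, h.conj_one]

theorem smul_one_inj {r s : R} (hrs : r • (1 : B) = s • 1) : r = s := by
  have := congrArg t hrs
  rw [map_smul, map_smul, h.map_one, smul_eq_mul, smul_eq_mul] at this
  simpa using congrArg (· * ⅟(2 : R)) this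

theorem conj_eq_self_iff {x : B} : conj t x = x ↔ x = (⅟2 * t x) • (1 : B) := by
  constructor
  · intro hx
    rw [conj_apply, sub_eq_iff_eq_add] at hx
    rw [mul_smul, hx, ← two_smul R x, smul_smul, invOf_mul_self, one_smul]
  · intro hx
    rw [hx, h.conj_smul_one]

theorem trace_eq_zero_of_conj {x : B} (hx : conj t x = -x) : t x = 0 := by
  apply h.smul_one_inj
  rw [conj_apply, sub_eq_neg_self] at hx
  rw [hx, zero_smul]

variable [SMulCommClass R B B] [IsScalarTower R B B]

omit [Invertible (2 : R)] in
theorem conj_mul (x y : B) : conj t (x * y) = conj t y * conj t x := by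
  have := h.polar x y
  simp only [conj_apply, mul_sub, sub_mul, smul_mul_assoc, mul_smul_comm, one_mul, mul_one]
  linear_combination (norm := module) -this

omit [Invertible (2 : R)] in
theorem trace_mul_conj_comm (x y : B) : t (x * conj t y) = t (y * conj t x) := by
  rw [← h.trace_conj, h.conj_mul, h.conj_conj]

omit [Invertible (2 : R)] in
theorem mul_conj_add (x y : B) :
    x * conj t y + y * conj t x = t (x * conj t y) • (1 : B) := by
  have : y * conj t x = conj t (x * conj t y) := by rw [h.conj_mul, h.conj_conj]
  rw [this, conj_apply t (x * _)]
  abel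

theorem mul_conj_self (x : B) : x * conj t x = nrm t x • (1 : B) := by
  have h1 := congrArg (⅟(2 : R) • ·) (h.mul_conj_add x x)
  simp only [← two_smul R (x * conj t x), smul_smul, invOf_mul_self, one_smul] at h1
  rw [h1, nrm, conj_apply, mul_sub, mul_smul_comm, mul_one, map_sub, map_smul, smul_eq_mul]

theorem conj_mul_self (x : B) : conj t x * x = nrm t x • (1 : B) := by
  rw [← h.mul_conj_self, conj_apply, sub_mul, mul_sub, smul_mul_assoc, mul_smul_comm, one_mul,
    mul_one]

theorem nrm_conj (x : B) : nrm t (conj t x) = nrm t x :=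
  h.smul_one_inj (by rw [← h.mul_conj_self, h.conj_conj, h.conj_mul_self])

theorem nrm_smul (r : R) (x : B) : nrm t (r • x) = r * r * nrm t x :=
  h.smul_one_inj (by
    rw [← h.mul_conj_self, map_smul, smul_mul_assoc, mul_smul_comm, h.mul_conj_self]
    module)

theorem nrm_add (x y : B) : nrm t (x + y) = nrm t x + nrm t y + t (x * conj t y) :=
  h.smul_one_inj (by
    rw [← h.mul_conj_self, map_add, add_mul, mul_add, mul_add, h.mul_conj_self, h.mul_conj_self,
      add_smul, add_smul, ← h.mul_conj_add]
    abel)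

theorem mul_self (x : B) : x * x = t x • x - nrm t x • (1 : B) := by
  rw [← h.mul_conj_self, conj_apply, mul_sub, mul_smul_comm, mul_one, sub_sub_cancel]

omit h [Invertible (2 : R)] [SMulCommClass R B B] in
theorem assoc_conj_left (x y z : B) :
    associator (conj t x) y z = -associator x y z := by
  rw [conj_apply, sub_eq_add_neg, assoc_add_left, assoc_smul_left, assoc_one_left, smul_zero,
    zero_add]
  simp only [associator_apply, neg_mul, neg_sub']

variable [IsAlternativeRing B]

omit h [Invertible (2 : R)] [SMulCommClass R B B] in
theorem assoc_conj_mid (x y z : B) :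
    associator x (conj t y) z = -associator x y z := by
  rw [assoc_swap_left, assoc_conj_left, assoc_swap_left x y z, neg_neg]

omit h [Invertible (2 : R)] [SMulCommClass R B B] in
theorem assoc_conj_right (x y z : B) :
    associator x y (conj t z) = -associator x y z := by
  rw [assoc_swap_right, assoc_conj_mid, assoc_swap_right x y z, neg_neg]

theorem mul_conj_mul (x y : B) : x * (conj t x * y) = nrm t x • y := by
  have := assoc_conj_mid (t := t) x x y
  rw [assoc_self_left, neg_zero, associator_apply, sub_eq_zero] at this
  rw [← this, h.mul_conj_self, smul_mul_assoc, one_mul]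

theorem conj_mul_mul (x y : B) : conj t x * (x * y) = nrm t x • y := by
  have := h.mul_conj_mul (conj t x) y
  rwa [h.conj_conj, h.nrm_conj] at this

theorem mul_mul_conj (x y : B) : (y * x) * conj t x = nrm t x • y := by
  have := assoc_conj_right (t := t) y x x
  rw [assoc_self_right, neg_zero, associator_apply, sub_eq_zero] at this
  rw [this, h.mul_conj_self, mul_smul_comm, mul_one]

theorem mul_conj_mul' (x y : B) : (y * conj t x) * x = nrm t x • y := by
  have := h.mul_mul_conj (conj t x) y
  rwa [h.conj_conj, h.nrm_conj] at this

theorem nrm_mul (x y : B) : nrm t (x * y) = nrm t x * nrm t y :=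
  h.smul_one_inj (by
    have h1 : associator (x * y) (conj t y) (conj t x) = 0 := by
      rw [assoc_conj_mid, assoc_conj_right, assoc_cyclic, assoc_mul_left, assoc_self_right,
        zero_mul]
      simp
    rw [associator_apply, sub_eq_zero] at h1
    rw [← h.mul_conj_self, h.conj_mul, ← h1, h.mul_mul_conj, smul_mul_assoc, h.mul_conj_self,
      smul_smul, mul_comm])

omit [Invertible (2 : R)] in
theorem conj_associator (x y z : B) : conj t (associator x y z) = -associator x y z := by
  rw [associator_apply, map_sub, h.conj_mul, h.conj_mul, h.conj_mul, h.conj_mul, ← neg_sub,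
    ← associator_apply, ← associator_apply, assoc_conj_left, assoc_conj_mid, assoc_conj_right,
    assoc_reverse x y z]
  simp

theorem trace_associator (x y z : B) : t (associator x y z) = 0 :=
  h.trace_eq_zero_of_conj (h.conj_associator x y z)

theorem trace_mul_assoc (x y z : B) : t ((x * y) * z) = t (x * (y * z)) := by
  rw [← sub_eq_zero, ← map_sub, ← associator_apply, h.trace_associator]

theorem isInv {x : B} {r : R} (hr : r * nrm t x = 1) : IsInv x (r • conj t x) := by
  constructor <;> intro y
  · rw [smul_mul_assoc, mul_smul_comm, h.mul_conj_mul, smul_smul, hr, one_smul]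
  · rw [smul_mul_assoc, h.conj_mul_mul, smul_smul, hr, one_smul]
  · rw [mul_smul_comm, smul_mul_assoc, h.mul_conj_mul', smul_smul, hr, one_smul]
  · rw [mul_smul_comm, h.mul_mul_conj, smul_smul, hr, one_smul]

/-- The operator `U_x`. -/
theorem mul_mul_self (x y : B) : (x * y) * x = t (x * y) • x - nrm t x • conj t y := by
  have h1 := h.mul_conj_add x (conj t y)
  rw [h.conj_conj] at h1
  have h2 := congrArg (· * x) h1
  simp only [add_mul, h.mul_conj_mul', smul_mul_assoc, one_mul] at h2
  rw [← h2, add_sub_cancel_right]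

end Conj

end IsTrace

end IsAlternativeRing

namespace IsAlternativeRing

section Center

variable {A : Type*} [NonAssocRing A]

instance : CommRing (Subring.center A) :=
  { (inferInstance : NonAssocRing (Subring.center A)) with
    mul_assoc := fun a b c => Subtype.ext (a.2.left_assoc b c).symm
    mul_comm := fun a b => Subtype.ext (a.2.comm b) }

instance : Module (Subring.center A) A where
  smul c x := c * x
  one_smul := one_mul
  mul_smul c d x := (c.2.left_assoc d x).symm
  smul_zero _ := mul_zero _
  smul_add _ := mul_add _
  add_smul _ _ := add_mul _ _
  zero_smul x := zero_mul x

theorem center_smul_def (c : Subring.center A) (x : A) : c • x = c * x := rfl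

instance : IsScalarTower (Subring.center A) A A :=
  ⟨fun c x y => (c.2.left_assoc x y).symm⟩

instance : SMulCommClass (Subring.center A) A A :=
  ⟨fun c x y => by
    exact IsMulCentral.left_comm c.2 x y⟩

end Center

end IsAlternativeRing

namespace AlgebraWithInvolution

open IsAlternativeRing

universe v

theorem invol_mem_center {R : Type v} [CommRing R] {A : AlgebraWithInvolution R} {c : A}
    (hc : c ∈ Set.center A.carrier) : A.invol c ∈ Set.center A.carrier := by
  refine ⟨fun x => ?_, fun x y => ?_, fun x y => ?_⟩
  · have := congrArg A.invol (hc.comm (A.invol x)).eq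
    rw [A.invol_mul, A.invol_mul, A.invol_invol] at this
    exact this.symm
  · have := congrArg A.invol (hc.right_assoc (A.invol y) (A.invol x))
    simp only [A.invol_mul, A.invol_invol] at this
    exact this
  · have := congrArg A.invol (hc.left_assoc (A.invol y) (A.invol x))
    simp only [A.invol_mul, A.invol_invol] at this
    exact this

/-- A nonassociative alternative central simple algebra with involution has a trace with values
in its center, which is compatible with the involution. -/
theorem exists_isTrace {k : Type v} [Field k] (hk2 : (2 : k) ≠ 0) (A : AlgebraWithInvolution k)
    [Module.Finite k A.carrier] [IsAlternativeRing A.carrier]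
    (hcentral : ∀ a ∈ Set.center A.carrier, A.invol a = a → ∃ c : k, a = c • (1 : A.carrier))
    (hsimple : ∀ I : Submodule k A.carrier,
      (∀ a ∈ I, ∀ x : A.carrier, x * a ∈ I ∧ a * x ∈ I) → (∀ a ∈ I, A.invol a ∈ I) →
        I = ⊥ ∨ I = ⊤)
    (hassoc : ¬ ∀ x y z : A, associator x y z = 0) :
    (∀ c ∈ Set.center A.carrier, c * c = 0 → c = 0) ∧
      ∃ t : A.carrier →ₗ[Subring.center A.carrier] Subring.center A.carrier,
        IsTrace t ∧ ∀ x, (t (A.invol x) : A.carrier) = A.invol (t x) := by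
  obtain ⟨F, _, _, B, _, _, _, _, _, π, t, hπsmul, hπ1, hπmul, hker, ht1, htc, htp, hcen, p, q,
    y, a, b, hne⟩ := exists_embedding hk2 A hsimple hassoc
  have ht : IsTrace t := ⟨ht1, htc, htp⟩
  have hone : ∀ r : F, r • (1 : B) = 0 → r = 0 := fun r hr => by
    by_contra hr0
    rw [smul_eq_zero_iff_right hr0] at hr
    apply hne
    rw [← mul_one (π _), hr, mul_zero]
  have hext : ∀ x y : A, π x = π y → π (A.invol x) = π (A.invol y) → x = y := fun x y h h' => by
    rw [← sub_eq_zero]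
    apply hker
    · rw [map_sub, h, sub_self]
    · rw [map_sub, map_sub, h', sub_self]
  have hmemcen : ∀ c : A, (∃ r : F, π c = r • (1 : B)) →
      (∃ r : F, π (A.invol c) = r • (1 : B)) → c ∈ Set.center A.carrier := by
    rintro c ⟨r, hr⟩ ⟨s, hs⟩
    refine ⟨fun x => hext _ _ ?_ ?_, fun x y => hext _ _ ?_ ?_, fun x y => hext _ _ ?_ ?_⟩ <;>
    simp only [A.invol_mul, hπmul, hr, hs, smul_mul_assoc, mul_smul_comm, one_mul, mul_one]
  let P : A → Prop := fun c => c ∈ Set.center A.carrier ∧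
    ∀ x, ∃ s, π s = t (π x) • π c ∧ π (A.invol s) = t (π (A.invol x)) • π (A.invol c)
  have hadd : ∀ c d, P c → P d → P (c + d) := by
    rintro c d ⟨hc, hc'⟩ ⟨hd, hd'⟩
    refine ⟨Set.add_mem_center hc hd, fun x => ?_⟩
    obtain ⟨s, hs, hs'⟩ := hc' x
    obtain ⟨s', hs₂, hs₂'⟩ := hd' x
    refine ⟨s + s', ?_, ?_⟩
    · rw [map_add, map_add, hs, hs₂, smul_add]
    · rw [map_add, map_add, map_add, map_add, hs', hs₂', smul_add]
  have hmul : ∀ c d, P c → d ∈ Set.center A.carrier → P (c * d) := by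
    rintro c d ⟨hc, hc'⟩ hd
    refine ⟨Set.mul_mem_center hc hd, fun x => ?_⟩
    obtain ⟨s, hs, hs'⟩ := hc' x
    refine ⟨s * d, ?_, ?_⟩
    · rw [hπmul, hπmul, hs, smul_mul_assoc]
    · rw [A.invol_mul, A.invol_mul, hπmul, hπmul, hs', mul_smul_comm]
  have hinv : ∀ c, P c → P (A.invol c) := by
    rintro c ⟨hc, hc'⟩
    refine ⟨invol_mem_center hc, fun x => ?_⟩
    obtain ⟨s, hs, hs'⟩ := hc' (A.invol x)
    refine ⟨A.invol s, ?_, ?_⟩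
    · rw [hs', A.invol_invol]
    · rw [A.invol_invol, A.invol_invol, hs]
  have hlie : ∀ x y : A, π ⁅x, y⁆ = ⁅π x, π y⁆ := fun x y => by
    rw [Ring.lie_def, Ring.lie_def, map_sub, hπmul, hπmul]
  have hlie' : ∀ x y : A, A.invol ⁅x, y⁆ = -⁅A.invol x, A.invol y⁆ := fun x y => by
    rw [Ring.lie_def, Ring.lie_def, map_sub, A.invol_mul, A.invol_mul, neg_sub]
  have hγ : P (⁅⁅p, q⁆, y⁆ * ⁅a, b⁆ + ⁅a, b⁆ * ⁅⁅p, q⁆, y⁆) := by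
    have key : ∀ p q y a b : A, ∃ r : F,
        π (⁅⁅p, q⁆, y⁆ * ⁅a, b⁆ + ⁅a, b⁆ * ⁅⁅p, q⁆, y⁆) = r • (1 : B) := fun p q y a b => by
      rw [map_add, hπmul, hπmul, hlie, hlie a b, ht.lie_mul_lie_add]
      exact ⟨_, rfl⟩
    have hconj : A.invol (⁅⁅p, q⁆, y⁆ * ⁅a, b⁆ + ⁅a, b⁆ * ⁅⁅p, q⁆, y⁆) =
        -(⁅⁅A.invol p, A.invol q⁆, A.invol y⁆ * ⁅A.invol a, A.invol b⁆ +
          ⁅A.invol a, A.invol b⁆ * ⁅⁅A.invol p, A.invol q⁆, A.invol y⁆) := by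
      rw [map_add, A.invol_mul, A.invol_mul, hlie' a b, hlie' _ y, hlie' p q]
      generalize ⁅A.invol p, A.invol q⁆ = c
      generalize ⁅A.invol a, A.invol b⁆ = d
      simp only [Ring.lie_def, mul_sub, sub_mul, mul_neg, neg_mul]
      abel
    refine ⟨hmemcen _ (key p q y a b) ?_, fun x => ?_⟩
    · obtain ⟨r, hr⟩ := key (A.invol p) (A.invol q) (A.invol y) (A.invol a) (A.invol b)
      refine ⟨-r, ?_⟩
      rw [hconj, map_neg, hr, neg_smul]
    · refine ⟨⁅x * ⁅p, q⁆ + ⁅p, q⁆ * x, y⁆ * ⁅a, b⁆ +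
        ⁅a, b⁆ * ⁅x * ⁅p, q⁆ + ⁅p, q⁆ * x, y⁆, ?_, ?_⟩
      · rw [map_add, map_add, hπmul, hπmul, hπmul, hπmul, hlie, hlie a b, hlie _ y, map_add,
          hπmul, hπmul, hlie, ht.lie_mul_add_lie, smul_mul_assoc, mul_smul_comm, smul_add]
      · rw [hconj, map_add A.invol, A.invol_mul, A.invol_mul, hlie' a b, hlie' _ y, map_add A.invol,
          A.invol_mul, A.invol_mul, hlie' p q]
        simp only [map_add, map_neg, hπmul, hlie]
        have := ht.lie_mul_add_lie (π (A.invol x)) (π (A.invol p)) (π (A.invol q))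
          (π (A.invol y))
        have e : ∀ c d z : B, ⁅-c * d + d * -c, z⁆ = -⁅d * c + c * d, z⁆ := fun c d z => by
          simp only [Ring.lie_def, mul_add, add_mul, neg_mul, mul_neg]
          abel
        rw [e, this]
        simp only [neg_neg, mul_neg, neg_mul, smul_mul_assoc, mul_smul_comm, smul_add, smul_neg]
        abel
  have hP1 : P 1 := by
    generalize ⁅⁅p, q⁆, y⁆ * ⁅a, b⁆ + ⁅a, b⁆ * ⁅⁅p, q⁆, y⁆ = c at hne hγ
    have hsym : ∃ d, P d ∧ A.invol d = d ∧ d ≠ 0 := by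
      by_cases h0 : c + A.invol c = 0
      · have hc : A.invol c = -c := (neg_eq_of_add_eq_zero_right h0).symm
        refine ⟨c * c, hmul c c hγ hγ.1, by rw [A.invol_mul, hc, neg_mul_neg], fun h => ?_⟩
        obtain ⟨r, hr⟩ := hcen c hγ.1
        have h2 := congrArg π h
        rw [hπmul, hr, map_zero, smul_mul_assoc, one_mul, smul_smul] at h2
        rw [mul_self_eq_zero.1 (hone _ h2), zero_smul] at hr
        exact hne hr
      · exact ⟨_, hadd _ _ hγ (hinv _ hγ), by rw [map_add, A.invol_invol, add_comm], h0⟩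
    obtain ⟨d, hd, hd', hd0⟩ := hsym
    obtain ⟨r, rfl⟩ := hcentral d hd.1 hd'
    have hr : r ≠ 0 := by
      rintro rfl
      exact hd0 (zero_smul _ _)
    have : (1 : A.carrier) = (r • 1) * (r⁻¹ • 1) := by
      rw [smul_mul_assoc, one_mul, smul_smul, mul_inv_cancel₀ hr, one_smul]
    rw [this]
    refine hmul _ _ hd (hmemcen _ ⟨algebraMap k F r⁻¹, ?_⟩ ⟨algebraMap k F r⁻¹, ?_⟩)
    · rw [hπsmul, hπ1]
    · rw [map_smul, A.invol_one, hπsmul, hπ1]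
  have hT : ∀ x, ∃ s, π s = t (π x) • (1 : B) ∧ π (A.invol s) = t (π (A.invol x)) • (1 : B) := by
    simpa only [A.invol_one, hπ1] using hP1.2
  choose T hT hT' using hT
  have hTcen : ∀ x, T x ∈ Set.center A.carrier := fun x =>
    hmemcen _ ⟨_, hT x⟩ ⟨_, hT' x⟩
  have hnil : ∀ c ∈ Set.center A.carrier, c * c = 0 → c = 0 := fun c hc h => by
    obtain ⟨r, hr⟩ := hcen c hc
    obtain ⟨s, hs⟩ := hcen _ (invol_mem_center hc)
    have h1 := congrArg π h
    have h2 := congrArg (fun x => π (A.invol x)) h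
    simp only [A.invol_mul, hπmul, hr, hs, map_zero, smul_mul_assoc, one_mul, smul_smul] at h1 h2
    rw [mul_self_eq_zero.1 (hone _ h1), zero_smul] at hr
    rw [mul_self_eq_zero.1 (hone _ h2), zero_smul] at hs
    exact hker c hr hs
  refine ⟨hnil,
    { toFun := fun x => ⟨T x, hTcen x⟩
      map_add' := fun x y => Subtype.ext (hext _ _ ?_ ?_)
      map_smul' := fun c x => Subtype.ext (hext _ _ ?_ ?_) },
    ⟨Subtype.ext (hext _ _ ?_ ?_), fun x y => Subtype.ext (hext _ _ ?_ ?_),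
      fun x y => hext _ _ ?_ ?_⟩, fun x => hext _ _ ?_ ?_⟩
  · change π (T (x + y)) = π (T x + T y)
    simp only [map_add, hT, add_smul]
  · change π (A.invol (T (x + y))) = π (A.invol (T x + T y))
    simp only [map_add, hT', add_smul]
  · obtain ⟨r, hr⟩ := hcen c c.2
    change π (T (c * x)) = π (c * T x)
    simp only [hπmul, hT, hr, smul_mul_assoc, one_mul, map_smul, smul_smul, smul_eq_mul]
  · obtain ⟨r, hr⟩ := hcen _ (invol_mem_center c.2)
    change π (A.invol (T (c * x))) = π (A.invol (c * T x))
    simp only [hπmul, A.invol_mul, hT', hr, mul_smul_comm, mul_one, map_smul, smul_smul,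
      smul_eq_mul]
  · change π (T 1) = π (2 : A.carrier)
    rw [hT, hπ1, ht1, ← one_add_one_eq_two, ← one_add_one_eq_two, map_add, hπ1, add_smul, one_smul]
  · change π (A.invol (T 1)) = π (A.invol (2 : A.carrier))
    rw [hT', A.invol_one, hπ1, ht1, ← one_add_one_eq_two, ← one_add_one_eq_two, map_add, map_add,
      A.invol_one, hπ1, add_smul, one_smul]
  · change π (T (x * y)) = π (T (y * x))
    rw [hT, hT, hπmul, hπmul, htc]
  · change π (A.invol (T (x * y))) = π (A.invol (T (y * x)))
    rw [hT', hT', A.invol_mul, A.invol_mul, hπmul, hπmul, htc]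
  · change π (x * y + y * x) = π (T x * y + T y * x + (T (x * y) - T x * T y) * 1)
    rw [mul_one]
    simp only [map_add, map_sub, hπmul, hT, smul_mul_assoc, one_mul, htp (π x) (π y)]
    module
  · change π (A.invol (x * y + y * x)) =
      π (A.invol (T x * y + T y * x + (T (x * y) - T x * T y) * 1))
    rw [mul_one]
    simp only [map_add, map_sub, hπmul, A.invol_mul, hT', mul_smul_comm, mul_one,
      htp (π (A.invol y)) (π (A.invol x))]
    module
  · change π (T (A.invol x)) = π (A.invol (T x))
    rw [hT, hT']
  · change π (A.invol (T (A.invol x))) = π (A.invol (A.invol (T x)))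
    rw [hT', A.invol_invol, A.invol_invol, hT]

end AlgebraWithInvolution

namespace IsAlternativeRing

/-- A linear automorphism of order at most two of a nonassociative algebra. -/
structure IsReflection {k B : Type*} [Field k] [NonAssocRing B] [Module k B] (σ : B →ₗ[k] B) :
    Prop where
  map_one : σ 1 = 1
  map_mul : ∀ x y, σ (x * y) = σ x * σ y
  map_map : ∀ x, σ (σ x) = x

namespace IsReflection

variable {k B : Type*} [Field k] [NonAssocRing B] [Module k B] {σ : B →ₗ[k] B}

/-- The fixed points of a reflection. -/
def fixed (h : IsReflection σ) : Subring B where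
  carrier := {x | σ x = x}
  mul_mem' := fun {x y} hx hy => by
    change σ (x * y) = x * y
    rw [h.map_mul, show σ x = x from hx, show σ y = y from hy]
  one_mem' := h.map_one
  add_mem' := fun {x y} hx hy => by
    change σ (x + y) = x + y
    rw [map_add, show σ x = x from hx, show σ y = y from hy]
  zero_mem' := map_zero σ
  neg_mem' := fun {x} hx => by
    change σ (-x) = -x
    rw [map_neg, show σ x = x from hx]

variable (h : IsReflection σ)

theorem apply_coe (x : h.fixed) : σ x = x := x.2

instance : SMul k h.fixed := ⟨fun c x => ⟨c • (x : B), by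
  change σ (c • (x : B)) = c • (x : B)
  rw [map_smul, h.apply_coe]⟩⟩

instance : Module k h.fixed :=
  Function.Injective.module k ⟨⟨fun x : h.fixed => (x : B), rfl⟩, fun _ _ => rfl⟩
    Subtype.val_injective fun _ _ => rfl

instance [SMulCommClass k B B] : SMulCommClass k h.fixed h.fixed :=
  ⟨fun c x y => Subtype.ext (mul_smul_comm c (x : B) (y : B)).symm⟩

instance [IsScalarTower k B B] : IsScalarTower k h.fixed h.fixed :=
  ⟨fun c x y => Subtype.ext (smul_mul_assoc c (x : B) (y : B))⟩

/-- The inclusion of the fixed points, as a linear map. -/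
def subtype : h.fixed →ₗ[k] B where
  toFun x := x
  map_add' _ _ := rfl
  map_smul' _ _ := rfl

theorem subtype_apply (x : h.fixed) : h.subtype x = x := rfl

theorem subtype_injective : Function.Injective h.subtype := Subtype.val_injective

instance [Module.Finite k B] : Module.Finite k h.fixed :=
  Module.Finite.of_injective h.subtype h.subtype_injective

instance [IsAlternativeRing B] : IsAlternativeRing h.fixed :=
  ⟨fun _ _ => Subtype.ext (left_alt _ _),
    fun _ _ => Subtype.ext (right_alt _ _)⟩

theorem add_mem_fixed (x : B) : x + σ x ∈ h.fixed := by
  change σ (x + σ x) = x + σ x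
  rw [map_add, h.map_map, add_comm]

theorem isTrace_comp {t : B →ₗ[k] k} (ht : IsTrace t) : IsTrace (t ∘ₗ h.subtype) :=
  ⟨ht.map_one, fun x y => ht.map_mul_comm x y, fun x y => Subtype.ext (ht.polar x y)⟩

end IsReflection

end IsAlternativeRing

namespace IsAlternativeRing

namespace IsTrace

variable {k B : Type*} [Field k] [Invertible (2 : k)] [NonAssocRing B] [Module k B]
  [SMulCommClass k B B] [IsScalarTower k B B] [IsAlternativeRing B] {t : B →ₗ[k] k}

omit [SMulCommClass k B B] [IsScalarTower k B B] [IsAlternativeRing B] in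
theorem trace_sub_half (h : IsTrace t) (x : B) : t (x - (⅟2 * t x) • (1 : B)) = 0 := by
  rw [map_sub, map_smul, h.map_one, smul_eq_mul, mul_right_comm, invOf_mul_self, one_mul,
    sub_self]

omit [IsAlternativeRing B] in
theorem mul_self_of_trace_eq_zero (h : IsTrace t) {s : B} (hs : t s = 0) :
    s * s = (-nrm t s) • (1 : B) := by
  rw [h.mul_self, hs]
  module

omit [IsScalarTower k B B] [IsAlternativeRing B] in
/-- Orthogonality to all elements can be tested on elements of trace zero. -/
theorem eq_zero_of_orthogonal (h : IsTrace t) (hnd : ∀ x, (∀ y, t (x * y) = 0) → x = 0) {x : B}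
    (hx : t x = 0) (hxy : ∀ y, t y = 0 → t (x * y) = 0) : x = 0 := by
  refine hnd x fun y => ?_
  have := hxy _ (h.trace_sub_half y)
  rwa [mul_sub, mul_smul_comm, mul_one, map_sub, map_smul, hx, smul_zero, sub_zero] at this

theorem exists_trace_eq_zero (h : IsTrace t) (hnd : ∀ x, (∀ y, t (x * y) = 0) → x = 0)
    (hassoc : ¬ ∀ x y z : B, associator x y z = 0) (g : B) :
    ∃ s, t s = 0 ∧ t (s * g) = 0 ∧ nrm t s ≠ 0 := by
  by_contra! hW
  apply hassoc
  have hpolar : ∀ x y, t x = 0 → t (x * g) = 0 → t y = 0 → t (y * g) = 0 → t (x * y) = 0 :=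
    fun x y hx hxg hy hyg => by
    have h1 := hW (x + y) (by rw [map_add, hx, hy, add_zero])
      (by rw [add_mul, map_add, hxg, hyg, add_zero])
    rw [h.nrm_add, hW x hx hxg, hW y hy hyg, conj_of_trace_eq_zero hy, mul_neg, map_neg] at h1
    simpa using h1
  obtain ⟨e, hdec⟩ : ∃ e, ∀ x, ∃ y : B, ∃ a b : k, t y = 0 ∧ t (y * g) = 0 ∧
      x = y + a • 1 + b • e := by
    by_cases he : ∀ x, t x = 0 → t (x * g) = 0
    · exact ⟨0, fun x => ⟨_, ⅟2 * t x, 0, h.trace_sub_half x, he _ (h.trace_sub_half x), by simp⟩⟩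
    · push Not at he
      obtain ⟨e, he, heg⟩ := he
      refine ⟨e, fun x => ?_⟩
      have h1 := h.trace_sub_half x
      set y := x - (⅟2 * t x) • (1 : B) with hy
      refine ⟨y - (t (y * g) / t (e * g)) • e, ⅟2 * t x, t (y * g) / t (e * g), ?_, ?_, ?_⟩
      · rw [map_sub, map_smul, h1, he, smul_zero, sub_zero]
      · rw [sub_mul, smul_mul_assoc, map_sub, map_smul, smul_eq_mul, div_mul_cancel₀ _ heg,
          sub_self]
      · rw [hy]
        abel
  have hzero : ∀ x, t x = 0 → t (x * g) = 0 → t (x * e) = 0 → x = 0 := fun x hx hxg hxe => by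
    refine hnd x fun y => ?_
    obtain ⟨z, a, b, hz, hzg, rfl⟩ := hdec y
    simp only [mul_add, mul_smul_comm, mul_one, map_add, map_smul, hx, hxe, smul_zero, add_zero]
    exact hpolar x z hx hxg hz hzg
  have hass : ∀ x y, t x = 0 → t (x * g) = 0 → t y = 0 → t (y * g) = 0 →
      ∀ z, associator x y z = 0 := fun x y hx hxg hy hyg z => by
    by_cases h0 : t (x * e) = 0
    · rw [hzero x hx hxg h0]
      simp [associator_apply]
    · have h1 : t (x * e) • y - t (y * e) • x = 0 := by
        apply hzero
        · rw [map_sub, map_smul, map_smul, hx, hy, smul_zero, smul_zero, sub_zero]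
        · rw [sub_mul, smul_mul_assoc, smul_mul_assoc, map_sub, map_smul, map_smul, hxg, hyg,
            smul_zero, smul_zero, sub_zero]
        · rw [sub_mul, smul_mul_assoc, smul_mul_assoc, map_sub, map_smul, map_smul, smul_eq_mul,
            smul_eq_mul, mul_comm, sub_self]
      have h2 : t (x * e) • associator x y z = 0 := by
        rw [← assoc_smul_mid, sub_eq_zero.1 h1, assoc_smul_mid, assoc_self_left, smul_zero]
      exact (smul_eq_zero.1 h2).resolve_left h0
  intro x y z
  obtain ⟨x, a, b, hx, hxg, rfl⟩ := hdec x
  obtain ⟨y, c, d, hy, hyg, rfl⟩ := hdec y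
  obtain ⟨z, u, v, hz, hzg, rfl⟩ := hdec z
  simp only [assoc_add_left, assoc_add_mid, assoc_add_right, assoc_smul_left, assoc_smul_mid,
    assoc_smul_right, assoc_one_left, assoc_one_mid, assoc_one_right, assoc_self_left,
    assoc_self_right, assoc_flex, hass x y hx hxg hy hyg, assoc_swap_right x z e,
    hass x z hx hxg hz hzg, ← assoc_cyclic e y z, hass y z hy hyg hz hzg, smul_zero, add_zero,
    neg_zero]

/-- In a nonassociative algebra, elements of nonzero norm are products of two elements of nonzero
norm and trace zero. -/
theorem exists_mul_eq (h : IsTrace t) (hnd : ∀ x, (∀ y, t (x * y) = 0) → x = 0)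
    (hassoc : ¬ ∀ x y z : B, associator x y z = 0) {g : B} (hg : nrm t g ≠ 0) :
    ∃ r s, t r = 0 ∧ nrm t r ≠ 0 ∧ t s = 0 ∧ nrm t s ≠ 0 ∧ r * s = g := by
  obtain ⟨s, hs, hsg, hs0⟩ := h.exists_trace_eq_zero hnd hassoc g
  refine ⟨s, (-(nrm t s)⁻¹) • (s * g), hs, hs0, ?_, ?_, ?_⟩
  · rw [map_smul, hsg, smul_zero]
  · rw [h.nrm_smul, h.nrm_mul]
    simp [hs0, hg]
  · have h1 := h.mul_conj_mul s g
    rw [conj_of_trace_eq_zero hs, neg_mul, mul_neg] at h1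
    rw [mul_smul_comm, neg_smul, ← smul_neg, h1, smul_smul, inv_mul_cancel₀ hs0, one_smul]

/-- A nondegenerate noncommutative quadratic algebra contains a noncentral element of
nonzero norm and trace zero. -/
theorem exists_not_commute (h : IsTrace t) (hnd : ∀ x, (∀ y, t (x * y) = 0) → x = 0)
    (hcomm : ¬ ∀ x y : B, x * y = y * x) :
    ∃ p, t p = 0 ∧ nrm t p ≠ 0 ∧ ∃ y, p * y ≠ y * p := by
  push Not at hcomm
  obtain ⟨x, y, hxy⟩ := hcomm
  have h1 := h.trace_sub_half x
  have h2 : (x - (⅟2 * t x) • (1 : B)) * y ≠ y * (x - (⅟2 * t x) • (1 : B)) := by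
    rw [sub_mul, mul_sub, smul_mul_assoc, mul_smul_comm, one_mul, mul_one]
    exact fun e => hxy (sub_left_injective e)
  generalize x - (⅟2 * t x) • (1 : B) = x at h1 h2
  by_cases h0 : nrm t x ≠ 0
  · exact ⟨x, h1, h0, y, h2⟩
  push Not at h0
  have key : ∀ w, t w = 0 → t (x * w) ≠ 0 → nrm t w ≠ 0 → ∃ y, w * y ≠ y * w := by
    intro w hw hxw hw0
    by_contra! hc
    have h3 := h.mul_conj_add w x
    rw [conj_of_trace_eq_zero h1, conj_of_trace_eq_zero hw, mul_neg, mul_neg, map_neg, ← hc x] at h3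
    have h4 := h.mul_conj_mul w x
    rw [conj_of_trace_eq_zero hw, neg_mul, mul_neg] at h4
    have h5 : (2 * nrm t w) • x = -(t (w * x) • w) := by
      have := congrArg (w * ·) h3
      simp only [mul_add, mul_neg, mul_smul_comm, mul_one] at this
      linear_combination (norm := module) this - (2 : k) • h4
    apply h2
    have h6 : (2 * nrm t w) • (x * y - y * x) = 0 := by
      rw [smul_sub, ← smul_mul_assoc, ← mul_smul_comm, h5, neg_mul, mul_neg, smul_mul_assoc,
        mul_smul_comm, hc y, sub_self]
    rw [smul_eq_zero_iff_right (mul_ne_zero (Invertible.ne_zero 2) hw0)] at h6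
    exact sub_eq_zero.1 h6
  have hx0 : x ≠ 0 := by
    rintro rfl
    simp at h2
  obtain ⟨w, hw, hxw⟩ : ∃ w, t w = 0 ∧ t (x * w) ≠ 0 := by
    by_contra! hw
    exact hx0 (h.eq_zero_of_orthogonal hnd h1 hw)
  by_cases hw0 : nrm t w ≠ 0
  · exact ⟨w, hw, hw0, key w hw hxw hw0⟩
  push Not at hw0
  have h3 : t (x + w) = 0 := by rw [map_add, h1, hw, add_zero]
  have h4 : nrm t (x + w) ≠ 0 := by
    rw [h.nrm_add, h0, hw0, conj_of_trace_eq_zero hw, mul_neg, map_neg]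
    simpa using hxw
  refine ⟨_, h3, h4, key _ h3 ?_ h4⟩
  rwa [mul_add, h.mul_self_of_trace_eq_zero h1, h0, neg_zero, zero_smul, zero_add]

end IsTrace

end IsAlternativeRing

namespace IsAlternativeRing

namespace IsTrace

section Doubling

variable {k B : Type*} [Field k] [Invertible (2 : k)] [NonAssocRing B] [Module k B]
  {t : B →ₗ[k] k} {σ : B →ₗ[k] B}

theorem half_add_half (x : B) : (⅟2 : k) • (x + σ x) + (⅟2 : k) • (x - σ x) = x := by
  rw [← smul_add, add_add_sub_cancel, ← two_smul k x, smul_smul, invOf_mul_self, one_smul]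

omit [Invertible (2 : k)] in
theorem apply_sub_apply (hσ : IsReflection σ) (x : B) : σ (x - σ x) = -(x - σ x) := by
  rw [map_sub, hσ.map_map, neg_sub]

theorem trace_eq_zero_of_apply (hσt : ∀ x, t (σ x) = t x) {l : B} (hl : σ l = -l) :
    t l = 0 := by
  have := hσt l
  rw [hl, map_neg, neg_eq_iff_add_eq_zero, ← two_mul] at this
  exact (mul_eq_zero.1 this).resolve_left (Invertible.ne_zero 2)

theorem trace_mul_eq_zero_of_apply (hσ : IsReflection σ) (hσt : ∀ x, t (σ x) = t x) {x l : B}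
    (hx : σ x = x) (hl : σ l = -l) : t (x * l) = 0 :=
  trace_eq_zero_of_apply hσt (by rw [hσ.map_mul, hx, hl, mul_neg])

variable [SMulCommClass k B B]

/-- The trace form is nondegenerate on the fixed points of a reflection. -/
theorem fixed_nondegenerate (hnd : ∀ x, (∀ y, t (x * y) = 0) → x = 0) (hσ : IsReflection σ)
    (hσt : ∀ x, t (σ x) = t x) (x : hσ.fixed)
    (hx : ∀ y : hσ.fixed, (t ∘ₗ hσ.subtype) (x * y) = 0) : x = 0 := by
  refine Subtype.ext (hnd x fun y => ?_)
  have h1 : t (x * (y + σ y)) = 0 := hx ⟨y + σ y, hσ.add_mem_fixed y⟩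
  have h2 := trace_mul_eq_zero_of_apply hσ hσt (hσ.apply_coe x) (apply_sub_apply hσ y)
  rw [← half_add_half (k := k) (σ := σ) y, mul_add, mul_smul_comm, mul_smul_comm, map_add,
    map_smul, map_smul, h1, h2]
  simp

variable [IsScalarTower k B B] (h : IsTrace t)
  (hnd : ∀ x, (∀ y, t (x * y) = 0) → x = 0) (hσ : IsReflection σ) (hσt : ∀ x, t (σ x) = t x)

include h hnd hσ hσt in
theorem exists_apply_eq_neg (hne : ∃ x, σ x ≠ x) : ∃ l, σ l = -l ∧ nrm t l ≠ 0 := by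
  by_contra! hl
  obtain ⟨x, hx⟩ := hne
  apply hx
  symm
  rw [← sub_eq_zero]
  have h1 := apply_sub_apply hσ x
  generalize x - σ x = l at h1
  refine hnd l fun y => ?_
  have h2 : t ((y + σ y) * l) = 0 :=
    trace_mul_eq_zero_of_apply hσ hσt (hσ.add_mem_fixed y) h1
  have h3 := apply_sub_apply hσ y
  have h4 := hl (l + (y - σ y)) (by rw [map_add, h1, h3, neg_add])
  rw [h.nrm_add, hl l h1, hl _ h3, conj_of_trace_eq_zero (trace_eq_zero_of_apply hσt h3), mul_neg,
    map_neg, add_zero, zero_add, neg_eq_zero] at h4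
  rw [← half_add_half (k := k) (σ := σ) y, mul_add, mul_smul_comm, mul_smul_comm, map_add,
    map_smul, map_smul, h4, h.map_mul_comm, h2]
  simp

variable {x y l : B}

include h hσ hσt

theorem mul_conj_eq (hx : σ x = x) (hl : σ l = -l) : l * conj t x = x * l := by
  have h1 := trace_mul_eq_zero_of_apply hσ hσt hx hl
  have h2 := h.mul_conj_add x l
  rw [conj_of_trace_eq_zero (trace_eq_zero_of_apply hσt hl), mul_neg, map_neg, h1, neg_zero,
    zero_smul] at h2
  exact (neg_add_eq_zero.1 h2).symm

omit h hσt [SMulCommClass k B B] [IsScalarTower k B B] [Invertible (2 : k)] in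
theorem apply_conj (hx : σ x = x) : σ (conj t x) = conj t x := by
  rw [conj_apply, map_sub, map_smul, hσ.map_one, hx]

omit h hσt [SMulCommClass k B B] [IsScalarTower k B B] [Invertible (2 : k)] in
theorem apply_mul (hx : σ x = x) (hy : σ y = y) : σ (x * y) = x * y := by
  rw [hσ.map_mul, hx, hy]

omit h hσt [SMulCommClass k B B] [IsScalarTower k B B] [Invertible (2 : k)] in
theorem apply_mul_neg (hx : σ x = x) (hl : σ l = -l) : σ (x * l) = -(x * l) := by
  rw [hσ.map_mul, hx, hl, mul_neg]

variable [IsAlternativeRing B]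

theorem mul_mul_of_apply (hx : σ x = x) (hy : σ y = y) (hl : σ l = -l) :
    x * (y * l) = (y * x) * l := by
  have h1 := h.conj_mul_mul (conj t x + l) (conj t y)
  have h2 := h.conj_mul_mul (conj t x) (conj t y)
  have h3 := h.conj_mul_mul l (conj t y)
  have hx' := apply_conj hσ hx (t := t)
  have hy' := apply_conj hσ hy (t := t)
  have h4 : t (conj t x * conj t l) = 0 := by
    rw [conj_of_trace_eq_zero (trace_eq_zero_of_apply hσt hl), mul_neg, map_neg,
      trace_mul_eq_zero_of_apply hσ hσt hx' hl, neg_zero]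
  rw [h.nrm_add, h4, add_zero, map_add, h.conj_conj, add_mul, add_mul, mul_add, mul_add, add_smul,
    ← h2, ← h3, h.conj_conj, conj_of_trace_eq_zero (trace_eq_zero_of_apply hσt hl),
    mul_conj_eq h hσ hσt hy hl] at h1
  have h5 := mul_conj_eq h hσ hσt (apply_mul hσ hy hx) hl
  rw [h.conj_mul] at h5
  rw [← h5]
  linear_combination (norm := (simp only [neg_mul]; abel)) h1

theorem mul_apply_mul (hx : σ x = x) (hy : σ y = y) (hl : σ l = -l) :
    (x * l) * y = (x * conj t y) * l := by
  have hy' := apply_conj hσ hy (t := t)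
  have h1 := mul_conj_eq h hσ hσt hy' (apply_mul_neg hσ hx hl)
  rw [h.conj_conj] at h1
  rw [h1, mul_mul_of_apply h hσ hσt hy' hx hl]

theorem mul_mul_mul_of_apply (hx : σ x = x) (hy : σ y = y) (hl : σ l = -l) :
    (x * l) * (y * l) = -(nrm t l • (conj t y * x)) := by
  have h1 := mul_conj_eq h hσ hσt (apply_mul hσ (apply_conj hσ hy (t := t)) hx) hl
  have h2 := h.mul_mul_conj l (conj t y * x)
  rw [conj_of_trace_eq_zero (trace_eq_zero_of_apply hσt hl), mul_neg] at h2
  rw [h.conj_mul, h.conj_conj] at h1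
  rw [← mul_conj_eq h hσ hσt hx hl, moufang_mid, h1, ← h2, neg_neg]

/-- The fixed points of a nontrivial reflection are associative. -/
theorem assoc_of_apply (hx : σ x = x) (hy : σ y = y) {z : B} (hz : σ z = z) (hl : σ l = -l)
    (hn : nrm t l ≠ 0) : associator x y z = 0 := by
  have hi : ∀ w, w * l = 0 → w = 0 := fun w hw => by
    have h1 := h.mul_mul_conj l w
    rw [hw, zero_mul] at h1
    exact (smul_eq_zero.1 h1.symm).resolve_left hn
  have h1 : associator y (x * l) z = -associator y z (x * l) := by rw [assoc_swap_right]
  have hz' := apply_conj hσ hz (t := t)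
  rw [associator_apply, associator_apply, mul_mul_of_apply h hσ hσt hy hx hl,
    mul_apply_mul h hσ hσt (apply_mul hσ hx hy) hz hl, mul_apply_mul h hσ hσt hx hz hl,
    mul_mul_of_apply h hσ hσt hy (apply_mul hσ hx hz') hl,
    mul_mul_of_apply h hσ hσt hz hx hl,
    mul_mul_of_apply h hσ hσt hy (apply_mul hσ hx hz) hl,
    mul_mul_of_apply h hσ hσt (apply_mul hσ hy hz) hx hl] at h1
  apply hi
  simp only [associator_apply, conj_apply, mul_sub, sub_mul, smul_mul_assoc, mul_smul_comm,
    mul_one] at h1 ⊢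
  linear_combination (norm := module) -h1

theorem exists_eq_add_mul (hn : nrm t l ≠ 0) (hl : σ l = -l) (w : B) :
    ∃ x y : hσ.fixed, w = x + y * l := by
  have h1 := h.mul_mul_conj l ((⅟2 : k) • (w - σ w))
  rw [conj_of_trace_eq_zero (trace_eq_zero_of_apply hσt hl), mul_neg, ← neg_mul] at h1
  have h2 : σ ((-(nrm t l)⁻¹) • (((⅟2 : k) • (w - σ w)) * l)) =
      (-(nrm t l)⁻¹) • (((⅟2 : k) • (w - σ w)) * l) := by
    rw [map_smul, hσ.map_mul, map_smul, apply_sub_apply hσ, hl, smul_neg, neg_mul_neg]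
  have h3 : σ ((⅟2 : k) • (w + σ w)) = (⅟2 : k) • (w + σ w) := by
    rw [map_smul, show σ (w + σ w) = w + σ w from hσ.add_mem_fixed w]
  refine ⟨⟨_, h3⟩, ⟨_, h2⟩, ?_⟩
  change w = (⅟2 : k) • (w + σ w) + (-(nrm t l)⁻¹) • (((⅟2 : k) • (w - σ w)) * l) * l
  rw [smul_mul_assoc, neg_smul, ← smul_neg, ← neg_mul, h1, smul_smul, inv_mul_cancel₀ hn, one_smul,
    half_add_half]

/-- If the fixed points of a nontrivial reflection commute, then the algebra is associative. -/
theorem assoc_of_commute (hn : nrm t l ≠ 0) (hl : σ l = -l)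
    (hcomm : ∀ x y : hσ.fixed, x * y = y * x) (x y z : B) : associator x y z = 0 := by
  have hc : ∀ {x y}, σ x = x → σ y = y → x * y = y * x :=
    fun {x y} hx hy => congrArg Subtype.val (hcomm ⟨x, hx⟩ ⟨y, hy⟩)
  have h0 : ∀ {x y z}, σ x = x → σ y = y → σ z = z → associator x y z = 0 :=
    fun hx hy hz => assoc_of_apply h hσ hσt hx hy hz hl hn
  have h1 : ∀ {x y z}, σ x = x → σ y = y → σ z = z → associator x y (z * l) = 0 :=
    fun {x y z} hx hy hz => by
    have h1 := h0 hz hy hx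
    rw [associator_apply, sub_eq_zero] at h1
    rw [associator_apply, mul_mul_of_apply h hσ hσt hy hz hl,
      mul_mul_of_apply h hσ hσt hx (apply_mul hσ hz hy) hl,
      mul_mul_of_apply h hσ hσt (apply_mul hσ hx hy) hz hl, h1, hc hx hy, sub_self]
  have h2 : ∀ {x y z}, σ x = x → σ y = y → σ z = z → associator (x * l) (y * l) z = 0 :=
    fun {x y z} hx hy hz => by
    have hy' := apply_conj hσ hy (t := t)
    have hz' := apply_conj hσ hz (t := t)
    have h1 := h0 hz hy' hx
    rw [associator_apply, sub_eq_zero] at h1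
    rw [associator_apply, mul_mul_mul_of_apply h hσ hσt hx hy hl,
      mul_apply_mul h hσ hσt hy hz hl,
      mul_mul_mul_of_apply h hσ hσt hx (apply_mul hσ hy hz') hl, h.conj_mul, h.conj_conj, h1,
      neg_mul, smul_mul_assoc, hc (apply_mul hσ hy' hx) hz, sub_self]
  have h3 : ∀ {x y z}, σ x = x → σ y = y → σ z = z → associator (x * l) (y * l) (z * l) = 0 :=
    fun {x y z} hx hy hz => by
    have hy' := apply_conj hσ hy (t := t)
    have hz' := apply_conj hσ hz (t := t)
    rw [associator_apply, mul_mul_mul_of_apply h hσ hσt hx hy hl,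
      mul_mul_mul_of_apply h hσ hσt hy hz hl, neg_mul, mul_neg, smul_mul_assoc, mul_smul_comm,
      mul_mul_of_apply h hσ hσt (apply_mul hσ hy' hx) hz hl,
      mul_apply_mul h hσ hσt hx (apply_mul hσ hz' hy) hl, h.conj_mul, h.conj_conj]
    have h1 := h0 hz hy' hx
    rw [associator_apply, sub_eq_zero] at h1
    rw [← h1, hc hz hy', hc hx (apply_mul hσ hy' hz), sub_self]
  obtain ⟨⟨x, hx⟩, ⟨x', hx'⟩, rfl⟩ := exists_eq_add_mul h hσ hσt hn hl x
  obtain ⟨⟨y, hy⟩, ⟨y', hy'⟩, rfl⟩ := exists_eq_add_mul h hσ hσt hn hl y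
  obtain ⟨⟨z, hz⟩, ⟨z', hz'⟩, rfl⟩ := exists_eq_add_mul h hσ hσt hn hl z
  simp only [assoc_add_left, assoc_add_mid, assoc_add_right]
  rw [h0 hx hy hz, h1 hx hy hz', assoc_swap_right x z (y' * l), h1 hx hz hy',
    ← assoc_cyclic (x' * l) y z, h1 hy hz hx', h2 hx' hy' hz, h3 hx' hy' hz',
    ← assoc_cyclic x (y' * l) (z' * l), h2 hy' hz' hx, assoc_swap_right (x' * l) (z' * l) y,
    h2 hx' hz' hy]
  simp

/-- A nontrivial reflection fixes a subalgebra of half dimension. -/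
theorem finrank_fixed [Module.Finite k B] (hn : nrm t l ≠ 0) (hl : σ l = -l) :
    Module.finrank k B = 2 * Module.finrank k hσ.fixed := by
  let f : (hσ.fixed × hσ.fixed) →ₗ[k] B :=
    hσ.subtype.coprod ((LinearMap.mulRight k l) ∘ₗ hσ.subtype)
  have hf : ∀ x y : hσ.fixed, f (x, y) = x + y * l := fun x y => by
    rw [LinearMap.coprod_apply]
    rfl
  have hinj : Function.Injective f := by
    rw [injective_iff_map_eq_zero]
    rintro ⟨x, y⟩ hxy
    rw [hf] at hxy
    have h1 := congrArg σ hxy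
    rw [map_add, hσ.map_mul, hσ.apply_coe, hσ.apply_coe, hl, map_zero, mul_neg] at h1
    have h2 : (2 : k) • (x : B) = 0 := by
      linear_combination (norm := module) hxy + h1
    have hx : (x : B) = 0 := (smul_eq_zero.1 h2).resolve_left (Invertible.ne_zero 2)
    rw [hx, zero_add] at hxy
    have h3 := h.mul_mul_conj l (y : B)
    rw [hxy, zero_mul] at h3
    exact Prod.ext (Subtype.ext hx)
      (Subtype.ext ((smul_eq_zero.1 h3.symm).resolve_left hn))
  have hsurj : Function.Surjective f := fun w => by
    obtain ⟨x, y, rfl⟩ := exists_eq_add_mul h hσ hσt hn hl w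
    exact ⟨(x, y), hf x y⟩
  rw [← (LinearEquiv.ofBijective f ⟨hinj, hsurj⟩).finrank_eq, Module.finrank_prod, two_mul]

end Doubling

end IsTrace

end IsAlternativeRing

namespace IsAlternativeRing

namespace IsTrace

variable {k B : Type*} [Field k] [Invertible (2 : k)] [NonAssocRing B] [Module k B]
  [SMulCommClass k B B] [IsScalarTower k B B] [IsAlternativeRing B] [Module.Finite k B]
  {t : B →ₗ[k] k}

omit [IsAlternativeRing B] [Module.Finite k B] in
/-- Conjugation by an element of trace zero and nonzero norm in an associative algebra is a
reflection. -/
theorem isReflection_conj (h : IsTrace t) (hassoc : ∀ x y z : B, associator x y z = 0) {p : B}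
    (hp : t p = 0) (hn : nrm t p ≠ 0) :
    IsReflection ((-(nrm t p)⁻¹) • (LinearMap.mulRight k p ∘ₗ LinearMap.mulLeft k p)) := by
  have ha : ∀ x y z : B, (x * y) * z = x * (y * z) := fun x y z => sub_eq_zero.1 (hassoc x y z)
  have hpp := h.mul_self_of_trace_eq_zero hp
  have hpx : ∀ x, p * (p * x) = (-nrm t p) • x := fun x => by
    rw [← ha, hpp, smul_mul_assoc, one_mul]
  refine ⟨?_, fun x y => ?_, fun x => ?_⟩ <;>
  simp only [LinearMap.smul_apply, LinearMap.comp_apply, LinearMap.mulLeft_apply,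
    LinearMap.mulRight_apply, mul_one, ha, smul_mul_assoc, mul_smul_comm, hpx, hpp, smul_smul] <;>
  match_scalars <;> field_simp

/-- A nondegenerate noncommutative associative quadratic algebra has dimension four. -/
theorem finrank_eq_four (h : IsTrace t) (hnd : ∀ x, (∀ y, t (x * y) = 0) → x = 0)
    (hassoc : ∀ x y z : B, associator x y z = 0) (hcomm : ¬ ∀ x y : B, x * y = y * x) :
    Module.finrank k B = 4 := by
  have ha : ∀ x y z : B, (x * y) * z = x * (y * z) := fun x y z => sub_eq_zero.1 (hassoc x y z)
  obtain ⟨p, hp, hn, y, hy⟩ := h.exists_not_commute hnd hcomm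
  have hσ := h.isReflection_conj hassoc hp hn
  set σ := (-(nrm t p)⁻¹) • (LinearMap.mulRight k p ∘ₗ LinearMap.mulLeft k p) with hσ_def
  have hσx : ∀ x, σ x = (-(nrm t p)⁻¹) • ((p * x) * p) := fun x => rfl
  have hpp := h.mul_self_of_trace_eq_zero hp
  have hfix : ∀ x, σ x = x ↔ p * x = x * p := fun x => by
    constructor
    · intro hx
      rw [hσx] at hx
      have h1 := congrArg (· * p) hx
      simp only [smul_mul_assoc, ha, hpp, mul_smul_comm, mul_one, smul_smul] at h1
      rwa [neg_mul_neg, inv_mul_cancel₀ hn, one_smul] at h1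
    · intro hx
      rw [hσx, hx, ha, hpp, mul_smul_comm, smul_smul, neg_mul_neg, inv_mul_cancel₀ hn, one_smul,
        mul_one]
  have hσt : ∀ x, t (σ x) = t x := fun x => by
    rw [hσx, map_smul, h.map_mul_comm, ← ha, hpp, smul_mul_assoc, one_mul, map_smul, smul_smul,
      neg_mul_neg, inv_mul_cancel₀ hn, one_smul]
  obtain ⟨l, hl, hln⟩ := exists_apply_eq_neg h hnd hσ hσt ⟨y, fun e => hy ((hfix y).1 e)⟩
  rw [finrank_fixed h hσ hσt hln hl]
  let f : (k × k) →ₗ[k] hσ.fixed :=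
    (LinearMap.toSpanSingleton k hσ.fixed 1).coprod
      (LinearMap.toSpanSingleton k hσ.fixed ⟨p, (hfix p).2 rfl⟩)
  have hf : ∀ a b : k, (f (a, b) : B) = a • (1 : B) + b • p := fun a b => by
    rw [LinearMap.coprod_apply]
    rfl
  have hp0 : p ≠ 0 := by
    rintro rfl
    simp at hy
  have h10 : (1 : B) ≠ 0 := fun e => hp0 (by rw [← mul_one p, e, mul_zero])
  have hinj : Function.Injective f := by
    rw [injective_iff_map_eq_zero]
    rintro ⟨a, b⟩ hab
    have h1 := congrArg Subtype.val hab
    rw [hf] at h1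
    have h2 := congrArg t h1
    rw [map_add, map_smul, map_smul, hp, h.map_one] at h2
    have ha0 : a = 0 := by simpa [Invertible.ne_zero (2 : k)] using h2
    rw [ha0, zero_smul, zero_add] at h1
    exact Prod.ext ha0 ((smul_eq_zero.1 h1).resolve_right hp0)
  have hsurj : Function.Surjective f := by
    rintro ⟨x, hx⟩
    have hx' := (hfix x).1 hx
    have h1 := h.trace_sub_half x
    have h2 : (x - (⅟2 * t x) • (1 : B)) * p = p * (x - (⅟2 * t x) • (1 : B)) := by
      rw [sub_mul, mul_sub, smul_mul_assoc, mul_smul_comm, one_mul, mul_one, hx']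
    set w := x - (⅟2 * t x) • (1 : B) with hw
    have h3 : conj t (p * w) = p * w := by
      rw [h.conj_mul, conj_of_trace_eq_zero hp, conj_of_trace_eq_zero h1, neg_mul_neg, h2]
    rw [h.conj_eq_self_iff] at h3
    have h4 := congrArg (p * ·) h3
    simp only [← ha, hpp, smul_mul_assoc, mul_smul_comm, one_mul, mul_one] at h4
    refine ⟨(⅟2 * t x, (-(nrm t p)⁻¹) * (⅟2 * t (p * w))), Subtype.ext ?_⟩
    rw [hf, mul_smul (-(nrm t p)⁻¹), ← h4, smul_smul, neg_mul_neg, inv_mul_cancel₀ hn, one_smul, hw,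
      add_sub_cancel]
  rw [← (LinearEquiv.ofBijective f ⟨hinj, hsurj⟩).finrank_eq, Module.finrank_prod,
    Module.finrank_self]

/-- A nondegenerate nonassociative quadratic alternative algebra with a nontrivial reflection `σ`
has dimension eight, and the involution `x ↦ conj (σ x)` has a skew space of dimension three. -/
theorem finrank_eq_eight (h : IsTrace t) (hnd : ∀ x, (∀ y, t (x * y) = 0) → x = 0)
    (hassoc : ¬ ∀ x y z : B, associator x y z = 0) {σ : B →ₗ[k] B} (hσ : IsReflection σ)
    (hσt : ∀ x, t (σ x) = t x) (hne : ∃ x, σ x ≠ x) {S : Submodule k B}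
    (hS : ∀ x, x ∈ S ↔ conj t (σ x) = -x) :
    Module.finrank k B = 8 ∧ Module.finrank k S = 3 := by
  obtain ⟨l, hl, hln⟩ := exists_apply_eq_neg h hnd hσ hσt hne
  have h4 : Module.finrank k hσ.fixed = 4 :=
    finrank_eq_four (hσ.isTrace_comp h) (fixed_nondegenerate hnd hσ hσt)
      (fun x y z => Subtype.ext (assoc_of_apply h hσ hσt x.2 y.2 z.2 hl hln))
      (fun hc => hassoc (assoc_of_commute h hσ hσt hln hl hc))
  refine ⟨by rw [finrank_fixed h hσ hσt hln hl, h4], ?_⟩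
  have hS' : ∀ x, x ∈ S ↔ σ x = x ∧ t x = 0 := fun x => by
    rw [hS, conj_apply, hσt]
    constructor
    · intro hx
      have h1 := congrArg t hx
      rw [map_sub, map_smul, h.map_one, hσt, map_neg, smul_eq_mul] at h1
      have h2 : t x = 0 := by
        have : 2 * t x = 0 := by linear_combination h1
        exact (mul_eq_zero.1 this).resolve_left (Invertible.ne_zero 2)
      rw [h2, zero_smul, zero_sub, neg_inj] at hx
      exact ⟨hx, h2⟩
    · rintro ⟨hx, hx'⟩
      rw [hx, hx', zero_smul, zero_sub]
  let f : (k × S) →ₗ[k] hσ.fixed :=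
    (LinearMap.toSpanSingleton k hσ.fixed 1).coprod
      { toFun := fun s => ⟨s, ((hS' s).1 s.2).1⟩
        map_add' := fun _ _ => rfl
        map_smul' := fun _ _ => rfl }
  have hf : ∀ (a : k) (s : S), (f (a, s) : B) = a • (1 : B) + s := fun a s => by
    rw [LinearMap.coprod_apply]
    rfl
  have hinj : Function.Injective f := by
    rw [injective_iff_map_eq_zero]
    rintro ⟨a, s⟩ has
    have h1 := congrArg Subtype.val has
    rw [hf] at h1
    have h2 := congrArg t h1
    rw [map_add, map_smul, ((hS' s).1 s.2).2, h.map_one] at h2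
    have ha0 : a = 0 := by simpa [Invertible.ne_zero (2 : k)] using h2
    rw [ha0, zero_smul, zero_add] at h1
    exact Prod.ext ha0 (Subtype.ext h1)
  have hsurj : Function.Surjective f := by
    rintro ⟨x, hx⟩
    refine ⟨(⅟2 * t x, ⟨x - (⅟2 * t x) • (1 : B), (hS' _).2 ⟨?_, h.trace_sub_half x⟩⟩), ?_⟩
    · rw [map_sub, map_smul, hσ.map_one, show σ x = x from hx]
    · refine Subtype.ext ?_
      rw [hf, add_sub_cancel]
  have h5 := (LinearEquiv.ofBijective f ⟨hinj, hsurj⟩).finrank_eq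
  rw [Module.finrank_prod, Module.finrank_self, h4] at h5
  omega

end IsTrace

end IsAlternativeRing

namespace AlgebraWithInvolution

open IsAlternativeRing IsTrace

universe v

section Center

variable {k : Type v} [Field k] {A : AlgebraWithInvolution k}

/-- The involution on the center. -/
def centerInvol (c : Subring.center A.carrier) : Subring.center A.carrier :=
  ⟨A.invol c, invol_mem_center c.2⟩

theorem centerInvol_mul (c d : Subring.center A.carrier) :
    centerInvol (c * d) = centerInvol c * centerInvol d := by
  rw [mul_comm]
  exact Subtype.ext (A.invol_mul d c)

theorem centerInvol_centerInvol (c : Subring.center A.carrier) :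
    centerInvol (centerInvol c) = c :=
  Subtype.ext (A.invol_invol c)

theorem invol_center_smul (c : Subring.center A.carrier) (x : A.carrier) :
    A.invol (c • x) = centerInvol c • A.invol x := by
  rw [center_smul_def, A.invol_mul, center_smul_def]
  exact ((centerInvol c).2.comm _).eq.symm

variable (A) in
/-- The scalars in the center. -/
def scalar (c : k) : Subring.center A.carrier :=
  ⟨c • (1 : A.carrier), by
    refine ⟨fun x => ?_, fun x y => ?_, fun x y => ?_⟩ <;>
    simp only [Commute, SemiconjBy, smul_mul_assoc, mul_smul_comm, one_mul, mul_one]⟩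

theorem coe_scalar (c : k) : (A.scalar c : A.carrier) = c • (1 : A.carrier) := rfl

theorem scalar_smul (c : k) (x : A.carrier) : A.scalar c • x = c • x := by
  rw [center_smul_def, coe_scalar, smul_mul_assoc, one_mul]

theorem scalar_mul (c d : k) : A.scalar (c * d) = A.scalar c * A.scalar d := by
  refine Subtype.ext ?_
  change (c * d) • (1 : A.carrier) = (c • 1) * (d • 1)
  rw [smul_mul_assoc, one_mul, smul_smul]

theorem scalar_one : A.scalar 1 = 1 := Subtype.ext (one_smul k _)

theorem scalar_injective [Nontrivial A.carrier] : Function.Injective A.scalar := fun c d hcd => by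
  have h1 := congrArg Subtype.val hcd
  rw [coe_scalar, coe_scalar, ← sub_eq_zero, ← sub_smul] at h1
  exact sub_eq_zero.1 ((smul_eq_zero.1 h1).resolve_right one_ne_zero)

theorem exists_scalar (hcentral : ∀ a ∈ Set.center A.carrier, A.invol a = a →
      ∃ c : k, a = c • (1 : A.carrier)) {c : Subring.center A.carrier} (hc : centerInvol c = c) :
    ∃ d : k, c = A.scalar d := by
  obtain ⟨d, hd⟩ := hcentral c c.2 (congrArg Subtype.val hc)
  exact ⟨d, Subtype.ext hd⟩

end Center

section Trace

variable {k : Type v} [Field k] {A : AlgebraWithInvolution k}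
  {t : A.carrier →ₗ[Subring.center A.carrier] Subring.center A.carrier}

theorem conj_smul_scalar (c : k) (x : A.carrier) : conj t (c • x) = c • conj t x := by
  rw [← scalar_smul, map_smul, scalar_smul]

theorem trace_smul_scalar (c : k) (x : A.carrier) : t (c • x) = A.scalar c * t x := by
  rw [← scalar_smul, map_smul, smul_eq_mul]

variable (ht : ∀ x, (t (A.invol x) : A.carrier) = A.invol (t x))
include ht

theorem trace_invol (x : A.carrier) : t (A.invol x) = centerInvol (t x) := Subtype.ext (ht x)

theorem conj_invol (x : A.carrier) : conj t (A.invol x) = A.invol (conj t x) := by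
  rw [conj_apply, conj_apply, map_sub, invol_center_smul, trace_invol ht, A.invol_one]

theorem nrm_invol [Invertible (2 : Subring.center A.carrier)] (h : IsTrace t) (x : A.carrier) :
    nrm t (A.invol x) = centerInvol (nrm t x) := by
  apply h.smul_one_inj
  rw [← h.mul_conj_self, conj_invol ht, ← A.invol_mul, h.conj_mul_self, invol_center_smul,
    A.invol_one]

omit ht in
variable (t) in
/-- The composition of the conjugation with the involution. -/
def reflection : A.carrier →ₗ[k] A.carrier where
  toFun x := conj t (A.invol x)
  map_add' x y := by rw [map_add, map_add]
  map_smul' c x := by rw [map_smul, conj_smul_scalar, RingHom.id_apply]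

omit ht in
theorem reflection_apply (x : A.carrier) : reflection t x = conj t (A.invol x) := rfl

theorem isReflection (h : IsTrace t) : IsReflection (reflection t) where
  map_one := by rw [reflection_apply, A.invol_one, h.conj_one]
  map_mul x y := by rw [reflection_apply, A.invol_mul, h.conj_mul]; rfl
  map_map x := by
    rw [reflection_apply, reflection_apply, ← conj_invol ht, A.invol_invol, h.conj_conj]

variable [Invertible (2 : Subring.center A.carrier)] [IsAlternativeRing A.carrier]

omit ht in
theorem exists_mul_nrm_eq_one (h : IsTrace t)
    (hcentral : ∀ a ∈ Set.center A.carrier, A.invol a = a → ∃ c : k, a = c • (1 : A.carrier))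
    (hsimple : ∀ I : Submodule k A.carrier,
      (∀ a ∈ I, ∀ x : A.carrier, x * a ∈ I ∧ a * x ∈ I) → (∀ a ∈ I, A.invol a ∈ I) →
        I = ⊥ ∨ I = ⊤)
    (hassoc : ¬ ∀ x y z : A, associator x y z = 0)
    (hnil : ∀ c ∈ Set.center A.carrier, c * c = 0 → c = 0) {u : A.carrier}
    (hu : ∀ w, ∃ y, A.Vop u y u = w) : ∃ r, r * nrm t u = 1 := by
  obtain ⟨c, hc⟩ : ∃ c : k, nrm t u * centerInvol (nrm t u) = A.scalar c := by
    apply exists_scalar hcentral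
    rw [centerInvol_mul, centerInvol_centerInvol, mul_comm]
  by_cases hc0 : c ≠ 0
  · refine ⟨A.scalar c⁻¹ * centerInvol (nrm t u), ?_⟩
    rw [mul_assoc, mul_comm (centerInvol _), hc, ← scalar_mul, inv_mul_cancel₀ hc0, scalar_one]
  exfalso
  push Not at hc0
  rw [hc0, show A.scalar (0 : k) = 0 from Subtype.ext (zero_smul k _)] at hc
  have h10 : (1 : Subring.center A.carrier) ≠ 0 := fun e => hassoc fun x y z => by
    rw [← one_smul (Subring.center A.carrier) (associator x y z), e, zero_smul]
  obtain ⟨g, hg0, hg⟩ : ∃ g, g ≠ 0 ∧ g * nrm t u = 0 := by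
    by_cases hn : nrm t u = 0
    · exact ⟨1, h10, by rw [hn, mul_zero]⟩
    · refine ⟨centerInvol (nrm t u), fun e => hn ?_, by rw [mul_comm, hc]⟩
      rw [← centerInvol_centerInvol (nrm t u), e]
      exact Subtype.ext (map_zero A.invol)
  have hV : ∀ y, A.Vop u y u = (2 * t (u * A.invol y)) • u -
      nrm t u • ((2 : Subring.center A.carrier) • conj t (A.invol y)) -
      (u * A.invol u) * y := fun y => by
    rw [Vop, h.mul_mul_self]
    module
  have hconj : g • conj t (u * A.invol u) = 0 := by
    obtain ⟨y, hy⟩ := hu 1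
    rw [← mul_one (conj t (u * A.invol u)), ← hy, hV, mul_sub, mul_sub, mul_smul_comm,
      mul_smul_comm, h.conj_mul_mul, h.nrm_mul, h.conj_mul u, h.mul_conj_mul', smul_sub, smul_sub,
      smul_comm g, smul_smul g, smul_smul g, smul_smul g, ← mul_assoc, hg]
    simp
  have hN : g • (u * A.invol u) = 0 := by
    have := congrArg (conj t) hconj
    rwa [map_smul, h.conj_conj, map_zero] at this
  have hw : ∀ w : A.carrier, ∃ r : Subring.center A.carrier, g • w = r • u := fun w => by
    obtain ⟨y, rfl⟩ := hu w
    refine ⟨g * (2 * t (u * A.invol y)), ?_⟩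
    rw [hV, smul_sub, smul_sub, ← smul_mul_assoc, hN, zero_mul, smul_smul g (nrm t u), hg,
      zero_smul, sub_zero, sub_zero, smul_smul]
  have hass : ∀ x y z : A, (g * g * g) • associator x y z = 0 := fun x y z => by
    obtain ⟨a, ha⟩ := hw x
    obtain ⟨b, hb⟩ := hw y
    obtain ⟨c, hc⟩ := hw z
    rw [mul_smul, ← assoc_smul_right, hc, mul_smul, ← assoc_smul_mid, hb, ← assoc_smul_left, ha,
      assoc_smul_left, assoc_smul_mid, assoc_self_left, smul_zero, smul_zero]
  let I : Submodule k A.carrier :=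
    { carrier := {x | (g * g * g) • x = 0 ∧ centerInvol (g * g * g) • x = 0}
      zero_mem' := ⟨smul_zero _, smul_zero _⟩
      add_mem' := fun {x y} hx hy => by
        exact ⟨by rw [smul_add, hx.1, hy.1, add_zero], by rw [smul_add, hx.2, hy.2, add_zero]⟩
      smul_mem' := fun c x hx => by
        refine ⟨?_, ?_⟩
        · rw [← scalar_smul, smul_comm, hx.1, smul_zero]
        · rw [← scalar_smul, smul_comm, hx.2, smul_zero] }
  have hI := hsimple I
    (fun a ha x => ⟨⟨by rw [← mul_smul_comm, ha.1, mul_zero], by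
      rw [← mul_smul_comm, ha.2, mul_zero]⟩, by rw [← smul_mul_assoc, ha.1, zero_mul], by
      rw [← smul_mul_assoc, ha.2, zero_mul]⟩)
    (fun a ha => ⟨by
      rw [← centerInvol_centerInvol (g * g * g), ← invol_center_smul, ha.2, map_zero], by
      rw [← invol_center_smul, ha.1, map_zero]⟩)
  rcases hI with hI | hI
  · refine hassoc fun x y z => ?_
    rw [← Submodule.mem_bot k, ← hI]
    refine ⟨hass x y z, ?_⟩
    have h1 : A.invol (associator (A.invol z) (A.invol y) (A.invol x)) = -associator x y z := by
      simp only [associator_apply, map_sub, A.invol_mul, A.invol_invol, neg_sub]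
    rw [← neg_neg (associator x y z), ← h1, smul_neg, ← invol_center_smul, hass, map_zero, neg_zero]
  · have h1 : (1 : A.carrier) ∈ I := hI ▸ Submodule.mem_top
    have h2 : g * g * g = 0 := by
      have := congrArg (fun x => x) h1.1
      rw [center_smul_def, mul_one] at this
      exact Subtype.ext this
    have hnil' : ∀ c : Subring.center A.carrier, c * c = 0 → c = 0 := fun c hc =>
      Subtype.ext (hnil c c.2 (congrArg Subtype.val hc))
    refine hg0 (hnil' g (hnil' _ ?_))
    rw [← mul_assoc, h2, zero_mul]

end Trace

end AlgebraWithInvolution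

namespace AlgebraWithInvolution

open IsAlternativeRing IsTrace

universe v

section Scalar

variable {k : Type v} [Field k] {A : AlgebraWithInvolution k}

theorem scalar_add (c d : k) : A.scalar (c + d) = A.scalar c + A.scalar d :=
  Subtype.ext (add_smul c d _)

theorem scalar_zero : A.scalar 0 = 0 := Subtype.ext (zero_smul k _)

theorem isUnit_scalar {c : k} (hc : c ≠ 0) : IsUnit (A.scalar c) :=
  .of_mul_eq_one (A.scalar c⁻¹) (by rw [← scalar_mul, mul_inv_cancel₀ hc, scalar_one])

theorem ne_zero_of_isUnit_scalar [Nontrivial A.carrier] {c : k} (hc : IsUnit (A.scalar c)) :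
    c ≠ 0 := by
  rintro rfl
  obtain ⟨r, hr⟩ := hc.exists_left_inv
  rw [scalar_zero, mul_zero] at hr
  exact zero_ne_one (congrArg Subtype.val hr)

theorem centerInvol_one : centerInvol (1 : Subring.center A.carrier) = 1 :=
  Subtype.ext A.invol_one

theorem isUnit_centerInvol {c : Subring.center A.carrier} (hc : IsUnit c) :
    IsUnit (centerInvol c) := by
  obtain ⟨r, hr⟩ := hc.exists_right_inv
  exact .of_mul_eq_one (centerInvol r) (by rw [← centerInvol_mul, hr, centerInvol_one])

theorem smul_one_mem_center (c : Subring.center A.carrier) :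
    c • (1 : A.carrier) ∈ Set.center A.carrier := by
  rw [center_smul_def, mul_one]
  exact c.2

variable (A) in
/-- Two elements in the same orbit of the group of autotopies. -/
def Autotopic (x y : A.carrier) : Prop := ∃ g : A.Isotopy A, g.toLinearEquiv x = y

theorem Autotopic.trans {x y z : A.carrier} (h₁ : A.Autotopic x y) (h₂ : A.Autotopic y z) :
    A.Autotopic x z := by
  obtain ⟨f, rfl⟩ := h₁
  obtain ⟨g, rfl⟩ := h₂
  exact ⟨f.trans g, rfl⟩

variable [IsAlternativeRing A.carrier]

theorem autotopic_smul {c : Subring.center A.carrier} (hc : IsUnit c) (x : A.carrier) :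
    A.Autotopic x (c • x) := by
  obtain ⟨r, hr⟩ := hc.exists_left_inv
  have hi : IsInv (c : A.carrier) (r : A.carrier) :=
    isInv_of_assoc (congrArg Subtype.val ((mul_comm c r).trans hr)) (congrArg Subtype.val hr)
      fun z => (assoc_of_mem_center c.2 _ _).1
  exact ⟨isotopyOfCenter hi c.2 r.2 (invol_mem_center c.2) (invol_mem_center r.2), rfl⟩

theorem autotopic_of_smul {c : Subring.center A.carrier} (hc : IsUnit c) {x y : A.carrier}
    (h : A.Autotopic x (c • y)) : A.Autotopic x y := by
  obtain ⟨r, hr⟩ := hc.exists_left_inv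
  have := h.trans (autotopic_smul (.of_mul_eq_one c hr) (c • y))
  rwa [smul_smul, hr, one_smul] at this

theorem autotopic_mul {s : A.carrier} (hs : A.invol s = -s) {c : k} (hc : c ≠ 0)
    (hsc : s * s = c • 1) (x : A.carrier) : A.Autotopic x (s * x) := by
  have hi : IsInv s (c⁻¹ • s) := by
    refine isInv_of_assoc ?_ ?_ fun z => ?_
    · rw [mul_smul_comm, hsc, smul_smul, inv_mul_cancel₀ hc, one_smul]
    · rw [smul_mul_assoc, hsc, smul_smul, inv_mul_cancel₀ hc, one_smul]
    · rw [assoc_smul_mid, assoc_self_left, smul_zero]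
  exact ⟨isotopyOfSkew hi hs, rfl⟩

end Scalar

section Restriction

variable {k : Type v} [Field k] {A : AlgebraWithInvolution k}
  {t : A.carrier →ₗ[Subring.center A.carrier] Subring.center A.carrier}
  {B : Type*} [NonAssocRing B] [Module k B]

/-- A trace which takes scalar values on a unital subalgebra restricts to a trace with values in
the base field. -/
theorem exists_isTrace_comp [Nontrivial A.carrier] (h : IsTrace t) {j : B →ₗ[k] A.carrier}
    (hj : Function.Injective j) (hj1 : j 1 = 1) (hjm : ∀ x y, j (x * y) = j x * j y)
    (hx : ∀ x, ∃ c : k, t (j x) = A.scalar c) :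
    ∃ t₀ : B →ₗ[k] k, IsTrace t₀ ∧ ∀ x, t (j x) = A.scalar (t₀ x) := by
  have hinj : Function.Injective A.scalar := scalar_injective
  choose f hf using hx
  let t₀ : B →ₗ[k] k :=
    { toFun := f
      map_add' := fun x y => hinj (by
        rw [← hf, map_add, map_add, hf, hf, scalar_add])
      map_smul' := fun c x => hinj (by
        rw [← hf, map_smul, trace_smul_scalar, hf, ← scalar_mul]
        rfl) }
  have ht₀ : ∀ x, t (j x) = A.scalar (t₀ x) := hf
  refine ⟨t₀, ⟨hinj ?_, fun x y => hinj ?_, fun x y => hj ?_⟩, ht₀⟩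
  · rw [← ht₀, hj1, h.map_one, ← one_add_one_eq_two, ← one_add_one_eq_two, scalar_add, scalar_one]
  · rw [← ht₀, ← ht₀, hjm, hjm, h.map_mul_comm]
  · have hs : t (j x) * t (j y) = A.scalar (t₀ x * t₀ y) := by rw [ht₀, ht₀, scalar_mul]
    have := h.polar (j x) (j y)
    rw [sub_smul, hs, ← hjm x y, ht₀, ht₀, ht₀, scalar_smul, scalar_smul, scalar_smul,
      scalar_smul] at this
    rw [map_add, hjm x y, hjm y x, map_add, map_add, map_smul, map_smul, map_smul, sub_smul, hj1,
      ← hjm x y, this]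

variable {j : B →ₗ[k] A.carrier} {t₀ : B →ₗ[k] k} (hj1 : j 1 = 1)
  (ht₀ : ∀ x, t (j x) = A.scalar (t₀ x))
include hj1 ht₀

theorem conj_apply_of_trace (x : B) : conj t (j x) = j (conj t₀ x) := by
  rw [conj_apply, conj_apply, map_sub, map_smul, hj1, ht₀, scalar_smul]

theorem nrm_apply_of_trace [Invertible (2 : k)] [Invertible (2 : Subring.center A.carrier)]
    [SMulCommClass k B B] [IsScalarTower k B B] (h : IsTrace t) (h₀ : IsTrace t₀)
    (hjm : ∀ x y, j (x * y) = j x * j y) (x : B) : nrm t (j x) = A.scalar (nrm t₀ x) := by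
  apply h.smul_one_inj
  rw [← h.mul_conj_self, conj_apply_of_trace hj1 ht₀, ← hjm, h₀.mul_conj_self, map_smul, hj1,
    scalar_smul]

end Restriction

end AlgebraWithInvolution

namespace AlgebraWithInvolution

open IsAlternativeRing IsTrace

universe v

variable {k : Type v} [Field k] {A : AlgebraWithInvolution k} [IsAlternativeRing A.carrier]
  [Invertible (2 : Subring.center A.carrier)]
  {t : A.carrier →ₗ[Subring.center A.carrier] Subring.center A.carrier}

/-- An invertible skew element of trace zero whose square is a scalar. -/
structure IsSkewUnit (t : A.carrier →ₗ[Subring.center A.carrier] Subring.center A.carrier)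
    (s : A.carrier) : Prop where
  invol_eq : A.invol s = -s
  trace_eq : t s = 0
  exists_mul_self : ∃ c : k, c ≠ 0 ∧ s * s = c • (1 : A.carrier)

omit [Invertible (2 : Subring.center A.carrier)] in
theorem IsSkewUnit.autotopic {s : A.carrier} (hs : IsSkewUnit t s) (x : A.carrier) :
    A.Autotopic x (s * x) :=
  have ⟨_, hc, hsc⟩ := hs.exists_mul_self
  autotopic_mul hs.invol_eq hc hsc x

omit [IsAlternativeRing A.carrier] in
theorem nrm_scalar_smul (h : IsTrace t) (c : k) (x : A.carrier) :
    nrm t (c • x) = A.scalar (c * c) * nrm t x := by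
  rw [← scalar_smul, h.nrm_smul, scalar_mul]

/-- If every invertible element fixed by the reflection is a product of two skew units, then an
invertible element `c + z` with `c` fixed by the reflection and `z` central and skew is autotopic
to one. -/
theorem autotopic_one_add (ht : ∀ x, (t (A.invol x) : A.carrier) = A.invol (t x)) (h : IsTrace t)
    (hcentral : ∀ a ∈ Set.center A.carrier, A.invol a = a → ∃ c : k, a = c • (1 : A.carrier))
    (hfac : ∀ g, A.invol g = conj t g → IsUnit (nrm t g) →
      ∃ r s, IsSkewUnit t r ∧ IsSkewUnit t s ∧ r * s = g)
    {z : Subring.center A.carrier} (hz : centerInvol z = -z) {d : k} (hd : z * z = A.scalar d)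
    {c : A.carrier} (hc : A.invol c = conj t c) (hn : IsUnit (nrm t (c + z • (1 : A.carrier)))) :
    A.Autotopic 1 (c + z • (1 : A.carrier)) := by
  have hsc : ∀ x, A.invol x = conj t x → ∃ e : k, t x = A.scalar e := fun x hx =>
    exists_scalar hcentral (by rw [← trace_invol ht, hx, h.trace_conj])
  obtain ⟨τ, hτ⟩ := hsc c hc
  set v := c + z • (1 : A.carrier) with hv
  set q := c * c - d • (1 : A.carrier) with hq
  have hqi : A.invol q = conj t q := by
    rw [hq, map_sub, map_sub, A.invol_mul, hc, h.conj_mul, map_smul, A.invol_one,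
      conj_smul_scalar, h.conj_one]
  have hvi : A.invol v = conj t (c - z • (1 : A.carrier)) := by
    rw [hv, map_add, map_sub, hc, invol_center_smul, hz, A.invol_one, h.conj_smul_one, neg_smul,
      sub_eq_add_neg]
  have hzz : z • z • (1 : A.carrier) = d • (1 : A.carrier) := by
    rw [smul_smul, hd, scalar_smul]
  have hvq : v * (c - z • (1 : A.carrier)) = q := by
    rw [hv, hq, add_mul, mul_sub, mul_smul_comm, mul_one, smul_mul_assoc, one_mul, smul_sub, hzz]
    abel
  have hnq : IsUnit (nrm t q) := by
    rw [← hvq, h.nrm_mul]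
    refine hn.mul ?_
    rw [← h.nrm_conj, ← hvi, nrm_invol ht h]
    exact isUnit_centerInvol hn
  obtain ⟨r, s, hr, hs, hrs⟩ := hfac (conj t q) (by rw [← hqi, conj_invol ht, hqi]) (by
    rwa [h.nrm_conj])
  obtain ⟨ρ, hρ⟩ := hn.exists_left_inv
  have hρ' : centerInvol ρ * centerInvol (nrm t v) = 1 := by
    rw [← centerInvol_mul, hρ, centerInvol_one]
  have hone : A.Autotopic 1 (q * v) := by
    refine autotopic_of_smul (.of_mul_eq_one _ hρ') ?_
    have htr : v + A.invol v ∈ Set.center A.carrier := by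
      have : v + A.invol v = t c • (1 : A.carrier) := by
        rw [hv, map_add, hc, conj_apply, invol_center_smul, hz, A.invol_one]
        module
      rw [this]
      exact smul_one_mem_center _
    refine ⟨isotopyOfTrace (h.isInv hρ) htr, ?_⟩
    change (v * (1 * A.invol (ρ • conj t v))) * v = centerInvol ρ • (q * v)
    rw [one_mul, invol_center_smul, ← conj_invol ht, hvi, h.conj_conj, mul_smul_comm,
      smul_mul_assoc, hvq]
  have h1 : associator r s 1 = 0 := assoc_one_right r s
  have h2 : associator r s q = 0 := by
    have h3 : associator r s (r * s) = 0 := by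
      rw [assoc_swap_right, assoc_mul_left, assoc_self_right, zero_mul, neg_zero]
    rwa [hrs, assoc_conj_right, neg_eq_zero] at h3
  have hcc := h.mul_self c
  rw [hτ, scalar_smul] at hcc
  have h4 : associator r s (q * c) = 0 := by
    by_cases hτ0 : τ = 0
    · obtain ⟨ν, hν, hrr⟩ := hr.exists_mul_self
      have hrs' : r * s = (-nrm t c - A.scalar d) • (1 : A.carrier) := by
        rw [hrs, hq, hcc, hτ0, ← scalar_smul d, map_sub, map_sub, h.conj_smul_one, h.conj_smul_one,
          zero_smul, map_zero]
        module
      have h5 : ν • s = (-nrm t c - A.scalar d) • r := by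
        rw [← mul_one r, ← mul_smul_comm, ← hrs', IsAlternativeRing.left_alt, hrr, smul_mul_assoc,
          one_mul]
      have h6 : ν • associator r s (q * c) = 0 := by
        rw [← assoc_smul_mid, h5, assoc_smul_mid, assoc_self_left, smul_zero]
      exact (smul_eq_zero.1 h6).resolve_left hν
    · have h5 : τ • c = q + (nrm t c + A.scalar d) • (1 : A.carrier) := by
        rw [hq, hcc, add_smul, scalar_smul]
        abel
      have h6 : τ • associator r s (q * c) = 0 := by
        rw [← assoc_smul_right, ← mul_smul_comm, h5, mul_add, mul_smul_comm, mul_one, h.mul_self q,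
          assoc_add_right, sub_eq_add_neg, assoc_add_right, ← neg_smul]
        simp only [assoc_smul_right, h1, h2, smul_zero, add_zero]
      exact (smul_eq_zero.1 h6).resolve_left hτ0
  have h7 : r * (s * (q * v)) = nrm t q • v := by
    rw [← h.conj_mul_mul q v, ← hrs, eq_comm, ← sub_eq_zero]
    change associator r s (q * v) = 0
    rw [hv, mul_add, assoc_add_right, h4, mul_smul_comm, mul_one, assoc_smul_right, h2, smul_zero,
      add_zero]
  refine autotopic_of_smul hnq ?_
  rw [← h7]
  exact (hone.trans (hs.autotopic _)).trans (hr.autotopic _)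

end AlgebraWithInvolution

namespace AlgebraWithInvolution

open IsAlternativeRing IsTrace

universe v

variable {k : Type v} [Field k] {A : AlgebraWithInvolution k} [IsAlternativeRing A.carrier]
  [Invertible (2 : Subring.center A.carrier)]
  {t : A.carrier →ₗ[Subring.center A.carrier] Subring.center A.carrier}

omit [Invertible (2 : Subring.center A.carrier)] in
/-- Division by a skew unit preserves the elements on which the involution is the conjugation. -/
theorem IsSkewUnit.exists_mul_eq (h : IsTrace t) {s : A.carrier} (hs : IsSkewUnit t s)
    {a : A.carrier} (ha : A.invol a = conj t a) : ∃ c, A.invol c = conj t c ∧ s * c = a := by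
  obtain ⟨ν, hν, hss⟩ := hs.exists_mul_self
  refine ⟨ν⁻¹ • (s * a), ?_, ?_⟩
  · rw [map_smul, conj_smul_scalar, A.invol_mul, h.conj_mul, ha, hs.invol_eq,
      conj_of_trace_eq_zero hs.trace_eq]
  · rw [mul_smul_comm, IsAlternativeRing.left_alt, hss, smul_mul_assoc, one_mul, smul_smul,
      inv_mul_cancel₀ hν, one_smul]

theorem autotopic_one_add_smul (ht : ∀ x, (t (A.invol x) : A.carrier) = A.invol (t x))
    (h : IsTrace t)
    (hcentral : ∀ a ∈ Set.center A.carrier, A.invol a = a → ∃ c : k, a = c • (1 : A.carrier))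
    (hfac : ∀ g, A.invol g = conj t g → IsUnit (nrm t g) →
      ∃ r s, IsSkewUnit t r ∧ IsSkewUnit t s ∧ r * s = g)
    {z : Subring.center A.carrier} (hz : centerInvol z = -z) {d : k} (hd : z * z = A.scalar d)
    {a b : A.carrier} (ha : A.invol a = conj t a) (hb : A.invol b = conj t b)
    (hnb : IsUnit (nrm t b)) (hn : IsUnit (nrm t (a + z • b))) :
    A.Autotopic 1 (a + z • b) := by
  obtain ⟨r, s, hr, hs, hrs⟩ := hfac b hb hnb
  obtain ⟨a', ha', rfl⟩ := hr.exists_mul_eq h ha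
  obtain ⟨c, hc, rfl⟩ := hs.exists_mul_eq h ha'
  have hu : r * (s * c) + z • b = r * (s * (c + z • (1 : A.carrier))) := by
    rw [mul_add, mul_add, mul_smul_comm, mul_one, mul_smul_comm, hrs]
  rw [hu] at hn ⊢
  rw [h.nrm_mul, h.nrm_mul] at hn
  exact ((autotopic_one_add ht h hcentral hfac hz hd hc
    (isUnit_of_mul_isUnit_right (isUnit_of_mul_isUnit_right hn))).trans (hs.autotopic _)).trans
    (hr.autotopic _)

/-- Every invertible element is autotopic to one, if there is a nonzero skew central element. -/
theorem autotopic_one_of_center (hk2 : (2 : k) ≠ 0) (hk3 : (3 : k) ≠ 0)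
    (ht : ∀ x, (t (A.invol x) : A.carrier) = A.invol (t x)) (h : IsTrace t)
    (hcentral : ∀ a ∈ Set.center A.carrier, A.invol a = a → ∃ c : k, a = c • (1 : A.carrier))
    (hfac : ∀ g, A.invol g = conj t g → IsUnit (nrm t g) →
      ∃ r s, IsSkewUnit t r ∧ IsSkewUnit t s ∧ r * s = g)
    {z : Subring.center A.carrier} (hz : centerInvol z = -z) {d : k} (hd : z * z = A.scalar d)
    (hd0 : d ≠ 0) {a b : A.carrier} (ha : A.invol a = conj t a) (hb : A.invol b = conj t b)
    (hn : IsUnit (nrm t (a + z • b))) : A.Autotopic 1 (a + z • b) := by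
  have hsc : ∀ x, A.invol x = conj t x → ∃ e : k, nrm t x = A.scalar e := fun x hx =>
    exists_scalar hcentral (by rw [← nrm_invol ht h, hx, h.nrm_conj])
  have hdu : IsUnit (z * z) := hd ▸ isUnit_scalar hd0
  have hzu : IsUnit z := isUnit_of_mul_isUnit_left hdu
  obtain ⟨α, hα⟩ := hsc a ha
  obtain ⟨β, hβ⟩ := hsc b hb
  by_cases hβ0 : β ≠ 0
  · exact autotopic_one_add_smul ht h hcentral hfac hz hd ha hb (hβ ▸ isUnit_scalar hβ0) hn
  have key : ∀ e f : k, IsUnit (A.scalar e + A.scalar f * z) →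
      IsUnit (nrm t (e • b + f • a)) → A.Autotopic 1 (a + z • b) := fun e f hef hne => by
    have h1 : (A.scalar e + A.scalar f * z) • (a + z • b) =
        (e • a + (d * f) • b) + z • (e • b + f • a) := by
      rw [← scalar_smul, ← scalar_smul, ← scalar_smul, ← scalar_smul, scalar_mul, ← hd]
      module
    refine autotopic_of_smul hef ?_
    rw [h1]
    refine autotopic_one_add_smul ht h hcentral hfac hz hd ?_ ?_ hne ?_
    · rw [map_add, map_add, map_smul, map_smul, conj_smul_scalar, conj_smul_scalar, ha, hb]
    · rw [map_add, map_add, map_smul, map_smul, conj_smul_scalar, conj_smul_scalar, ha, hb]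
    · rw [← h1, h.nrm_smul]
      exact (hef.mul hef).mul hn
  by_cases hα0 : α ≠ 0
  · refine key 0 1 ?_ ?_
    · rwa [scalar_zero, scalar_one, one_mul, zero_add]
    · rw [zero_smul, one_smul, zero_add, hα]
      exact isUnit_scalar hα0
  push Not at hα0 hβ0
  rw [hα0, scalar_zero] at hα
  rw [hβ0, scalar_zero] at hβ
  have hab : IsUnit (t (b * conj t a)) := by
    rw [h.nrm_add, h.nrm_smul, hα, hβ, mul_zero, zero_add, zero_add, map_smul, mul_smul_comm,
      map_smul, smul_eq_mul, h.trace_mul_conj_comm] at hn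
    exact isUnit_of_mul_isUnit_right hn
  obtain ⟨e, he0, he⟩ : ∃ e : k, e ≠ 0 ∧ e * e - d ≠ 0 := by
    by_cases h1 : (1 : k) * 1 - d = 0
    · exact ⟨2, hk2, fun h3 => hk3 (by linear_combination h3 - h1)⟩
    · exact ⟨1, one_ne_zero, h1⟩
  refine key e 1 ?_ ?_
  · rw [scalar_one, one_mul]
    refine isUnit_of_mul_isUnit_left (y := A.scalar e - z) ?_
    have : (A.scalar e + z) * (A.scalar e - z) = A.scalar (e * e - d) := by
      rw [eq_comm, ← add_right_cancel_iff (a := A.scalar d), ← scalar_add, sub_add_cancel,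
        scalar_mul, ← hd]
      ring
    rw [this]
    exact isUnit_scalar he
  · rw [one_smul, h.nrm_add, nrm_scalar_smul h, hα, hβ, mul_zero, zero_add, zero_add,
      smul_mul_assoc, trace_smul_scalar]
    exact (isUnit_scalar he0).mul hab

end AlgebraWithInvolution

namespace AlgebraWithInvolution

open IsAlternativeRing IsTrace

universe v

variable {k : Type v} [Field k] {A : AlgebraWithInvolution k} [IsAlternativeRing A.carrier]
  [Invertible (2 : Subring.center A.carrier)]
  {t : A.carrier →ₗ[Subring.center A.carrier] Subring.center A.carrier}

/-- The trace form of a simple algebra with involution is nondegenerate. -/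
theorem trace_nondegenerate (ht : ∀ x, (t (A.invol x) : A.carrier) = A.invol (t x))
    (h : IsTrace t) [Nontrivial A.carrier]
    (hsimple : ∀ I : Submodule k A.carrier,
      (∀ a ∈ I, ∀ x : A.carrier, x * a ∈ I ∧ a * x ∈ I) → (∀ a ∈ I, A.invol a ∈ I) →
        I = ⊥ ∨ I = ⊤) (x : A.carrier) (hx : ∀ y, t (x * y) = 0) : x = 0 := by
  let I : Submodule k A.carrier :=
    { carrier := {x | ∀ y, t (x * y) = 0}
      zero_mem' := fun y => by rw [zero_mul, map_zero]
      add_mem' := fun {x y} hx hy w => by rw [add_mul, map_add, hx, hy, add_zero]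
      smul_mem' := fun c x hx y => by rw [smul_mul_assoc, trace_smul_scalar, hx, mul_zero] }
  have hI := hsimple I
    (fun a ha x => ⟨fun y => by
      rw [h.trace_mul_assoc, h.map_mul_comm, h.trace_mul_assoc]
      exact ha _, fun y => by
      rw [h.trace_mul_assoc]
      exact ha _⟩)
    (fun a ha y => by
      have h1 := ha (A.invol y)
      rw [← A.invol_invol y, ← A.invol_mul, trace_invol ht, h.map_mul_comm, h1]
      exact Subtype.ext (map_zero A.invol))
  rcases hI with hI | hI
  · rw [← Submodule.mem_bot k, ← hI]
    exact hx
  · have h1 : ∀ y, t (1 * y) = 0 := (hI ▸ Submodule.mem_top : (1 : A.carrier) ∈ I)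
    have h2 := h1 1
    rw [mul_one, h.map_one] at h2
    have h3 : (1 : Subring.center A.carrier) = 0 :=
      (invOf_mul_self 2).symm.trans ((congrArg (⅟2 * ·) h2).trans (mul_zero _))
    exact absurd (congrArg Subtype.val h3) one_ne_zero

/-- An invertible element on which the involution is the conjugation is a product of two skew
units. -/
theorem exists_isSkewUnit_mul_eq [Invertible (2 : k)] [Nontrivial A.carrier]
    (ht : ∀ x, (t (A.invol x) : A.carrier) = A.invol (t x)) (h : IsTrace t)
    (hcentral : ∀ a ∈ Set.center A.carrier, A.invol a = a → ∃ c : k, a = c • (1 : A.carrier))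
    (hnd : ∀ x, (∀ y, t (x * y) = 0) → x = 0)
    (hnil : ∀ c ∈ Set.center A.carrier, c * c = 0 → c = 0)
    (hassoc : ¬ ∀ x y z : (isReflection ht h).fixed, associator x y z = 0) {g : A.carrier}
    (hg : A.invol g = conj t g) (hn : IsUnit (nrm t g)) :
    ∃ r s, IsSkewUnit t r ∧ IsSkewUnit t s ∧ r * s = g := by
  set hσ := isReflection ht h with hσ_def
  have hinv : ∀ x : hσ.fixed, A.invol x = conj t x := fun x => by
    have := hσ.apply_coe x
    rw [reflection_apply] at this
    rw [← this, h.conj_conj, this]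
  obtain ⟨t₀, h₀, ht₀⟩ := exists_isTrace_comp h (j := hσ.subtype) hσ.subtype_injective rfl
    (fun _ _ => rfl) fun x => exists_scalar hcentral (by
      rw [← trace_invol ht, hσ.subtype_apply, hinv, h.trace_conj])
  have hnrm := nrm_apply_of_trace (j := hσ.subtype) rfl ht₀ h h₀ fun _ _ => rfl
  have hnd₀ : ∀ x, (∀ y, t₀ (x * y) = 0) → x = 0 := fun x hx => by
    have hx' : ∀ y, t (x * (y + reflection t y)) = 0 := fun y => by
      have := ht₀ (x * ⟨_, hσ.add_mem_fixed y⟩)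
      rwa [hx, scalar_zero] at this
    have hT : ∀ y, t (x * y) + centerInvol (t (x * y)) = 0 := fun y => by
      have h1 : reflection t (x * y) = x * reflection t y := by rw [hσ.map_mul, hσ.apply_coe]
      rw [← trace_invol ht, ← h.trace_conj (A.invol _), ← reflection_apply, h1, ← map_add,
        ← mul_add, hx']
    refine Subtype.ext (hnd x fun y => ?_)
    have h1 := hT (t (x * y) • y)
    rw [mul_smul_comm, map_smul, smul_eq_mul, centerInvol_mul,
      eq_neg_of_add_eq_zero_right (hT y), neg_mul_neg, ← two_mul] at h1
    have h2 : t (x * y) * t (x * y) = 0 := by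
      rw [← invOf_mul_cancel_left (2 : Subring.center A.carrier) (t (x * y) * t (x * y)), h1,
        mul_zero]
    exact Subtype.ext (hnil _ (t (x * y)).2 (congrArg Subtype.val h2))
  have hgσ : reflection t g = g := by rw [reflection_apply, hg, h.conj_conj]
  have hg₀ : nrm t₀ (⟨g, hgσ⟩ : hσ.fixed) ≠ 0 := ne_zero_of_isUnit_scalar (A := A) (by
    rw [← hnrm]
    exact hn)
  have hskew : ∀ r : hσ.fixed, t₀ r = 0 → nrm t₀ r ≠ 0 → IsSkewUnit t (r : A.carrier) :=
    fun r hr hr0 => by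
    have htr : t (r : A.carrier) = 0 := by
      have := ht₀ r
      rwa [hr, scalar_zero] at this
    exact ⟨by rw [hinv, conj_of_trace_eq_zero htr], htr, -nrm t₀ r, neg_ne_zero.2 hr0,
      congrArg Subtype.val (h₀.mul_self_of_trace_eq_zero hr)⟩
  obtain ⟨r, s, hr, hr0, hs, hs0, hrs⟩ := h₀.exists_mul_eq hnd₀ hassoc hg₀
  exact ⟨r, s, hskew r hr hr0, hskew s hs hs0, congrArg Subtype.val hrs⟩

omit [Invertible (2 : Subring.center A.carrier)] in
/-- If there is no nonzero skew central element, then the involution is the conjugation, or the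
algebra is an octonion algebra with a nonstandard involution. -/
theorem invol_eq_conj_or [Invertible (2 : k)] [Nontrivial A.carrier] [Module.Finite k A.carrier]
    (ht : ∀ x, (t (A.invol x) : A.carrier) = A.invol (t x)) (h : IsTrace t)
    (hcentral : ∀ a ∈ Set.center A.carrier, A.invol a = a → ∃ c : k, a = c • (1 : A.carrier))
    (hnd : ∀ x, (∀ y, t (x * y) = 0) → x = 0)
    (hassoc : ¬ ∀ x y z : A, associator x y z = 0)
    (hz : ∀ z : Subring.center A.carrier, centerInvol z = -z → z = 0) :
    (∀ x, A.invol x = conj t x) ∨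
      Module.finrank k A.carrier = 8 ∧ Module.finrank k A.skew = 3 := by
  have hσ := isReflection ht h
  have hsym : ∀ c : Subring.center A.carrier, centerInvol c = c := fun c => by
    rw [← sub_eq_zero]
    refine hz _ (Subtype.ext ?_)
    change A.invol (A.invol c - c) = -(A.invol c - c)
    rw [map_sub, A.invol_invol, neg_sub]
  obtain ⟨t₀, h₀, ht₀⟩ := exists_isTrace_comp h (j := (LinearMap.id : A.carrier →ₗ[k] A.carrier))
    Function.injective_id rfl (fun _ _ => rfl) fun x => exists_scalar hcentral (hsym _)
  have hconj : ∀ x, conj t x = conj t₀ x :=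
    conj_apply_of_trace (j := (LinearMap.id : A.carrier →ₗ[k] A.carrier)) rfl ht₀
  by_cases hne : ∃ x, reflection t x ≠ x
  · refine .inr (finrank_eq_eight h₀ (fun x hx => hnd x fun y => ?_) hassoc hσ
      (fun x => scalar_injective (A := A) ?_) hne fun x => ?_)
    · exact (ht₀ (x * y)).trans (by rw [hx, scalar_zero])
    · rw [← ht₀, ← ht₀, LinearMap.id_apply, LinearMap.id_apply, reflection_apply, h.trace_conj,
        trace_invol ht, hsym]
    · rw [← hconj, reflection_apply, h.conj_conj]
      rfl
  · push Not at hne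
    refine .inl fun x => ?_
    rw [← h.conj_conj (A.invol x), ← reflection_apply, hne]

end AlgebraWithInvolution

namespace AlgebraWithInvolution

open IsAlternativeRing IsTrace

universe v

variable {k : Type v} [Field k] {A : AlgebraWithInvolution k} [IsAlternativeRing A.carrier]

omit [IsAlternativeRing A.carrier] in
/-- A skew central element splits the algebra into two copies of the fixed points of the
reflection. -/
theorem exists_eq_add_smul [Invertible (2 : k)]
    {t : A.carrier →ₗ[Subring.center A.carrier] Subring.center A.carrier}
    (ht : ∀ x, (t (A.invol x) : A.carrier) = A.invol (t x)) (h : IsTrace t)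
    {z : Subring.center A.carrier} (hz : centerInvol z = -z) {d : k} (hd : z * z = A.scalar d)
    (hd0 : d ≠ 0) (x : A.carrier) :
    ∃ a b : (isReflection ht h).fixed, x = a + z • (b : A.carrier) := by
  set hσ := isReflection ht h with hσ_def
  have hsmul : ∀ y, reflection t (z • y) = -(z • reflection t y) := fun y => by
    rw [reflection_apply, invol_center_smul, hz, map_smul, reflection_apply, neg_smul]
  refine ⟨⟨(⅟2 : k) • (x + reflection t x), ?_⟩,
    ⟨(d⁻¹ * ⅟2 : k) • z • (x - reflection t x), ?_⟩, ?_⟩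
  · change reflection t _ = _
    rw [map_smul, map_add, hσ.map_map, add_comm]
  · change reflection t _ = _
    rw [map_smul, hsmul, map_sub, hσ.map_map, ← smul_neg, neg_sub]
  · change x = (⅟2 : k) • (x + reflection t x) + z • (d⁻¹ * ⅟2 : k) • z • (x - reflection t x)
    rw [← scalar_smul (_ * _), smul_comm z, smul_smul z z, hd, scalar_smul, scalar_smul, smul_smul,
      mul_right_comm, inv_mul_cancel₀ hd0, one_mul, half_add_half]

omit [IsAlternativeRing A.carrier] in
theorem fixed_not_assoc [Invertible (2 : k)]
    {t : A.carrier →ₗ[Subring.center A.carrier] Subring.center A.carrier}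
    (ht : ∀ x, (t (A.invol x) : A.carrier) = A.invol (t x)) (h : IsTrace t)
    {z : Subring.center A.carrier}
    (hx : ∀ x : A.carrier, ∃ a b : (isReflection ht h).fixed, x = a + z • (b : A.carrier))
    (hassoc : ¬ ∀ x y z : A, associator x y z = 0) :
    ¬ ∀ x y z : (isReflection ht h).fixed, associator x y z = 0 := fun hf => hassoc fun x y w => by
  have hf' : ∀ a b c : (isReflection ht h).fixed, associator (a : A.carrier) b c = 0 :=
    fun a b c => congrArg Subtype.val (hf a b c)
  obtain ⟨a, b, rfl⟩ := hx x
  obtain ⟨c, d, rfl⟩ := hx y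
  obtain ⟨e, f, rfl⟩ := hx w
  simp only [assoc_add_left, assoc_add_mid, assoc_add_right, assoc_smul_left, assoc_smul_mid,
    assoc_smul_right, hf', smul_zero, add_zero]

/-- In a nonassociative alternative central simple algebra with involution, every element which is
mapped to one by an isotopy is autotopic to one. -/
theorem autotopic_one (hk2 : (2 : k) ≠ 0) (hk3 : (3 : k) ≠ 0) [Module.Finite k A.carrier]
    (hcentral : ∀ a ∈ Set.center A.carrier, A.invol a = a → ∃ c : k, a = c • (1 : A.carrier))
    (hsimple : ∀ I : Submodule k A.carrier,
      (∀ a ∈ I, ∀ x : A.carrier, x * a ∈ I ∧ a * x ∈ I) → (∀ a ∈ I, A.invol a ∈ I) →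
        I = ⊥ ∨ I = ⊤)
    (hassoc : ¬ ∀ x y z : A, associator x y z = 0)
    (hdim : (Module.finrank k A.carrier, Module.finrank k A.skew) ≠ (8, 3)) {u : A.carrier}
    (hu : ∀ w, ∃ y, A.Vop u y u = w) : A.Autotopic 1 u := by
  let _ : Invertible (2 : k) := invertibleOfNonzero hk2
  have htwo : (2 : Subring.center A.carrier) = A.scalar 2 := by
    rw [← one_add_one_eq_two, ← one_add_one_eq_two, scalar_add, scalar_one]
  let _ : Invertible (2 : Subring.center A.carrier) :=
    ⟨A.scalar 2⁻¹, by rw [htwo, ← scalar_mul, inv_mul_cancel₀ hk2, scalar_one],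
      by rw [htwo, ← scalar_mul, mul_inv_cancel₀ hk2, scalar_one]⟩
  have _ : Nontrivial A.carrier := by
    push Not at hassoc
    obtain ⟨x, y, z, hxyz⟩ := hassoc
    exact ⟨_, _, hxyz⟩
  obtain ⟨hnil, t, h, ht⟩ := exists_isTrace hk2 A hcentral hsimple hassoc
  have hn : IsUnit (nrm t u) :=
    have ⟨r, hr⟩ := exists_mul_nrm_eq_one h hcentral hsimple hassoc hnil hu
    .of_mul_eq_one_right r hr
  have hnd := trace_nondegenerate ht h hsimple
  by_cases hz : ∀ z : Subring.center A.carrier, centerInvol z = -z → z = 0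
  · rcases invol_eq_conj_or ht h hcentral hnd hassoc hz with hc | hc
    · obtain ⟨r, s, hr, hs, rfl⟩ := exists_isSkewUnit_mul_eq ht h hcentral hnd hnil
        (fixed_not_assoc ht h (z := 0) (fun x => ⟨⟨x, by
          change reflection t x = x
          rw [reflection_apply, hc, h.conj_conj]⟩, 0, by simp⟩) hassoc) (hc u) hn
      have := (hs.autotopic 1).trans (hr.autotopic _)
      rwa [mul_one] at this
    · exact absurd (Prod.ext hc.1 hc.2) hdim
  · push Not at hz
    obtain ⟨z, hz, hz0⟩ := hz
    obtain ⟨d, hd⟩ := exists_scalar hcentral (c := z * z) (by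
      rw [centerInvol_mul, hz, neg_mul_neg])
    have hd0 : d ≠ 0 := by
      rintro rfl
      rw [scalar_zero] at hd
      exact hz0 (Subtype.ext (hnil z z.2 (congrArg Subtype.val hd)))
    have hx := exists_eq_add_smul ht h hz hd hd0
    have hinv : ∀ x : (isReflection ht h).fixed, A.invol x = conj t x := fun x => by
      have := (isReflection ht h).apply_coe x
      rw [reflection_apply] at this
      rw [← this, h.conj_conj, this]
    obtain ⟨a, b, rfl⟩ := hx u
    exact autotopic_one_of_center hk2 hk3 ht h hcentral
      (fun g => exists_isSkewUnit_mul_eq ht h hcentral hnd hnil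
        (fixed_not_assoc ht h hx hassoc)) hz hd hd0 (hinv a) (hinv b) hn

end AlgebraWithInvolution

/-- Let `k` be a field of characteristic not 2 or 3 and let `(A,−)`, `(A′,−)`
be central simple `k`-algebras with involution such that `A` is alternative and
`(dim A, dim Skew(A,−)) ≠ (8,3)`.  Then `(A,−)` and `(A′,−)` are isotopic iff they are
isomorphic as algebras with involution. -/
theorem alternative_isotopic_iff_isomorphic
    {k : Type u} [Field k] (hk2 : (2 : k) ≠ 0) (hk3 : (3 : k) ≠ 0)
    (A A' : AlgebraWithInvolution k)
    [Module.Finite k A.carrier] [Module.Finite k A'.carrier]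
    -- `(A,−)` is central:
    (hAcentral : ∀ a ∈ Set.center A.carrier, A.invol a = a → ∃ c : k, a = c • (1 : A.carrier))
    -- `(A,−)` is simple (no proper nonzero involution-stable two-sided ideal):
    (hAsimple : ∀ I : Submodule k A.carrier,
      (∀ a ∈ I, ∀ x : A.carrier, x * a ∈ I ∧ a * x ∈ I) → (∀ a ∈ I, A.invol a ∈ I) →
        I = ⊥ ∨ I = ⊤)
    -- `(A′,−)` is central:
    (hA'central : ∀ a ∈ Set.center A'.carrier, A'.invol a = a → ∃ c : k, a = c • (1 : A'.carrier))
    -- `(A′,−)` is simple: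
    (hA'simple : ∀ I : Submodule k A'.carrier,
      (∀ a ∈ I, ∀ x : A'.carrier, x * a ∈ I ∧ a * x ∈ I) → (∀ a ∈ I, A'.invol a ∈ I) →
        I = ⊥ ∨ I = ⊤)
    -- `A` is alternative:
    (hAalt : ∀ x y : A.carrier, x * (x * y) = (x * x) * y ∧ (y * x) * x = y * (x * x))
    -- `(dim A, dim Skew(A,−)) ≠ (8,3)`:
    (hdim : (Module.finrank k A.carrier, Module.finrank k A.skew) ≠ (8, 3)) :
    A.IsIsotopic A' ↔ Nonempty (A.Iso A') := by
  refine ⟨fun ⟨f⟩ => ?_, fun ⟨e⟩ => ⟨e.toIsotopy⟩⟩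
  have _ : IsAlternativeRing A.carrier :=
    ⟨fun x y => (hAalt x y).1, fun x y => (hAalt x y).2⟩
  by_cases hassoc : ∀ x y z : A, associator x y z = 0
  · exact f.nonempty_iso_of_assoc hk3 hassoc
  · obtain ⟨g, hg⟩ := AlgebraWithInvolution.autotopic_one hk2 hk3 hAcentral hAsimple hassoc hdim
      (f.exists_Vop_eq hk3)
    exact f.nonempty_iso hk3 g hg
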